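/- arXiv:math/0106254 — 2 statements merged into one kernel-verified Lean document; each statement's English description precedes it below -/
import Mathlib

section
/- Let H be a semisimple Hopf algebra over an algebraically closed field of characteristic zero. If the dimension of H is even, then the exponent of H is even. -/
open TensorProduct LinearMap Coalgebra

/-- The `m`-th Sweedler power `h ↦ h₍₁₎ h₍₂₎ ⋯ h₍ₘ₎`, where `h₍₁₎ ⊗ ⋯ ⊗ h₍ₘ₎` is the
iterated comultiplication: for `m = 0` it is `ε(h)1`, and inductively
`h ↦ ∑ h₍₁₎ * ((m)-th power of h₍₂₎)`. -/
noncomputable def sweedlerPow (K H : Type*) [Field K] [Ring H] [HopfAlgebra K H] :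
    ℕ → (H →ₗ[K] H)
  | 0 => Algebra.linearMap K H ∘ₗ Coalgebra.counit
  | n + 1 => LinearMap.mul' K H ∘ₗ (sweedlerPow K H n).lTensor H ∘ₗ Coalgebra.comul

namespace EvenExp
open HopfAlgebra WithConv

section conv
variable {K H : Type*} [Field K] [Ring H] [HopfAlgebra K H]

/-- `h ↦ h ⊗ 1`. -/
noncomputable def i1 (K H : Type*) [Field K] [Ring H] [HopfAlgebra K H] : H →ₐ[K] H ⊗[K] H :=
  Algebra.TensorProduct.includeLeft
/-- `h ↦ 1 ⊗ h`. -/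
noncomputable def i2 (K H : Type*) [Field K] [Ring H] [HopfAlgebra K H] : H →ₐ[K] H ⊗[K] H :=
  Algebra.TensorProduct.includeRight

@[simp] lemma i1_apply (h : H) : i1 K H h = h ⊗ₜ 1 := rfl
@[simp] lemma i2_apply (h : H) : i2 K H h = 1 ⊗ₜ h := rfl

lemma conv_i1_i2 : toConv (i1 K H).toLinearMap * toConv (i2 K H).toLinearMap =
    toConv (comul : H →ₗ[K] H ⊗[K] H) := by
  ext h
  rw [(ℛ K h).convMul_apply]
  simp [(ℛ K h).eq]

lemma conv_algHom_left {A : Type*} [Ring A] [Algebra K A] (φ : H →ₐ[K] A) :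
    toConv (φ.toLinearMap ∘ₗ antipode K) * toConv φ.toLinearMap = 1 := by
  have := algHom_comp_convMul_distrib φ (toConv (antipode K (A := H))) (toConv LinearMap.id)
  rw [antipode_mul_id] at this
  apply WithConv.ofConv_injective
  simp only [LinearMap.comp_id] at this
  rw [← this]
  ext h
  simp [LinearMap.convOne_def]

lemma conv_algHom_right {A : Type*} [Ring A] [Algebra K A] (φ : H →ₐ[K] A) :
    toConv φ.toLinearMap * toConv (φ.toLinearMap ∘ₗ antipode K) = 1 := by
  have := algHom_comp_convMul_distrib φ (toConv LinearMap.id) (toConv (antipode K (A := H)))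
  rw [id_mul_antipode] at this
  apply WithConv.ofConv_injective
  simp only [LinearMap.comp_id] at this
  rw [← this]
  ext h
  simp [LinearMap.convOne_def]

lemma key1 : toConv ((i1 K H).toLinearMap ∘ₗ antipode K) * toConv (comul : H →ₗ[K] H ⊗[K] H)
    = toConv (i2 K H).toLinearMap := by
  rw [← conv_i1_i2, ← mul_assoc, conv_algHom_left, one_mul]

lemma key3 : toConv (comul : H →ₗ[K] H ⊗[K] H) * toConv ((i2 K H).toLinearMap ∘ₗ antipode K)
    = toConv (i1 K H).toLinearMap := by
  rw [← conv_i1_i2, mul_assoc, conv_algHom_right, mul_one]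

lemma comul_antipode_conv : toConv ((comul : H →ₗ[K] H ⊗[K] H) ∘ₗ antipode K) =
    toConv ((i2 K H).toLinearMap ∘ₗ antipode K) * toConv ((i1 K H).toLinearMap ∘ₗ antipode K) := by
  refine (left_inv_eq_right_inv (a := toConv (comul : H →ₗ[K] H ⊗[K] H)) ?_ comul_right_inv).symm
  rw [mul_assoc, key1, conv_algHom_left]

lemma comul_antipode (h : H) : comul (R := K) (antipode K h) =
    TensorProduct.map (antipode K) (antipode K) (TensorProduct.comm K H H (comul h)) := by
  have := congr($(comul_antipode_conv (K := K) (H := H)) h)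
  rw [(ℛ K h).convMul_apply] at this
  simpa [← (ℛ K h).eq] using this

lemma key2 : toConv ((comul : H →ₗ[K] H ⊗[K] H) ∘ₗ antipode K) * toConv (i1 K H).toLinearMap
    = toConv ((i2 K H).toLinearMap ∘ₗ antipode K) := by
  rw [comul_antipode_conv, mul_assoc, conv_algHom_left, mul_one]

variable (K) in
/-- The square of the antipode. -/
noncomputable def S2 : H →ₗ[K] H := antipode K ∘ₗ antipode K

lemma S2_apply (h : H) : S2 K h = antipode K (antipode K h) := rfl

lemma S2_mul (a b : H) : S2 K (a * b) = S2 K a * S2 K b := by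
  simp [S2_apply, antipode_mul_antidistrib]

lemma S2_one : S2 K (1 : H) = 1 := by simp [S2_apply]

lemma comul_S2 (h : H) : comul (R := K) (S2 K h) = TensorProduct.map (S2 K) (S2 K) (comul h) := by
  rw [S2_apply, comul_antipode, comul_antipode, ← (ℛ K h).eq]
  simp [S2_apply]

/-- `h ↦ f(h₁) h₂`. -/
noncomputable def Lf (f : H →ₗ[K] K) : H →ₗ[K] H :=
  (TensorProduct.lid K H).toLinearMap ∘ₗ f.rTensor H ∘ₗ comul
/-- `h ↦ h₁ f(h₂)`. -/
noncomputable def Rf (f : H →ₗ[K] K) : H →ₗ[K] H :=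
  (TensorProduct.rid K H).toLinearMap ∘ₗ f.lTensor H ∘ₗ comul

lemma Lf_repr {ι} {h : H} (r : Repr K h ι) (f : H →ₗ[K] K) :
    Lf f h = ∑ i ∈ r.index, f (r.left i) • r.right i := by
  simp [Lf, ← r.eq]
lemma Rf_repr {ι} {h : H} (r : Repr K h ι) (f : H →ₗ[K] K) :
    Rf f h = ∑ i ∈ r.index, f (r.right i) • r.left i := by
  simp [Rf, ← r.eq]

lemma S_comp_Lf (f : H →ₗ[K] K) (h : H) :
    antipode K (Lf (f ∘ₗ antipode K) h) = Rf f (antipode K h) := by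
  simp [Lf, Rf, comul_antipode, ← (ℛ K h).eq]

lemma Rf_S (f : H →ₗ[K] K) (h : H) :
    Rf f (antipode K h) = antipode K (Lf (f ∘ₗ antipode K) h) := (S_comp_Lf f h).symm

/-- commutation of left and right actions -/
lemma Lf_Rf (f g : H →ₗ[K] K) (h : H) : Lf f (Rf g h) = Rf g (Lf f h) := by
  have := congr((TensorProduct.lid K H).toLinearMap (TensorProduct.map f
    ((TensorProduct.rid K H).toLinearMap ∘ₗ g.lTensor H) $(coassoc_apply (R := K) h)))
  rw [← (ℛ K h).eq] at this
  simp only [map_sum] at this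
  simp only [Rf, Lf, LinearMap.comp_apply, ← (ℛ K h).eq, map_sum] at this ⊢
  simp at this ⊢
  rw [← this]
  refine Finset.sum_congr rfl fun i _ => ?_
  simp [← (ℛ K ((ℛ K h).left i)).eq, TensorProduct.sum_tmul, Finset.smul_sum,smul_smul, mul_comm]


lemma Lf_comp (f g : H →ₗ[K] K) (h : H) :
    Lf g (Lf f h) = Lf (toConv f * toConv g).ofConv h := by
  have := congr((TensorProduct.lid K H).toLinearMap (TensorProduct.map f
    ((TensorProduct.lid K H).toLinearMap ∘ₗ g.rTensor H) $(coassoc_apply (R := K) h)))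
  rw [← (ℛ K h).eq] at this
  simp only [map_sum] at this
  simp only [Lf, LinearMap.comp_apply, ← (ℛ K h).eq, map_sum] at this ⊢
  simp at this ⊢
  rw [← this]
  refine Finset.sum_congr rfl fun i _ => ?_
  rw [← LinearMap.convMul_apply]
  simp [(ℛ K ((ℛ K h).left i)).convMul_apply, ← (ℛ K ((ℛ K h).left i)).eq,
    TensorProduct.sum_tmul, Finset.sum_smul, smul_smul]
  exact Finset.sum_congr rfl fun _ _ => by rw [mul_comm]

lemma Lf_counit (h : H) : Lf (counit (R := K)) h = h := by
  simp [Lf]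
lemma Rf_counit (h : H) : Rf (counit (R := K)) h = h := by
  simp [Rf]

lemma Lf_smul (c : K) (f : H →ₗ[K] K) : Lf (c • f) = c • Lf f := by
  ext h; simp [Lf_repr (ℛ K h), Finset.smul_sum, smul_smul]

lemma Lf_sum {ι} (s : Finset ι) (f : ι → H →ₗ[K] K) (h : H) :
    Lf (∑ i ∈ s, f i) h = ∑ i ∈ s, Lf (f i) h := by
  simp [Lf_repr (ℛ K h), Finset.sum_smul]
  rw [Finset.sum_comm]

lemma dual_swap (f g : H →ₗ[K] K) (h : H) : f (Rf g h) = g (Lf f h) := by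
  simp [Lf_repr (ℛ K h), Rf_repr (ℛ K h), mul_comm]

variable (K) in
/-- The functional `h ↦ Tr (x ↦ h S²(x))`. -/
noncomputable def lam : H →ₗ[K] K :=
  LinearMap.trace K H ∘ₗ LinearMap.lcomp K H (S2 K) ∘ₗ LinearMap.mul K H

lemma lam_apply (h : H) : lam K h = LinearMap.trace K H (LinearMap.mulLeft K h ∘ₗ S2 K) := rfl

section fd
variable [FiniteDimensional K H]

lemma lam_Lf (f : H →ₗ[K] K) (h : H) : lam K (Lf f h) = f 1 * lam K h := by
  let b := Module.finBasis K H
  let fj := fun j => f ∘ₗ LinearMap.mulRight K (b j)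
  have hf : ∀ u v : H, f (u * v) = ∑ j, b.coord j v * fj j u := by
    intro u v
    conv_lhs => rw [← b.sum_repr v]
    rw [Finset.mul_sum, map_sum]
    simp [fj, -Module.Basis.sum_repr]
  let G := fun j => Lf (fj j) ∘ₗ LinearMap.mulLeft K h ∘ₗ S2 K
  let B := fun j => Lf (b.coord j ∘ₗ antipode K)
  have C2 : ∑ j, B j ∘ₗ G j = f 1 • (LinearMap.mulLeft K h ∘ₗ S2 K) := by
    ext x
    simp only [LinearMap.sum_apply, LinearMap.comp_apply, G, B, LinearMap.smul_apply]
    generalize (mulLeft K h) (S2 K x) = w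
    simp only [Lf_comp, ← Lf_sum]
    have : ∑ j, (toConv (fj j) * toConv (b.coord j ∘ₗ antipode K)).ofConv = f 1 • counit := by
      ext w
      simp only [LinearMap.sum_apply]
      have h1 : ∀ j, (toConv (fj j) * toConv (b.coord j ∘ₗ antipode K)).ofConv w =
        ∑ i ∈ (ℛ K w).index, fj j ((ℛ K w).left i) * b.coord j (antipode K ((ℛ K w).right i)) :=
        fun j => (ℛ K w).convMul_apply _ _
      simp only [h1]
      rw [Finset.sum_comm]
      simp only [mul_comm (fj _ _), ← hf]
      rw [← map_sum, sum_mul_antipode_eq_smul]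
      simp [mul_comm]
    rw [this, Lf_smul, LinearMap.smul_apply, Lf_counit]
  have C1 : ∑ j, G j ∘ₗ B j = LinearMap.mulLeft K (Lf f h) ∘ₗ S2 K := by
    ext x
    simp only [LinearMap.sum_apply, LinearMap.comp_apply, G, B, S2_apply, S_comp_Lf]
    generalize antipode K x = w
    have h1 : ∀ (t : H ⊗[K] H) (r : H), TensorProduct.lid K H (f.rTensor H (t * (r ⊗ₜ 1))) =
        ∑ j, b.coord j r • TensorProduct.lid K H ((fj j).rTensor H t) := by
      intro t r
      induction t with
      | zero => simp
      | add x y hx hy => simp only [add_mul, map_add, hx, hy, smul_add, Finset.sum_add_distrib]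
      | tmul x y => simp [hf, Finset.sum_smul, smul_smul]
    have h2 := congr(TensorProduct.lid K H (f.rTensor H (comul h * $(key2 (K := K) (H := H)) w)))
    rw [(ℛ K w).convMul_apply] at h2
    have h3 : TensorProduct.lid K H (f.rTensor H (comul h * (1 ⊗ₜ[K] antipode K w))) =
        Lf f h * antipode K w := by
      rw [Lf, LinearMap.comp_apply, LinearMap.comp_apply]
      generalize (comul h : H ⊗[K] H) = t
      induction t with
      | zero => simp
      | add x y hx hy => simp only [add_mul, map_add, hx, hy]
      | tmul x y => simp
    simp only [mulLeft_apply]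
    rw [← h3]
    refine Eq.trans ?_ h2
    simp only [Finset.mul_sum, map_sum, ← mul_assoc]
    simp [h1, Rf_repr (ℛ K w), Finset.mul_sum]
    rw [Finset.sum_comm]
    simp [Lf]
  have := congr(LinearMap.trace K H $C1)
  rw [lam_apply, ← this, map_sum]
  rw [Finset.sum_congr rfl fun j _ => LinearMap.trace_comp_comm' (B j) (G j)]
  rw [← map_sum, C2, map_smul, lam_apply, smul_eq_mul]

lemma eq_of_dual {x y : H} (hxy : ∀ f : H →ₗ[K] K, f x = f y) : x = y := by
  rw [← sub_eq_zero]
  exact ((Module.forall_dual_apply_eq_zero_iff K (x - y)).1 fun f => by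
    rw [map_sub, hxy f, sub_self])

lemma Rf_lam (h : H) : Rf (lam K) h = lam K h • 1 := by
  apply eq_of_dual (K := K)
  intro f
  rw [dual_swap, lam_Lf]
  simp [mul_comm]

lemma lam_mul (a b : H) : lam K (a * b) = lam K (b * S2 K a) := by
  rw [lam_apply, lam_apply]
  have h1 : LinearMap.mulLeft K (b * S2 K a) ∘ₗ S2 K =
      (LinearMap.mulLeft K b ∘ₗ S2 K) ∘ₗ LinearMap.mulLeft K a := by
    ext x; simp [S2_mul, mul_assoc]
  rw [h1]
  refine Eq.trans ?_ (LinearMap.trace_comp_comm' (LinearMap.mulLeft K a)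
    (LinearMap.mulLeft K b ∘ₗ S2 K)).symm
  congr 1
  ext x; simp [mul_assoc]

end fd
end conv
end EvenExp
namespace EvenExp
open Polynomial

lemma transfer {K L : Type*} [Field K] [CharZero K] [Field L] [CharZero L] {N : ℕ} (hN : 0 < N)
    {ζ : K} (hζ : IsPrimitiveRoot ζ N) {ζ' : L} (hζ' : IsPrimitiveRoot ζ' N) (Q : ℤ[X])
    (h : aeval ζ Q = 0) : aeval ζ' Q = 0 := by
  have h1 := minpoly.isIntegrallyClosed_dvd (hζ.isIntegral hN) h
  rw [← cyclotomic_eq_minpoly hζ hN, cyclotomic_eq_minpoly hζ' hN] at h1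
  obtain ⟨R, rfl⟩ := h1
  simp

lemma cyc_dvd {K : Type*} [Field K] [CharZero K] {N : ℕ} (hN : 0 < N)
    {ζ : K} (hζ : IsPrimitiveRoot ζ N) (Q : ℤ[X])
    (h : aeval ζ Q = 0) : cyclotomic N ℤ ∣ Q := by
  rw [cyclotomic_eq_minpoly hζ hN]
  exact minpoly.isIntegrallyClosed_dvd (hζ.isIntegral hN) h

lemma tracePoly {K V : Type*} [Field K] [CharZero K] [AddCommGroup V] [Module K V]
    [FiniteDimensional K V] {N : ℕ} (hN : 0 < N) {ζ : K} (hζ : IsPrimitiveRoot ζ N)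
    (f : Module.End K V) (hf : f ^ N = 1) :
    ∃ P : ℤ[X], P.eval 1 = Module.finrank K V ∧
      ∀ k : ℕ, LinearMap.trace K V (f ^ k) = aeval (ζ ^ k) P := by
  have hN0 : (N : K) ≠ 0 := by exact_mod_cast hN.ne'
  have hζ0 : ζ ≠ 0 := hζ.ne_zero hN.ne'
  let y : ℕ → Module.End K V := fun j => (ζ⁻¹ ^ j) • f
  let p : ℕ → Module.End K V := fun j => (N : K)⁻¹ • ∑ k ∈ Finset.range N, y j ^ k
  have hy : ∀ j, y j ^ N = 1 := fun j => by
    simp only [y]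
    rw [_root_.smul_pow, hf, ← pow_mul, mul_comm, pow_mul, inv_pow, hζ.pow_eq_one]; simp
  have hyp : ∀ j, y j * p j = p j := fun j => by
    have := mul_geom_sum (y j) N
    rw [hy, sub_self, sub_mul, one_mul, sub_eq_zero] at this
    simp only [p, mul_smul_comm, this]
  have hfp : ∀ j, f * p j = ζ ^ j • p j := fun j => by
    conv_rhs => rw [← hyp]
    simp only [y, smul_mul_assoc, smul_smul]
    rw [← mul_pow, mul_inv_cancel₀ hζ0, one_pow, one_smul]
  have hfkp : ∀ j k, f ^ k * p j = (ζ ^ k) ^ j • p j := fun j k => by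
    induction k with
    | zero => simp
    | succ k ih =>
      rw [pow_succ', mul_assoc, ih, mul_smul_comm, hfp, smul_smul]; congr 1; ring
  have hykp : ∀ j k, y j ^ k * p j = p j := fun j k => by
    induction k with
    | zero => simp
    | succ k ih => rw [pow_succ, mul_assoc, hyp, ih]
  have hid : ∀ j, IsIdempotentElem (p j) := fun j => by
    unfold IsIdempotentElem
    conv_lhs => enter [1]; simp only [p]
    rw [smul_mul_assoc, Finset.sum_mul]
    simp only [hykp]
    rw [Finset.sum_const, Finset.card_range, ← Nat.cast_smul_eq_nsmul K, smul_smul,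
      inv_mul_cancel₀ hN0, one_smul]
  have hsum : ∑ j ∈ Finset.range N, p j = 1 := by
    simp only [p, ← Finset.smul_sum, y, _root_.smul_pow]
    rw [Finset.sum_comm]
    rw [Finset.sum_eq_single 0]
    · simp only [pow_zero, one_smul, Finset.sum_const, Finset.card_range]
      rw [← Nat.cast_smul_eq_nsmul K, smul_smul, inv_mul_cancel₀ hN0, one_smul]
    · intro k hk hk0
      rw [← Finset.sum_smul]
      have h1 : ∑ i ∈ Finset.range N, (ζ⁻¹ ^ i) ^ k = 0 := by
        have := mul_geom_sum (ζ⁻¹ ^ k) N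
        have h2 : (ζ⁻¹ ^ k) ^ N = 1 := by
          rw [← pow_mul, mul_comm, pow_mul, inv_pow, hζ.pow_eq_one]; simp
        rw [h2, sub_self, mul_eq_zero] at this
        rcases this with h | h
        · rw [sub_eq_zero, inv_pow, inv_eq_one] at h
          exact absurd h (hζ.pow_ne_one_of_pos_of_lt hk0 (Finset.mem_range.1 hk))
        · rw [← h]; exact Finset.sum_congr rfl fun i _ => by rw [← pow_mul, ← pow_mul, mul_comm]
      rw [h1, zero_smul]
    · intro h; exact absurd (Finset.mem_range.2 hN) h
  have htr : ∀ j, ∃ m : ℕ, LinearMap.trace K V (p j) = m := fun j => by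
    exact ⟨_, LinearMap.IsProj.trace ((LinearMap.isProj_range_iff_isIdempotentElem _).2 (hid j))⟩
  choose m hm using htr
  have key : ∀ k : ℕ, LinearMap.trace K V (f ^ k) =
      aeval (ζ ^ k) (∑ j ∈ Finset.range N, (m j : ℤ[X]) * X ^ j) := fun k => by
    conv_lhs => rw [← mul_one (f ^ k), ← hsum, Finset.mul_sum]
    simp [hfkp, hm, mul_comm]
  refine ⟨_, ?_, key⟩
  have h0 := key 0
  rw [pow_zero, pow_zero, LinearMap.trace_one] at h0
  simp [eval_finsetSum] at h0 ⊢
  exact_mod_cast h0.symm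

end EvenExp
namespace EvenExp
open Polynomial
lemma tr_sandwich {K V : Type*} [Field K] [AddCommGroup V] [Module K V] [FiniteDimensional K V]
    (A B : Module.End K V) : LinearMap.trace K (Module.End K V)
      (LinearMap.mulLeft K A ∘ₗ LinearMap.mulRight K B) =
      LinearMap.trace K V A * LinearMap.trace K V B := by
  rw [← LinearMap.trace_transpose' B, mul_comm, ← LinearMap.trace_tensorProduct']
  refine Eq.trans ?_ (LinearMap.trace_conj' (M := TensorProduct K (Module.Dual K V) V)
    (N := Module.End K V) _ (dualTensorHomEquiv K V V))
  congr 1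
  apply LinearMap.ext
  intro x
  obtain ⟨t, rfl⟩ := (dualTensorHomEquiv K V V).surjective x
  rw [LinearEquiv.conj_apply_apply, LinearEquiv.symm_apply_apply]
  induction t with
  | zero => simp
  | add x y hx hy => simp only [map_add, hx, hy]
  | tmul f v =>
    ext w
    simp [dualTensorHomEquiv, Module.Dual.transpose]

lemma central_idem {K V : Type*} [Field K] [AddCommGroup V] [Module K V]
    [Nontrivial V] (e : Module.End K V) (hc : ∀ x, x * e = e * x) (hi : e * e = e) :
    e = 0 ∨ e = 1 := by
  have h : e ∈ Subalgebra.center K (Module.End K V) := by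
    rw [Subalgebra.mem_center_iff]; exact hc
  rw [Algebra.IsCentral.center_eq_bot, Algebra.mem_bot] at h
  obtain ⟨c, rfl⟩ := h
  rw [← map_mul] at hi
  have := (algebraMap K (Module.End K V)).injective hi
  rcases (IsIdempotentElem.iff_eq_zero_or_one (p := c)).1 this with h | h <;> simp [h]

lemma block {K V : Type*} [Field K] [IsAlgClosed K] [CharZero K] [AddCommGroup V] [Module K V]
    [FiniteDimensional K V] [Nontrivial V] {N : ℕ} (hN : 0 < N) {ζ : K} (hζ : IsPrimitiveRoot ζ N)
    (F : Module.End K (Module.End K V)) (hmul : ∀ x y, F (x * y) = F x * F y)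
    (h1 : ∀ x, x * F 1 = F 1 * x) (hF : F 1 = 1 → F ^ N = 1) :
    ∃ (P : ℤ[X]) (τ : Module.End K V → K), τ 1 = aeval ζ P ∧ ∀ a,
      LinearMap.trace K (Module.End K V) (LinearMap.mulLeft K a ∘ₗ F) =
        τ a * aeval (ζ ^ (N - 1)) P := by
  rcases central_idem (F 1) h1 (by rw [← hmul, one_mul]) with h0 | h0
  · refine ⟨0, 0, by simp, fun a => ?_⟩
    have : F = 0 := by
      ext1 x
      rw [← mul_one x, hmul, h0, mul_zero]; rfl
    simp [this]
  have hFN := hF h0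
  have hN1 : N - 1 + 1 = N := by omega
  let Fe : Module.End K V ≃ₐ[K] Module.End K V :=
    AlgEquiv.ofAlgHom (AlgHom.ofLinearMap F h0 hmul)
      (AlgHom.ofLinearMap (F ^ (N - 1))
        (by
          have : ∀ k, (F ^ k) 1 = 1 := fun k => by
            induction k with
            | zero => rfl
            | succ k ih => rw [pow_succ, Module.End.mul_apply, h0, ih]
          exact this _)
        (by
          have : ∀ k x y, (F ^ k) (x * y) = (F ^ k) x * (F ^ k) y := fun k => by
            induction k with
            | zero => intros; rfl
            | succ k ih => intro x y; simp only [pow_succ, Module.End.mul_apply, hmul, ih]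
          exact this _))
      (by
        ext1 x
        change (F * F ^ (N - 1)) x = x
        rw [← pow_succ', hN1, hFN]; rfl)
      (by
        ext1 x
        change (F ^ (N - 1) * F) x = x
        rw [← pow_succ, hN1, hFN]; rfl)
  obtain ⟨T, hT⟩ := AlgEquiv.eq_linearEquivConjAlgEquiv Fe
  have hFT : ∀ x, F x = T.toLinearMap * x * T.symm.toLinearMap := fun x => by
    have := congr($hT x)
    rw [LinearEquiv.conjAlgEquiv_apply] at this
    rw [mul_assoc]
    exact this
  set t : Module.End K V := T.toLinearMap
  set s : Module.End K V := T.symm.toLinearMap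
  have hts : t * s = 1 := by ext x; simp [t, s]
  have hst : s * t = 1 := by ext x; simp [t, s]
  have hFk : ∀ k x, (F ^ k) x = t ^ k * x * s ^ k := fun k => by
    induction k with
    | zero => simp
    | succ k ih =>
      intro x
      rw [pow_succ, Module.End.mul_apply, hFT, ih, pow_succ t, pow_succ' s]; noncomm_ring
  have hcomm : Commute s t := by rw [Commute, SemiconjBy, hts, hst]
  have hsk : ∀ k, s ^ k * t ^ k = 1 := fun k => by
    rw [← hcomm.mul_pow, hst, one_pow]
  have hcen : t ^ N ∈ Subalgebra.center K (Module.End K V) := by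
    rw [Subalgebra.mem_center_iff]
    intro b
    have := hFk N b
    rw [hFN, Module.End.one_apply] at this
    conv_lhs => rw [this]
    rw [mul_assoc, hsk, mul_one]
  rw [Algebra.IsCentral.center_eq_bot, Algebra.mem_bot] at hcen
  obtain ⟨c, hc⟩ := hcen
  obtain ⟨r, hr⟩ := IsAlgClosed.exists_pow_nat_eq c hN
  have hc0 : c ≠ 0 := by
    rintro rfl
    have := hsk N
    rw [← hc] at this
    simp at this
  have hr0 : r ≠ 0 := by
    rintro rfl
    rw [zero_pow hN.ne'] at hr; exact hc0 hr.symm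
  set g : Module.End K V := r⁻¹ • t
  have hgN : g ^ N = 1 := by
    simp only [g]
    rw [_root_.smul_pow, ← hc, Algebra.algebraMap_eq_smul_one, smul_smul, inv_pow, hr,
      inv_mul_cancel₀ hc0, one_smul]
  have hginv : g ^ (N - 1) = r • s := by
    have h1 : g * (r • s) = 1 := by
      simp [g, smul_smul, hr0, hts]
    calc g ^ (N - 1) = g ^ (N - 1) * (g * (r • s)) := by rw [h1, mul_one]
      _ = r • s := by rw [← mul_assoc, ← pow_succ, hN1, hgN, one_mul]
  obtain ⟨P, -, hP⟩ := tracePoly hN hζ g hgN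
  refine ⟨P, fun a => LinearMap.trace K V (a * g), ?_, fun a => ?_⟩
  · simpa using hP 1
  · rw [← hP, hginv, ← tr_sandwich]
    congr 1
    ext1 x
    simp only [LinearMap.comp_apply, LinearMap.mulLeft_apply, LinearMap.mulRight_apply, hFT, g]
    simp only [mul_smul_comm, smul_mul_assoc, smul_smul]
    rw [mul_inv_cancel₀ hr0, one_smul]
    noncomm_ring
end EvenExp
namespace EvenExp
open Polynomial

lemma trace_pi {K ι : Type*} [Field K] [Fintype ι] [DecidableEq ι] (B : ι → Type*)
    [∀ i, AddCommGroup (B i)] [∀ i, Module K (B i)] [∀ i, FiniteDimensional K (B i)]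
    (f : Module.End K (∀ i, B i)) : LinearMap.trace K _ f =
      ∑ i, LinearMap.trace K (B i) (LinearMap.proj i ∘ₗ f ∘ₗ LinearMap.single K B i) := by
  have h : ∑ i, LinearMap.single K B i ∘ₗ LinearMap.proj i ∘ₗ f = f := by
    refine LinearMap.ext fun x => funext fun j => ?_
    simp only [LinearMap.sum_apply, LinearMap.comp_apply, Finset.sum_apply]
    rw [Finset.sum_eq_single j]
    · simp
    · intro i _ hij; simp [Pi.single_eq_of_ne hij.symm]
    · simp
  conv_lhs => rw [← h, map_sum]
  refine Finset.sum_congr rfl fun i _ => ?_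
  exact LinearMap.trace_comp_comm' (LinearMap.proj i ∘ₗ f) (LinearMap.single K B i)

lemma pos_pi {K ι : Type*} [Field K] [IsAlgClosed K] [CharZero K] [Fintype ι] [DecidableEq ι]
    (V : ι → Type*) [∀ i, AddCommGroup (V i)] [∀ i, Module K (V i)]
    [∀ i, FiniteDimensional K (V i)] [∀ i, Nontrivial (V i)] {N : ℕ} (hN : 0 < N)
    (σ : Module.End K (∀ i, Module.End K (V i))) (hmul : ∀ x y, σ (x * y) = σ x * σ y)
    (hσ : σ ^ N = 1) (htr : LinearMap.trace K _ σ = 0) (a : ∀ i, Module.End K (V i)) :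
    LinearMap.trace K _ (LinearMap.mulLeft K a ∘ₗ σ) = 0 := by
  have hN1 : N - 1 + 1 = N := by omega
  have : NeZero N := ⟨hN.ne'⟩
  obtain ⟨ζ, hζ⟩ := HasEnoughRootsOfUnity.exists_primitiveRoot K N
  have hs1 : ∀ i (x y : Module.End K (V i)), LinearMap.single K (fun i => Module.End K (V i)) i (x * y) =
      LinearMap.single K (fun i => Module.End K (V i)) i x * LinearMap.single K (fun i => Module.End K (V i)) i y := by
    intro i x y
    simp [Pi.single_mul]
  let F : ∀ i, Module.End K (Module.End K (V i)) := fun i =>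
    LinearMap.proj i ∘ₗ σ ∘ₗ LinearMap.single K (fun i => Module.End K (V i)) i
  have hsurj : ∀ x, ∃ y, σ y = x := fun x => ⟨(σ ^ (N - 1)) x, by
    rw [← Module.End.mul_apply, ← pow_succ', hN1, hσ]; rfl⟩
  have hF : ∀ i, ∃ (P : ℤ[X]) (τ : Module.End K (V i) → K), τ 1 = aeval ζ P ∧ ∀ a,
      LinearMap.trace K (Module.End K (V i)) (LinearMap.mulLeft K a ∘ₗ F i) =
        τ a * aeval (ζ ^ (N - 1)) P := by
    intro i
    apply block hN hζ
    · intro x y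
      simp only [F, LinearMap.comp_apply, hs1, hmul]; rfl
    · intro x
      obtain ⟨y, hy⟩ := hsurj (Pi.single i x)
      have h1 : y * Pi.single i 1 = Pi.single i 1 * y := by
        ext j : 1
        by_cases h : j = i
        · subst h; simp
        · simp [Pi.single_eq_of_ne h]
      have h2 := congr(σ $h1 i)
      rw [hmul, hmul, hy] at h2
      simp only [Pi.mul_apply, Pi.single_eq_same] at h2
      exact h2
    · intro h1
      have hk : ∀ k x, (F i ^ k) x = (σ ^ k) (Pi.single i x) i := by
        intro k
        induction k with
        | zero => intro x; simp
        | succ k ih =>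
          intro x
          rw [pow_succ', Module.End.mul_apply, ih]
          have h3 : Pi.single i ((σ ^ k) (Pi.single i x) i) =
              Pi.single i 1 * (σ ^ k) (Pi.single i x) := by
            ext j : 1
            by_cases h : j = i
            · subst h; simp
            · simp [Pi.single_eq_of_ne h]
          have h4 : F i ((σ ^ k) (Pi.single i x) i) =
            σ (Pi.single i ((σ ^ k) (Pi.single i x) i)) i := rfl
          rw [h4, h3, hmul, Pi.mul_apply]
          have h5 : σ (Pi.single i 1) i = 1 := h1
          rw [h5, one_mul, pow_succ', Module.End.mul_apply]
      ext1 x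
      rw [hk, hσ]; simp
  choose P τ hτ hP using hF
  have hsum : ∀ a : ∀ i, Module.End K (V i), LinearMap.trace K _ (LinearMap.mulLeft K a ∘ₗ σ) =
      ∑ i, τ i (a i) * aeval (ζ ^ (N - 1)) (P i) := by
    intro a
    rw [trace_pi]
    refine Finset.sum_congr rfl fun i _ => ?_
    rw [← hP]
    congr 1
  have h0 := hsum 1
  have e1 : LinearMap.mulLeft K (1 : ∀ i, Module.End K (V i)) ∘ₗ σ = σ := by
    ext1 x; simp
  rw [e1, htr] at h0
  have h1 : aeval ζ (∑ i, P i * (P i).comp (X ^ (N - 1))) = 0 := by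
    rw [map_sum, h0]
    refine Finset.sum_congr rfl fun i _ => ?_
    rw [map_mul, aeval_comp, Pi.one_apply, hτ]; simp
  have hC := Complex.isPrimitiveRoot_exp N hN.ne'
  set ω := Complex.exp (2 * Real.pi * Complex.I / N)
  have h2 := transfer hN hζ hC _ h1
  have hω : ω ^ (N - 1) = (starRingEnd ℂ) ω := by
    rw [← Complex.inv_eq_conj (Complex.norm_eq_one_of_pow_eq_one hC.pow_eq_one hN.ne')]
    refine eq_inv_of_mul_eq_one_left ?_
    rw [← pow_succ, hN1, hC.pow_eq_one]
  have h3 : ∀ i, aeval (ω ^ (N - 1)) (P i) = 0 := by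
    have h4 : ∑ i, ‖aeval ω (P i)‖ ^ 2 = 0 := by
      rw [← Complex.ofReal_inj]
      rw [Complex.ofReal_zero, ← h2, map_sum, Complex.ofReal_sum]
      refine Finset.sum_congr rfl fun i _ => ?_
      rw [map_mul, aeval_comp, Complex.ofReal_pow, ← Complex.mul_conj']
      congr 1
      have : (aeval ω) (X ^ (N - 1) : ℤ[X]) = (starRingEnd ℂ) ω := by simp [hω]
      rw [this]
      exact (Polynomial.aeval_algHom_apply ((starRingEnd ℂ).toIntAlgHom) ω (P i)).symm
    intro i
    have h5 := (Finset.sum_eq_zero_iff_of_nonneg (fun i _ => by positivity)).1 h4 i (Finset.mem_univ _)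
    have h6 : aeval ω (P i) = 0 := by simpa using h5
    rw [hω]
    have := Polynomial.aeval_algHom_apply ((starRingEnd ℂ).toIntAlgHom) ω (P i)
    rw [h6, map_zero] at this
    exact this
  rw [hsum]
  refine Finset.sum_eq_zero fun i _ => ?_
  have h7 := transfer hN hC hζ ((P i).comp (X ^ (N - 1))) (by rw [aeval_comp]; simpa using h3 i)
  rw [aeval_comp] at h7
  simp only [map_pow, aeval_X] at h7
  rw [h7, mul_zero]

lemma pos_semisimple {K A : Type*} [Field K] [IsAlgClosed K] [CharZero K] [Ring A] [Algebra K A]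
    [FiniteDimensional K A] [IsSemisimpleRing A] {N : ℕ} (hN : 0 < N)
    (σ : Module.End K A) (hmul : ∀ x y, σ (x * y) = σ x * σ y)
    (hσ : σ ^ N = 1) (htr : LinearMap.trace K _ σ = 0) (a : A) :
    LinearMap.trace K _ (LinearMap.mulLeft K a ∘ₗ σ) = 0 := by
  obtain ⟨n, d, hd, ⟨e0⟩⟩ := IsSemisimpleRing.exists_algEquiv_pi_matrix_of_isAlgClosed K A
  let e : A ≃ₐ[K] ∀ i, Module.End K (Fin (d i) → K) :=
    e0.trans (AlgEquiv.piCongrRight fun i => Matrix.toLinAlgEquiv')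
  have h : LinearMap.mulLeft K (e a) ∘ₗ e.toLinearEquiv.conj σ =
      e.toLinearEquiv.conj (LinearMap.mulLeft K a ∘ₗ σ) := by
    refine LinearMap.ext fun x => ?_
    change e a * e (σ (e.symm x)) = e (a * σ (e.symm x))
    rw [map_mul]
  rw [← LinearMap.trace_conj' _ e.toLinearEquiv, ← h]
  apply pos_pi (fun i => Fin (d i) → K) hN
  · intro x y
    have : ∀ x, e.toLinearEquiv.conj σ x = e (σ (e.symm x)) := fun x => rfl
    simp [this, hmul]
  · have : e.toLinearEquiv.conj σ ^ N = e.toLinearEquiv.conj (σ ^ N) := by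
      exact (map_pow (LinearEquiv.conjAlgEquiv K e.toLinearEquiv) σ N).symm
    rw [this, hσ]
    exact map_one (LinearEquiv.conjAlgEquiv K e.toLinearEquiv)
  · rw [LinearMap.trace_conj', htr]
end EvenExp
namespace EvenExp
open HopfAlgebra WithConv

lemma exists_int_aux {K A : Type*} [Field K] [Ring A] [Algebra K A] [IsSemisimpleRing A]
    (e : A →ₐ[K] K) : ∃ L : A, (∀ h, h * L = e h • L) ∧ e L = 1 := by
  let I : Submodule A A := RingHom.ker e
  obtain ⟨J, hJ⟩ := exists_isCompl I
  have h1 : (1 : A) ∈ I ⊔ J := by rw [hJ.sup_eq_top]; trivial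
  obtain ⟨u, hu, L, hL, huL⟩ := Submodule.mem_sup.1 h1
  have hu' : e u = 0 := hu
  have heL : e L = 1 := by
    have := congr(e $huL)
    rwa [map_add, hu', zero_add, map_one] at this
  refine ⟨L, fun h => ?_, heL⟩
  have h2 : h * L - e h • L = (h - algebraMap K A (e h)) * L := by
    rw [sub_mul, Algebra.smul_def]
  have hmI : h * L - e h • L ∈ I := by
    change e _ = 0
    simp
  have hmJ : h * L - e h • L ∈ J := by
    rw [h2]; exact J.smul_mem _ hL
  have := Submodule.disjoint_def.1 hJ.disjoint _ hmI hmJ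
  exact sub_eq_zero.1 this

section int
variable {K H : Type*} [Field K] [Ring H] [HopfAlgebra K H]

/-- Normalized two-sided integral. -/
structure IsInt (K : Type*) {H : Type*} [Field K] [Ring H] [HopfAlgebra K H] (L : H) : Prop where
  l : ∀ h, h * L = counit (R := K) h • L
  r : ∀ h, L * h = counit (R := K) h • L
  e : counit (R := K) L = 1

lemma exists_int [IsSemisimpleRing H] : ∃ L : H, IsInt K L := by
  obtain ⟨L, hL, hL1⟩ := exists_int_aux (Bialgebra.counitAlgHom K H)
  obtain ⟨M, hM, hM1⟩ := exists_int_aux (K := K) (A := Hᵐᵒᵖ)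
    ((Bialgebra.counitAlgHom K H).fromOpposite (fun _ _ => mul_comm _ _))
  have hM' : ∀ h, M.unop * h = counit (R := K) h • M.unop := fun h => by
    have := congr(MulOpposite.unop $(hM (MulOpposite.op h)))
    exact this
  have hM1' : counit (R := K) M.unop = 1 := hM1
  simp only [Bialgebra.counitAlgHom_apply] at hL hL1
  have : M.unop = L := by
    have h1 := hL M.unop
    have h2 := hM' L
    rw [hM1', one_smul] at h1
    rw [hL1, one_smul] at h2
    rw [← h1, h2]
  exact ⟨L, hL, this ▸ hM', hL1⟩

variable {L : H}

lemma IsInt.a1 (hL : IsInt K L) (h : H) :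
    (antipode K h ⊗ₜ[K] 1) * comul (R := K) L = (1 ⊗ₜ h) * comul (R := K) L := by
  have := congr($(key1 (K := K) (H := H)) h * comul (R := K) L)
  rw [(ℛ K h).convMul_apply] at this
  simp only [LinearMap.comp_apply, AlgHom.toLinearMap_apply, i1_apply, i2_apply] at this
  rw [← this, Finset.sum_mul]
  simp only [mul_assoc, ← Bialgebra.comul_mul, hL.l, map_smul, mul_smul_comm]
  conv_lhs => rw [← Rf_counit (K := K) h, Rf_repr (ℛ K h), map_sum, sum_tmul, Finset.sum_mul]
  refine Finset.sum_congr rfl fun i _ => ?_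
  rw [map_smul, ← smul_tmul', smul_mul_assoc]

lemma IsInt.a2 (hL : IsInt K L) (h : H) :
    comul (R := K) L * (h ⊗ₜ[K] 1) = comul (R := K) L * (1 ⊗ₜ antipode K h) := by
  have := congr(comul (R := K) L * $(key3 (K := K) (H := H)) h)
  rw [(ℛ K h).convMul_apply] at this
  simp only [LinearMap.comp_apply, AlgHom.toLinearMap_apply, i1_apply, i2_apply] at this
  rw [← this, Finset.mul_sum]
  simp only [← mul_assoc, ← Bialgebra.comul_mul, hL.r, map_smul, smul_mul_assoc]
  conv_rhs => rw [← Lf_counit (K := K) h, Lf_repr (ℛ K h), map_sum, tmul_sum, Finset.mul_sum]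
  refine Finset.sum_congr rfl fun i _ => ?_
  rw [map_smul, tmul_smul, mul_smul_comm]

lemma IsInt.s1 (hL : IsInt K L) {ι} (r : Repr K L ι) (h : H) :
    ∑ i ∈ r.index, (antipode K h * r.left i) ⊗ₜ[K] r.right i =
      ∑ i ∈ r.index, r.left i ⊗ₜ[K] (h * r.right i) := by
  simpa [← r.eq, Finset.mul_sum] using hL.a1 h

lemma IsInt.s2 (hL : IsInt K L) {ι} (r : Repr K L ι) (h : H) :
    ∑ i ∈ r.index, (r.left i * h) ⊗ₜ[K] r.right i =
      ∑ i ∈ r.index, r.left i ⊗ₜ[K] (r.right i * antipode K h) := by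
  simpa [← r.eq, Finset.sum_mul] using hL.a2 h

section fd
variable [FiniteDimensional K H]

lemma IsInt.lam_L (hL : IsInt K L) : lam K L = 1 := by
  have : LinearMap.mulLeft K L ∘ₗ S2 K = (counit (R := K)).smulRight L := by
    ext x
    simp [hL.r, S2_apply]
  rw [lam_apply, this, trace_smulRight, hL.e]

lemma IsInt.a (hL : IsInt K L) {ι} (r : Repr K L ι) (h : H) :
    ∑ i ∈ r.index, lam K (h * r.right i) • r.left i = antipode K h := by
  have h1 := congr(TensorProduct.rid K H ((lam K).lTensor H $(hL.s1 r h)))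
  simp only [map_sum, lTensor_tmul, rid_tmul] at h1
  rw [← h1]
  simp only [← mul_smul_comm, ← Finset.mul_sum]
  rw [← Rf_repr, Rf_lam, hL.lam_L, one_smul, mul_one]

lemma IsInt.b (hL : IsInt K L) {ι} (r : Repr K L ι) (h : H) :
    ∑ i ∈ r.index, lam K (r.right i * antipode K h) • r.left i = h := by
  have h1 := congr(TensorProduct.rid K H ((lam K).lTensor H $(hL.s2 r h)))
  simp only [map_sum, lTensor_tmul, rid_tmul] at h1
  rw [← h1]
  simp only [← smul_mul_assoc, ← Finset.sum_mul]
  rw [← Rf_repr, Rf_lam, hL.lam_L, one_smul, one_mul]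

lemma IsInt.S_inj (hL : IsInt K L) : Function.Injective (antipode K (A := H)) := by
  rw [injective_iff_map_eq_zero]
  intro h h0
  rw [← hL.b (ℛ K L) h, h0]; simp

lemma IsInt.S_surj (hL : IsInt K L) : Function.Surjective (antipode K (A := H)) :=
  LinearMap.injective_iff_surjective.1 hL.S_inj

lemma IsInt.S_L (hL : IsInt K L) : antipode K L = L := by
  obtain ⟨k, hk⟩ := hL.S_surj L
  have h1 := hL.l (antipode K L)
  have h2 := congr(antipode K $(hL.l k))
  rw [antipode_mul_antidistrib, hk, map_smul] at h2
  have h3 : counit (R := K) k = 1 := by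
    rw [← counit_antipode, hk, hL.e]
  rw [h3, one_smul, h1, counit_antipode, hL.e, one_smul] at h2
  exact h2.symm

/-- `f ↦ Λ₁ f(Λ₂)` -/
noncomputable def Phi (L : H) : (H →ₗ[K] K) →ₗ[K] H where
  toFun f := Rf f L
  map_add' f g := by simp [Rf_repr (ℛ K L), add_smul, Finset.sum_add_distrib]
  map_smul' c f := by simp [Rf_repr (ℛ K L), Finset.smul_sum, smul_smul]

lemma IsInt.Phi_inj (hL : IsInt K L) : Function.Injective (Phi (K := K) L) := by
  rw [LinearMap.injective_iff_surjective_of_finrank_eq_finrank (Subspace.dual_finrank_eq)]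
  intro h
  refine ⟨lam K ∘ₗ LinearMap.mulRight K (antipode K h), ?_⟩
  conv_rhs => rw [← hL.b (ℛ K L) h]
  exact Rf_repr (ℛ K L) _

lemma IsInt.unique (hL : IsInt K L) (m : H →ₗ[K] K) (hm : ∀ y, Rf m y = m y • 1) :
    m = m L • lam K := by
  apply hL.Phi_inj
  rw [map_smul]
  change Rf m L = m L • Rf (lam K) L
  rw [hm, Rf_lam, hL.lam_L, one_smul]

lemma Rf_comp (f g : H →ₗ[K] K) (y : H) : Rf (f ∘ₗ Lf g) y = Rf g (Rf f y) := by
  apply eq_of_dual (K := K)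
  intro φ
  rw [dual_swap, dual_swap, Lf_Rf, dual_swap, LinearMap.comp_apply]

lemma IsInt.Lf_lam (hL : IsInt K L) (y : H) : Lf (lam K) y = lam K y • Lf (lam K) L := by
  apply eq_of_dual (K := K)
  intro f
  have := hL.unique (f ∘ₗ Lf (lam K)) (fun y => by
    rw [Rf_comp, Rf_lam, dual_swap]; rfl)
  have := congr($this y)
  simp only [LinearMap.comp_apply, LinearMap.smul_apply, smul_eq_mul] at this
  rw [this, map_smul, smul_eq_mul, mul_comm]

lemma tensor_expand {ι} [Fintype ι] (b : Module.Basis ι K H) (t : H ⊗[K] H) :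
    t = ∑ j, b j ⊗ₜ[K] TensorProduct.lid K H ((b.coord j).rTensor H t) := by
  induction t with
  | zero => simp
  | add x y hx hy =>
    simp only [map_add, tmul_add, Finset.sum_add_distrib]
    rw [← hx, ← hy]
  | tmul x y =>
    simp only [rTensor_tmul, lid_tmul, ← smul_tmul]
    rw [← sum_tmul]
    simp

lemma IsInt.comul_g (hL : IsInt K L) : comul (R := K) (Lf (lam K) L) =
    Lf (lam K) L ⊗ₜ Lf (lam K) L := by
  have h1 : ∀ f : H →ₗ[K] K, Lf f (Lf (lam K) L) = f (Lf (lam K) L) • Lf (lam K) L := by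
    intro f
    rw [Lf_comp]
    have : (toConv (lam K) * toConv f).ofConv = f (Lf (lam K) L) • lam K := by
      ext y
      have h2 : (toConv (lam K) * toConv f).ofConv y = f (Lf (lam K) y) := by
        refine ((ℛ K y).convMul_apply _ _).trans ?_
        simp [Lf_repr (ℛ K y)]
      rw [h2, hL.Lf_lam]; simp [mul_comm]
    rw [this, Lf_smul, LinearMap.smul_apply]
  set g := Lf (lam K) L
  rw [tensor_expand (Module.finBasis K H) (comul (R := K) g),
    tensor_expand (Module.finBasis K H) (g ⊗ₜ[K] g)]
  refine Finset.sum_congr rfl fun j _ => ?_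
  have := h1 ((Module.finBasis K H).coord j)
  congr 1

lemma IsInt.counit_g (hL : IsInt K L) : counit (R := K) (Lf (lam K) L) = 1 := by
  rw [← dual_swap, Rf_counit, hL.lam_L]

lemma IsInt.g_comm (hL : IsInt K L) (h : H) :
    h * Lf (lam K) L = Lf (lam K) L * S2 K (S2 K h) := by
  have h1 := congr(TensorProduct.lid K H ((lam K).rTensor H $(hL.s1 (ℛ K L) h)))
  have h2 := congr(TensorProduct.lid K H ((lam K).rTensor H
    $(hL.s2 (ℛ K L) (S2 K (antipode K h)))))
  simp only [map_sum, rTensor_tmul, lid_tmul, lam_mul (antipode K h)] at h1 h2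
  rw [h1] at h2
  simp only [← smul_mul_assoc, ← Finset.sum_mul] at h2
  rw [← Lf_repr] at h2
  refine Eq.trans ?_ h2
  rw [Lf_repr (ℛ K L), Finset.mul_sum]
  exact Finset.sum_congr rfl fun i _ => by rw [mul_smul_comm, smul_mul_assoc]

lemma sweedler_grouplike {g : H} (hg : comul (R := K) g = g ⊗ₜ g) (hg1 : counit (R := K) g = 1)
    (m : ℕ) : sweedlerPow K H m g = g ^ m := by
  induction m with
  | zero => simp [sweedlerPow, hg1]
  | succ m ih => simp [sweedlerPow, hg, ih, pow_succ']

lemma IsInt.S2_pow (hL : IsInt K L) {n : ℕ}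
    (hn : sweedlerPow K H n = Algebra.linearMap K H ∘ₗ counit) :
    (S2 K : Module.End K H) ^ (2 * n) = 1 := by
  have hg : Lf (lam K) L ^ n = 1 := by
    rw [← sweedler_grouplike hL.comul_g hL.counit_g, hn]
    simp [hL.counit_g]
  have h1 : ∀ k (h : H), h * Lf (lam K) L ^ k =
      Lf (lam K) L ^ k * ((S2 K : Module.End K H) ^ (2 * k)) h := by
    intro k
    induction k with
    | zero => simp
    | succ k ih =>
      intro h
      rw [pow_succ, ← mul_assoc, ih, mul_assoc, hL.g_comm, ← mul_assoc]
      congr 1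
      rw [mul_add, add_comm, pow_add]
      simp [pow_two, Module.End.mul_apply]
  ext h
  have := h1 n h
  rw [hg, mul_one, one_mul] at this
  exact this.symm

lemma IsInt.c_ne [IsAlgClosed K] [CharZero K] [IsSemisimpleRing H] (hL : IsInt K L) {n : ℕ}
    (hn0 : 0 < n) (hn : sweedlerPow K H n = Algebra.linearMap K H ∘ₗ counit) :
    lam K (1 : H) ≠ 0 := by
  intro h0
  have := pos_semisimple (by omega : 0 < 2 * n) (S2 K : Module.End K H) S2_mul (hL.S2_pow hn)
    (by
      rw [lam_apply] at h0
      rw [← h0]; congr 1; ext x; simp) L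
  rw [← lam_apply, hL.lam_L] at this
  exact one_ne_zero this

lemma IsInt.S4 [IsAlgClosed K] [CharZero K] [IsSemisimpleRing H] (hL : IsInt K L) {n : ℕ}
    (hn0 : 0 < n) (hn : sweedlerPow K H n = Algebra.linearMap K H ∘ₗ counit) (h : H) :
    S2 K (S2 K h) = h := by
  have h1 := hL.Lf_lam 1
  have h2 : Lf (lam K) (1 : H) = lam K (1 : H) • 1 := by simp [Lf, Algebra.TensorProduct.one_def]
  rw [h2] at h1
  have h3 := smul_right_injective H (hL.c_ne hn0 hn) h1
  have h4 := hL.g_comm h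
  rw [← h3, mul_one, one_mul] at h4
  exact h4.symm

lemma rTensor_Lf (f : H →ₗ[K] K) (h : H) :
    (Lf f).rTensor H (comul (R := K) h) = comul (R := K) (Lf f h) := by
  have := congr((TensorProduct.lid K (H ⊗[K] H)).toLinearMap (f.rTensor (H ⊗[K] H)
    $(coassoc_apply (R := K) h)))
  rw [← (ℛ K h).eq] at this
  simp only [map_sum] at this
  simp only [Lf, LinearMap.comp_apply, ← (ℛ K h).eq, map_sum] at this ⊢
  simp at this ⊢
  rw [← this]
  refine Finset.sum_congr rfl fun i _ => ?_
  simp [← (ℛ K ((ℛ K h).left i)).eq, TensorProduct.sum_tmul, smul_tmul']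

lemma IsInt.S_eq (hL : IsInt K L) : (antipode K : H →ₗ[K] H) =
    ∑ i ∈ (ℛ K L).index, (lam K ∘ₗ LinearMap.mulRight K ((ℛ K L).right i)).smulRight
      ((ℛ K L).left i) := by
  ext h
  rw [← hL.a (ℛ K L) h]
  simp

lemma sweedler_one (h : H) : sweedlerPow K H 1 h = h := by
  conv_rhs => rw [← Rf_counit (K := K) h, Rf_repr (ℛ K h)]
  simp [sweedlerPow, ← (ℛ K h).eq, Algebra.algebraMap_eq_smul_one]

lemma IsInt.trace_S (hL : IsInt K L) : LinearMap.trace K H (antipode K) =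
    lam K (sweedlerPow K H 2 L) := by
  rw [hL.S_eq, map_sum]
  simp only [trace_smulRight]
  rw [sweedlerPow, LinearMap.comp_apply, LinearMap.comp_apply, ← (ℛ K L).eq]
  simp [sweedler_one]

lemma IsInt.trace_Rf (hL : IsInt K L) (f : H →ₗ[K] K) :
    LinearMap.trace K H (Rf f ∘ₗ S2 K) = lam K (1 : H) * f L := by
  have h1 : Rf f ∘ₗ S2 K = ∑ i ∈ (ℛ K L).index,
      (lam K ∘ₗ LinearMap.mulRight K ((ℛ K L).right i)).smulRight
        (Rf f (antipode K ((ℛ K L).left i))) := by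
    ext h
    rw [LinearMap.comp_apply, S2_apply, ← hL.a (ℛ K L) h]
    simp
  rw [h1, map_sum]
  simp only [trace_smulRight, Rf_S, LinearMap.comp_apply, mulRight_apply]
  rw [← map_sum]
  have h2 := congr(LinearMap.mul' K H ((antipode K).rTensor H $(rTensor_Lf (f ∘ₗ antipode K) L)))
  rw [mul_antipode_rTensor_comul_apply, ← (ℛ K L).eq] at h2
  simp only [map_sum, rTensor_tmul, mul'_apply] at h2
  rw [h2, ← dual_swap, Rf_counit, LinearMap.comp_apply, hL.S_L, Algebra.algebraMap_eq_smul_one,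
    map_smul, smul_eq_mul, mul_comm]

end fd
end int
end EvenExp
namespace EvenExp
open HopfAlgebra WithConv

section fin
variable {K H : Type*} [Field K] [Ring H] [HopfAlgebra K H]

/-- `h ⊗ v ↦ h₁ ⊗ φ(h₂) v`. -/
noncomputable def Th (φ : H →ₗ[K] H) : Module.End K (H ⊗[K] H) :=
  (LinearMap.mul' K H).lTensor H ∘ₗ (TensorProduct.assoc K H H H).toLinearMap ∘ₗ
    (φ.lTensor H ∘ₗ comul).rTensor H

lemma Th_repr (φ : H →ₗ[K] H) {ι} {h : H} (r : Repr K h ι) (v : H) :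
    Th φ (h ⊗ₜ v) = ∑ i ∈ r.index, r.left i ⊗ₜ (φ (r.right i) * v) := by
  simp [Th, ← r.eq, sum_tmul]

lemma Th_succ (ψ : H →ₗ[K] H) : Th LinearMap.id * Th ψ =
    Th (K := K) (LinearMap.mul' K H ∘ₗ ψ.lTensor H ∘ₗ comul) := by
  refine TensorProduct.ext' fun h v => ?_
  have := congr(((mulRight K v ∘ₗ LinearMap.mul' K H ∘ₗ ψ.lTensor H).lTensor H)
    $(coassoc_apply (R := K) h))
  rw [← (ℛ K h).eq] at this
  simp only [map_sum] at this
  rw [Module.End.mul_apply, Th_repr _ (ℛ K h), Th_repr _ (ℛ K h), map_sum]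
  simp only [rTensor_tmul, lTensor_tmul, LinearMap.comp_apply, mulRight_apply] at this ⊢
  rw [← this]
  refine Finset.sum_congr rfl fun i _ => ?_
  rw [Th_repr _ (ℛ K _)]
  simp [← (ℛ K ((ℛ K h).left i)).eq, sum_tmul, mul_assoc]

lemma Th_zero : Th (K := K) (H := H) (sweedlerPow K H 0) = 1 := by
  refine TensorProduct.ext' fun h v => ?_
  rw [Th_repr _ (ℛ K h)]
  conv_rhs => rw [← Rf_counit (K := K) h, Rf_repr (ℛ K h)]
  simp [sweedlerPow, sum_tmul, smul_tmul, Algebra.algebraMap_eq_smul_one]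

lemma Th_pow (m : ℕ) : Th LinearMap.id ^ m = Th (sweedlerPow K H m) := by
  induction m with
  | zero => rw [pow_zero, Th_zero]
  | succ m ih => rw [pow_succ', ih, Th_succ, sweedlerPow]

variable (K H) in
/-- `S² ⊗ S²` -/
noncomputable def DD : Module.End K (H ⊗[K] H) := TensorProduct.map (S2 K) (S2 K)

lemma Th_DD : Commute (Th LinearMap.id) (DD K H) := by
  refine TensorProduct.ext' fun h v => ?_
  rw [Module.End.mul_apply, Module.End.mul_apply, Th_repr _ (ℛ K h), DD, map_tmul]
  simp only [Th, LinearMap.comp_apply, rTensor_tmul, comul_S2, ← (ℛ K h).eq]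
  simp [sum_tmul, S2_mul]

variable [FiniteDimensional K H] {L : H}

lemma Th_expand {ι} [Fintype ι] (b : Module.Basis ι K H) (φ : H →ₗ[K] H) :
    Th φ = ∑ j, TensorProduct.map (Rf (b.coord j)) (mulLeft K (φ (b j))) := by
  refine TensorProduct.ext' fun h v => ?_
  rw [Th_repr _ (ℛ K h)]
  simp only [LinearMap.sum_apply, map_tmul, Rf_repr (ℛ K h), sum_tmul]
  rw [Finset.sum_comm]
  refine Finset.sum_congr rfl fun i _ => ?_
  conv_lhs => rw [← b.sum_repr ((ℛ K h).right i), map_sum, Finset.sum_mul, tmul_sum]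
  refine Finset.sum_congr rfl fun j _ => ?_
  rw [map_smul, smul_mul_assoc, tmul_smul, smul_tmul']
  rfl

lemma IsInt.trace_Th (hL : IsInt K L) (φ : H →ₗ[K] H) :
    LinearMap.trace K (H ⊗[K] H) (Th φ * DD K H) = lam K (1 : H) * lam K (φ L) := by
  let b := Module.finBasis K H
  rw [Th_expand b, Finset.sum_mul, map_sum]
  have : ∀ j, LinearMap.trace K (H ⊗[K] H)
      (TensorProduct.map (Rf (b.coord j)) (mulLeft K (φ (b j))) * DD K H) =
      lam K (1 : H) * (b.coord j L * lam K (φ (b j))) := fun j => by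
    rw [DD, Module.End.mul_eq_comp, ← TensorProduct.map_comp, trace_tensorProduct', hL.trace_Rf,
      lam_apply (φ (b j)), mul_assoc]
  simp only [this]
  rw [← Finset.mul_sum]
  congr 1
  conv_rhs => rw [← b.sum_repr L]
  rw [map_sum, map_sum]
  exact Finset.sum_congr rfl fun j _ => by rw [map_smul, map_smul, smul_eq_mul]; rfl

open Polynomial in
lemma IsInt.main [IsAlgClosed K] [CharZero K] [IsSemisimpleRing H] (hL : IsInt K L) {n : ℕ}
    (hn : sweedlerPow K H n = Algebra.linearMap K H ∘ₗ counit) (hodd : Odd n) :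
    LinearMap.trace K H (antipode K) = 1 := by
  have hn0 : 0 < n := hodd.pos
  have hc := hL.c_ne hn0 hn
  have hS4 := hL.S4 hn0 hn
  have hz : ∃ z : ℤ, lam K (1 : H) = z := by
    obtain ⟨P, -, hP⟩ := tracePoly (K := K) two_pos (IsPrimitiveRoot.neg_one 0 (by decide))
      (S2 K : Module.End K H) (by ext h; simp [pow_two, hS4])
    refine ⟨P.eval (-1), ?_⟩
    have h1 := hP 1
    have h2 : lam K (1 : H) = LinearMap.trace K H (S2 K) := by
      rw [lam_apply]; congr 1; ext x; simp
    rw [h2, ← pow_one (S2 K), h1, pow_one]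
    have h3 : (-1 : K) = algebraMap ℤ K (-1) := by simp
    rw [h3, aeval_algebraMap_apply]
    simp
  obtain ⟨z, hz⟩ := hz
  have hD2 : DD K H ^ 2 = 1 := by
    refine TensorProduct.ext' fun h v => ?_
    simp [pow_two, DD, hS4]
  have hT : Th (LinearMap.id (R := K) (M := H)) ^ n = 1 := by
    rw [Th_pow, hn, ← Th_zero]; rfl
  have hU : (Th LinearMap.id * DD K H) ^ (2 * n) = 1 := by
    rw [Th_DD.mul_pow, pow_mul (DD K H), hD2, one_pow, mul_comm 2 n, pow_mul, hT, one_pow, mul_one]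
  have hU2 : (Th LinearMap.id * DD K H) ^ (n + 2) = Th (sweedlerPow K H 2) * DD K H := by
    obtain ⟨k, hk⟩ := hodd
    rw [Th_DD.mul_pow, pow_add, hT, one_mul, Th_pow]
    congr 1
    rw [show n + 2 = 2 * (k + 1) + 1 by omega, pow_succ, pow_mul, hD2, one_pow, one_mul]
  have hN : 0 < 2 * n := by omega
  have : NeZero (2 * n) := ⟨hN.ne'⟩
  obtain ⟨ζ, hζ⟩ := HasEnoughRootsOfUnity.exists_primitiveRoot K (2 * n)
  obtain ⟨P, -, hP⟩ := tracePoly hN hζ _ hU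
  have h1 := hP 1
  rw [pow_one, pow_one, hL.trace_Th, LinearMap.id_apply, hL.lam_L, mul_one, hz] at h1
  have hco : (n + 2).Coprime (2 * n) := by
    have hodd2 : Odd (n + 2) := by
      obtain ⟨k, hk⟩ := hodd; exact ⟨k + 1, by omega⟩
    refine Nat.Coprime.mul_right (Nat.coprime_two_right.2 hodd2) ?_
    simpa using (Nat.coprime_two_left.2 hodd)
  have h2 := transfer hN hζ (hζ.pow_of_coprime _ hco) (P - C z) (by simp [← h1])
  have h3 := hP (n + 2)
  rw [hU2, hL.trace_Th, ← hL.trace_S] at h3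
  simp only [map_sub, aeval_C, sub_eq_zero] at h2
  rw [h2] at h3
  have h4 : lam K (1 : H) * LinearMap.trace K H (antipode K) = lam K (1 : H) * 1 := by
    rw [h3, hz]; simp
  exact mul_left_cancel₀ hc h4

open Polynomial in
lemma IsInt.odd_dim [IsAlgClosed K] [CharZero K] [IsSemisimpleRing H] (hL : IsInt K L) {n : ℕ}
    (hn : sweedlerPow K H n = Algebra.linearMap K H ∘ₗ counit) (hodd : Odd n) :
    Odd (Module.finrank K H) := by
  have htr := hL.main hn hodd
  have hS4 := hL.S4 hodd.pos hn
  obtain ⟨ζ, hζ⟩ := HasEnoughRootsOfUnity.exists_primitiveRoot K 4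
  obtain ⟨P, hP1, hP⟩ := tracePoly (by norm_num : 0 < 4) hζ (antipode K : Module.End K H)
    (by
      ext h
      have := hS4 h
      simp only [S2_apply] at this
      simpa [pow_succ] using this)
  have h1 := hP 1
  rw [pow_one, pow_one, htr] at h1
  obtain ⟨Q, hQ⟩ := cyc_dvd (by norm_num : 0 < 4) hζ (P - 1) (by simp [← h1])
  have h2 := congr(Polynomial.eval 1 $hQ)
  have : Fact (Nat.Prime 2) := ⟨Nat.prime_two⟩
  have h3 : Polynomial.eval 1 (cyclotomic (2 ^ (1 + 1)) ℤ) = ((2 : ℕ) : ℤ) :=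
    eval_one_cyclotomic_prime_pow 1
  rw [eval_mul, eval_sub, hP1, eval_one, show (4 : ℕ) = 2 ^ (1 + 1) by norm_num, h3] at h2
  have h4 : Odd ((Module.finrank K H : ℕ) : ℤ) := ⟨eval 1 Q, by push_cast at h2; linarith⟩
  exact_mod_cast h4

end fin
end EvenExp

/-- Let `H` be a semisimple Hopf algebra over an algebraically
closed field of characteristic zero.  If the dimension of `H` is even, then the
exponent of `H` (the least `n > 0` such that `h₍₁₎ h₍₂₎ ⋯ h₍ₙ₎ = ε(h)1` for all
`h ∈ H`) is even. -/
theorem even_dim_even_exponent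
    {K H : Type*} [Field K] [IsAlgClosed K] [CharZero K]
    [Ring H] [HopfAlgebra K H] [FiniteDimensional K H] [IsSemisimpleRing H]
    (n : ℕ)
    (hn : IsLeast {m : ℕ | 0 < m ∧
      sweedlerPow K H m = Algebra.linearMap K H ∘ₗ Coalgebra.counit} n)
    (heven : Even (Module.finrank K H)) :
    Even n := by
  by_contra hne
  obtain ⟨L, hL⟩ := EvenExp.exists_int (K := K) (H := H)
  have := hL.odd_dim hn.1.2 (Nat.not_even_iff_odd.1 hne)
  exact (Nat.not_even_iff_odd.2 this) heven
end

section
/- Let H be a semisimple Hopf algebra over an algebraically closed field of characteristic zero. If H has a simple module of even dimension, then the dimension of H is even. -/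
section
open Polynomial

set_option linter.unusedSectionVars false

namespace EvenHopf
section linalg
variable {K : Type*} [Field K] [IsAlgClosed K] {n : Type*} [Fintype n] [DecidableEq n]

theorem det_aeval (M : Matrix n n K) (p : K[X]) :
    (aeval M p).det = (M.charpoly.roots.map (fun x => p.eval x)).prod := by
  have hc : Multiset.card M.charpoly.roots = Fintype.card n := by
    rw [← M.charpoly_natDegree_eq_dim, (IsAlgClosed.splits M.charpoly).natDegree_eq_card_roots]
  have h1 : ∀ b : K, (M - algebraMap K _ b).det =
      (M.charpoly.roots.map (fun x => x - b)).prod := by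
    intro b
    have h2 : M.charpoly = (M.charpoly.roots.map (fun a => X - C a)).prod :=
      (IsAlgClosed.splits M.charpoly).eq_prod_roots_of_monic M.charpoly_monic
    have h3 := Matrix.eval_charpoly M b
    have h4 : (M - algebraMap K _ b) = -(Matrix.scalar n b - M) := by
      simp [Matrix.algebraMap_eq_diagonal, Matrix.scalar_apply]
    rw [h4, Matrix.det_neg, ← h3, ← hc]
    conv_lhs => rw [h2]
    rw [eval_multiset_prod, Multiset.map_map]
    simp only [Function.comp_def, eval_sub, eval_X, eval_C]
    have h5 : ∀ s : Multiset K, (-1:K) ^ (Multiset.card s) * (s.map (fun x => b - x)).prod =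
        (s.map (fun x => x - b)).prod := by
      intro s
      induction s using Multiset.induction_on with
      | empty => simp
      | cons a s ih => simp [pow_succ, ← ih]; ring
    rw [← h2]
    exact h5 _
  have hp := (IsAlgClosed.splits p).eq_prod_roots
  have h6 : ∀ s : Multiset K, (aeval M (s.map (fun b => X - C b)).prod).det =
      (M.charpoly.roots.map (fun x => ((s.map (fun b => X - C b)).prod).eval x)).prod := by
    intro s
    induction s using Multiset.induction_on with
    | empty => simp
    | cons a s ih =>
      simp only [Multiset.map_cons, Multiset.prod_cons, map_mul, Matrix.det_mul, ih, eval_mul,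
        Multiset.prod_map_mul]
      simp [h1]
  rw [hp]
  simp only [map_mul, Matrix.det_mul, h6, eval_mul, Multiset.prod_map_mul, aeval_C, eval_C]
  congr 1
  rw [Matrix.algebraMap_eq_diagonal, Matrix.det_diagonal]
  simp [hc]

theorem roots_charpoly_pow' (M : Matrix n n K) (k : ℕ) :
    (M ^ k).charpoly.roots = M.charpoly.roots.map (fun x => x ^ k) := by
  have : Infinite K := IsAlgClosed.instInfinite
  have h : (M ^ k).charpoly = ((M.charpoly.roots.map (fun x => x ^ k)).map (fun a => X - C a)).prod := by
    apply Polynomial.funext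
    intro t
    rw [Matrix.eval_charpoly]
    have := det_aeval M (C t - X ^ k)
    simp only [map_sub, aeval_C, map_pow, aeval_X] at this
    rw [Matrix.scalar_apply]
    rw [Matrix.algebraMap_eq_diagonal] at this
    rw [eval_multiset_prod]
    simp only [Multiset.map_map, Function.comp_def, eval_sub, eval_X, eval_C]
    refine Eq.trans this ?_
    simp
  rw [h, roots_multiset_prod_X_sub_C]

theorem trace_pow_eq (M : Matrix n n K) (k : ℕ) :
    (M ^ k).trace = (M.charpoly.roots.map (fun x => x ^ k)).sum := by
  rw [Matrix.trace_eq_sum_roots_charpoly, roots_charpoly_pow']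

/-- eigenvalues as an indexed family -/
theorem exists_eig (M : Matrix n n K) : ∃ (N : ℕ) (r : Fin N → K),
    (∀ x, x ∈ M.charpoly.roots ↔ ∃ i, r i = x) ∧ ∀ k, (M ^ k).trace = ∑ i, r i ^ k := by
  obtain ⟨l, hl⟩ := Quot.exists_rep M.charpoly.roots
  refine ⟨l.length, l.get, ?_, ?_⟩
  · intro x
    rw [← hl]
    simp [List.mem_iff_get]
  · intro k
    rw [trace_pow_eq, ← hl]
    have := (Fin.sum_univ_getElem (l.map (fun x => x ^ k)))
    simp only [List.getElem_map] at this
    simp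
    rw [← List.sum_ofFn]
    congr 1
    apply List.ext_get <;> simp

end linalg

section integ
variable {K : Type*} [Field K] [CharZero K]

theorem newton_integral {N : ℕ} (s : Fin N → K) (h : ∀ k, 1 ≤ k → IsIntegral ℤ (∑ i, s i ^ k)) (k : ℕ) :
    IsIntegral ℤ ((k.factorial : K) * MvPolynomial.aeval s (MvPolynomial.esymm (Fin N) ℤ k)) := by
  induction k using Nat.strong_induction_on with
  | _ k ih =>
    rcases Nat.eq_zero_or_pos k with rfl | hk
    · simpa using isIntegral_one
    · have hN := congrArg (MvPolynomial.aeval s) (MvPolynomial.mul_esymm_eq_sum (Fin N) ℤ k)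
      obtain ⟨j, rfl⟩ : ∃ j, k = j + 1 := ⟨k - 1, by omega⟩
      simp only [map_mul, map_natCast, map_sum, map_pow, map_neg, map_one] at hN
      have : (((j+1).factorial : ℕ) : K) * MvPolynomial.aeval s (MvPolynomial.esymm (Fin N) ℤ (j+1))
        = (j.factorial : K) * ((((j+1 : ℕ)) : K) * MvPolynomial.aeval s (MvPolynomial.esymm (Fin N) ℤ (j+1))) := by
        rw [Nat.factorial_succ]; push_cast; ring
      rw [this, hN, mul_left_comm, Finset.mul_sum]
      refine IsIntegral.mul (((isIntegral_one).neg).pow _) (IsIntegral.sum _ ?_)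
      intro a ha
      simp only [Finset.mem_filter] at ha
      obtain ⟨c, hc⟩ := Nat.factorial_dvd_factorial (show a.1 ≤ j by omega)
      have e : (j.factorial : K) * ((-1) ^ a.1 * MvPolynomial.aeval s (MvPolynomial.esymm (Fin N) ℤ a.1) *
          MvPolynomial.aeval s (MvPolynomial.psum (Fin N) ℤ a.2)) =
          (-1) ^ a.1 * (c : K) * ((a.1.factorial : K) * MvPolynomial.aeval s (MvPolynomial.esymm (Fin N) ℤ a.1)) *
          ∑ i, s i ^ a.2 := by
        rw [hc]; simp [MvPolynomial.psum]; ring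
      rw [e]
      refine IsIntegral.mul (IsIntegral.mul (IsIntegral.mul (((isIntegral_one).neg).pow _) ?_) (ih _ ha.2)) (h _ (by have := ha.1; have := ha.2; simp at *; omega))
      exact_mod_cast isIntegral_algebraMap (R := ℤ) (x := (c : ℤ))

theorem fact_mul_integral {N : ℕ} (s : Fin N → K) (h : ∀ k, 1 ≤ k → IsIntegral ℤ (∑ i, s i ^ k)) (i : Fin N) :
    IsIntegral ℤ ((N.factorial : K) * s i) := by
  let R := integralClosure ℤ K
  have h1 : ∀ k, k ≤ N → IsIntegral ℤ ((N.factorial : K) * MvPolynomial.aeval s (MvPolynomial.esymm (Fin N) ℤ k)) := by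
    intro k hk
    obtain ⟨c, hc⟩ := Nat.factorial_dvd_factorial hk
    rw [hc, mul_comm k.factorial c]; push_cast; rw [mul_assoc]
    refine IsIntegral.mul ?_ (newton_integral s h k)
    exact_mod_cast isIntegral_algebraMap (R := ℤ) (x := (c : ℤ))
  let p : K[X] := C (N.factorial : K) * ((Finset.univ.val.map s).map (fun a => X - C a)).prod
  have hroot : p.eval (s i) = 0 := by
    simp only [p, eval_mul, eval_multiset_prod, Multiset.map_map]
    rw [Multiset.prod_eq_zero, mul_zero]
    simp only [Multiset.mem_map]
    exact ⟨i, by simp, by simp⟩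
  have hcoef : ∀ k, IsIntegral ℤ (p.coeff k) := by
    intro k
    by_cases hk : k ≤ N
    · simp only [p, coeff_C_mul]
      rw [Multiset.prod_X_sub_C_coeff _ (by simpa using hk), ← MvPolynomial.aeval_esymm_eq_multiset_esymm (Fin N) ℤ, mul_left_comm]
      refine IsIntegral.mul (((isIntegral_one).neg).pow _) (h1 _ ?_)
      simp
    · have : p.coeff k = 0 := by
        simp only [p, coeff_C_mul]
        rw [coeff_eq_zero_of_natDegree_lt, mul_zero]
        rw [natDegree_multiset_prod_X_sub_C_eq_card]; simpa using hk
      rw [this]; exact isIntegral_zero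
  have hl : p ∈ Polynomial.lifts (algebraMap R K) := by
    rw [Polynomial.lifts_iff_coeff_lifts]
    intro k
    exact ⟨⟨_, hcoef k⟩, rfl⟩
  obtain ⟨q, hq⟩ := (Polynomial.mem_lifts _).mp hl
  have hinj : Function.Injective (algebraMap R K) := Subtype.val_injective
  have hlead : algebraMap R K q.leadingCoeff = (N.factorial : K) := by
    rw [← Polynomial.leadingCoeff_map_of_injective hinj, hq]
    simp only [p, leadingCoeff_mul, leadingCoeff_C]
    rw [(monic_multiset_prod_of_monic _ _ (fun a _ => monic_X_sub_C a)).leadingCoeff, mul_one]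
  have hz : aeval (s i) q = 0 := by
    rw [← eval_map_algebraMap, hq, hroot]
  have := isIntegral_leadingCoeff_smul q (s i) hz
  rw [Algebra.smul_def, hlead] at this
  exact isIntegral_trans (R := ℤ) (A := R) _ this

theorem integral_of_mul_pow {x : K} {c : ℕ} (hc : c ≠ 0)
    (h : ∀ m, 1 ≤ m → IsIntegral ℤ ((c : K) * x ^ m)) : IsIntegral ℤ x := by
  have hx : IsIntegral ℚ x := by
    have := (h 1 le_rfl).tower_top (A := ℚ)
    have h2 : x = algebraMap ℚ K ((c : ℚ)⁻¹) * (c * x ^ 1) := by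
      have : (c : K) ≠ 0 := by exact_mod_cast hc
      simp; field_simp
    rw [h2]
    exact isIntegral_algebraMap.mul this
  let F := IntermediateField.adjoin ℚ {x}
  have : FiniteDimensional ℚ F := IntermediateField.adjoin.finiteDimensional hx
  have : NumberField F := ⟨⟩
  let y : F := IntermediateField.AdjoinSimple.gen ℚ x
  have hy : algebraMap F K y = x := IntermediateField.AdjoinSimple.algebraMap_gen ℚ x
  have hal : IsAlmostIntegral (NumberField.RingOfIntegers F) y := by
    refine ⟨(c : NumberField.RingOfIntegers F), ?_, ?_⟩
    · rw [mem_nonZeroDivisors_iff_ne_zero]; exact_mod_cast hc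
    · intro m
      have hyint : IsIntegral ℤ ((c : F) * y ^ m) := by
        rcases Nat.eq_zero_or_pos m with rfl | hm
        · rw [pow_zero, mul_one]; exact_mod_cast isIntegral_algebraMap (R := ℤ) (x := (c : ℤ))
        · have := h m hm
          rw [← isIntegral_algebraMap_iff (FaithfulSMul.algebraMap_injective F K)]
          rw [map_mul, map_pow, hy, map_natCast]
          exact this
      refine ⟨⟨_, hyint⟩, ?_⟩
      rw [Algebra.smul_def, map_natCast]
      rfl
  have h3 := hal.isIntegral
  have h4 : IsIntegral ℤ y := isIntegral_trans _ h3
  rw [← hy]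
  exact h4.map (IsScalarTower.toAlgHom ℤ F K)

theorem eig_integral {N : ℕ} (r : Fin N → K) (h : ∀ k, 1 ≤ k → IsIntegral ℤ (∑ i, r i ^ k)) (i : Fin N) :
    IsIntegral ℤ (r i) := by
  refine integral_of_mul_pow (c := N.factorial) (Nat.factorial_ne_zero _) ?_
  intro m hm
  refine fact_mul_integral (fun i => r i ^ m) ?_ i
  intro k hk
  simp only [← pow_mul]
  exact h _ (Nat.mul_pos hm hk)

/-- sum of squares versus square of sum for integral families -/
theorem sq_sub_integral {N : ℕ} (r : Fin N → K) (h : ∀ i, IsIntegral ℤ (r i)) :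
    ∃ z, IsIntegral ℤ z ∧ (∑ i, r i) ^ 2 - ∑ i, r i ^ 2 = 2 * z := by
  induction N with
  | zero => exact ⟨0, isIntegral_zero, by simp⟩
  | succ N ih =>
    obtain ⟨z, hz, e⟩ := ih (fun i => r i.succ) (fun i => h _)
    refine ⟨z + r 0 * ∑ i : Fin N, r i.succ, hz.add ((h 0).mul (IsIntegral.sum _ fun i _ => h _)), ?_⟩
    rw [Fin.sum_univ_succ, Fin.sum_univ_succ]
    linear_combination e

variable [IsAlgClosed K] {n : Type*} [Fintype n] [DecidableEq n]

theorem trace_sq_of_integral (M : Matrix n n K) (h : ∀ k, 1 ≤ k → IsIntegral ℤ (M ^ k).trace) :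
    ∃ z, IsIntegral ℤ z ∧ M.trace ^ 2 - (M ^ 2).trace = 2 * z := by
  obtain ⟨N, r, -, hr⟩ := exists_eig M
  obtain ⟨z, hz, e⟩ := sq_sub_integral r (eig_integral r (fun k hk => by rw [← hr]; exact h k hk))
  refine ⟨z, hz, ?_⟩
  rw [← e, hr, ← pow_one M, hr]; simp

theorem eig_of_aeval_zero (M : Matrix n n K) (p : K[X]) (hp : aeval M p = 0) {x : K}
    (hx : x ∈ M.charpoly.roots) : p.eval x = 0 := by
  have hx' : M.charpoly.IsRoot x := isRoot_of_mem_roots hx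
  rw [← Matrix.mem_spectrum_iff_isRoot_charpoly] at hx'
  have := spectrum.subset_polynomial_aeval M p ⟨x, hx', rfl⟩
  rw [hp] at this
  by_contra hne
  exact (spectrum.mem_iff.mp this) (by simpa using (IsUnit.mk0 _ hne).map (algebraMap K (Matrix n n K)))

theorem trace_integral_of_pow {k : ℕ} (hk : 1 ≤ k) (M : Matrix n n K) (h : M ^ (k+1) = M) :
    IsIntegral ℤ M.trace := by
  obtain ⟨N, r, h1, hr⟩ := exists_eig M
  rw [← pow_one M, hr]
  refine IsIntegral.sum _ fun i _ => ?_
  simp only [pow_one]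
  have := eig_of_aeval_zero M (X ^ (k+1) - X) (by simp [h]) ((h1 _).2 ⟨i, rfl⟩)
  refine ⟨X ^ (k+1) - X, ?_, by simpa using this⟩
  apply monic_X_pow_sub
  simp only [degree_X]; exact_mod_cast (show 1 < k + 1 by omega)

/-- an idempotent matrix has natural trace -/
theorem trace_idem (M : Matrix n n K) (h : M * M = M) : ∃ m : ℕ, M.trace = m := by
  obtain ⟨N, r, h1, hr⟩ := exists_eig M
  rw [← pow_one M, hr]
  simp only [pow_one]
  have : ∀ i, ∃ m : ℕ, r i = m := by
    intro i
    have := eig_of_aeval_zero M (X ^ 2 - X) (by simp [pow_two, h]) ((h1 _).2 ⟨i, rfl⟩)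
    simp only [eval_sub, eval_pow, eval_X] at this
    have : r i * (r i - 1) = 0 := by linear_combination this
    rcases mul_eq_zero.mp this with h | h
    · exact ⟨0, by simpa using h⟩
    · exact ⟨1, by simpa using sub_eq_zero.mp h⟩
  choose m hm using this
  exact ⟨∑ i, m i, by push_cast; exact Finset.sum_congr rfl fun i _ => hm i⟩
end integ
end EvenHopf
end

section
open Polynomial
set_option linter.unusedSectionVars false

namespace EvenHopf
section A6
variable {K : Type*} [Field K] [CharZero K] [IsAlgClosed K]

theorem eig_roots_unity {d m : ℕ} (hm : 0 < m) (G G' : Matrix (Fin d) (Fin d) K) (h : G * G' = 1) (c : K)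
    (hc : G ^ m = algebraMap K _ c) : ∃ (N : ℕ) (w : Fin N → algebraicClosure ℚ K) (u : K), u ≠ 0 ∧
      (∀ j, w j ^ m = 1) ∧ G.trace = u * ∑ j, (w j : K) ∧ G'.trace = u⁻¹ * ∑ j, ((w j)⁻¹ : K) := by
  rcases Nat.eq_zero_or_pos d with rfl | hd
  · exact ⟨0, fun _ => 1, 1, one_ne_zero, by simp, by simp [Matrix.trace], by simp [Matrix.trace]⟩
  have : Nonempty (Fin d) := ⟨⟨0, hd⟩⟩
  have hunit : IsUnit G := IsUnit.of_mul_eq_one G' h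
  have hc0 : c ≠ 0 := by
    rintro rfl
    rw [map_zero] at hc
    exact (hunit.pow m).ne_zero hc
  obtain ⟨u, hu⟩ := IsAlgClosed.exists_pow_nat_eq c hm
  have hu0 : u ≠ 0 := by rintro rfl; rw [zero_pow hm.ne'] at hu; exact hc0 hu.symm
  obtain ⟨N, r, h1, hr⟩ := exists_eig G
  have hrm : ∀ j, r j ^ m = c := by
    intro j
    have := eig_of_aeval_zero G (X ^ m - C c) (by simp [hc]) ((h1 _).2 ⟨j, rfl⟩)
    simpa [sub_eq_zero] using this
  have hw : ∀ j, ∃ w : algebraicClosure ℚ K, w ^ m = 1 ∧ (w : K) = r j / u := by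
    intro j
    have e : (r j / u) ^ m = 1 := by rw [div_pow, hrm, hu, div_self hc0]
    refine ⟨⟨r j / u, ?_⟩, ?_, rfl⟩
    · rw [mem_algebraicClosure_iff]
      exact IsIntegral.isAlgebraic (IsIntegral.of_pow hm (by rw [e]; exact isIntegral_one))
    · ext; simpa using e
  choose w hw1 hw2 using hw
  refine ⟨N, w, u, hu0, hw1, ?_, ?_⟩
  · rw [← pow_one G, hr, Finset.mul_sum]
    refine Finset.sum_congr rfl fun j _ => ?_
    rw [hw2]; field_simp
  · have hG' : G' = c⁻¹ • G ^ (m - 1) := by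
      have e : G ^ m * G' = G ^ (m - 1) := by
        conv_lhs => rw [show m = (m - 1) + 1 by omega, pow_succ, mul_assoc, h, mul_one]
      rw [← e, hc, Algebra.algebraMap_eq_smul_one, smul_mul_assoc, one_mul, smul_smul, inv_mul_cancel₀ hc0, one_smul]
    rw [hG', Matrix.trace_smul, hr, Finset.mul_sum, smul_eq_mul, Finset.mul_sum]
    refine Finset.sum_congr rfl fun j _ => ?_
    have hrj : r j ≠ 0 := by intro h0; have := hrm j; rw [h0, zero_pow hm.ne'] at this; exact hc0 this.symm
    rw [hw2, ← hrm j]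
    have e : r j ^ m = r j ^ (m-1) * r j := by rw [← pow_succ]; congr 1; omega
    rw [e]; field_simp

theorem sum_trace_ne_zero {ι : Type*} [Fintype ι] (d : ι → ℕ) {m : ℕ} (hm : 0 < m)
    (G G' : ∀ i, Matrix (Fin (d i)) (Fin (d i)) K) (h : ∀ i, G i * G' i = 1) (c : ι → K)
    (hc : ∀ i, G i ^ m = algebraMap K _ (c i)) (i₀ : ι) (h0 : (G' i₀).trace ≠ 0) :
    ∑ i, (G i).trace * (G' i).trace ≠ 0 := by
  choose N w u hu hw hG hG' using fun i => eig_roots_unity hm (G i) (G' i) (h i) (c i) (hc i)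
  have : Algebra.IsAlgebraic ℚ (algebraicClosure ℚ K) := algebraicClosure.isAlgebraic ℚ K
  let φ : algebraicClosure ℚ K →ₐ[ℚ] ℂ := IsAlgClosed.lift
  have key : ∀ i, φ (∑ j, (w i j)⁻¹) = (starRingEnd ℂ) (φ (∑ j, w i j)) := by
    intro i
    simp only [map_sum]
    refine Finset.sum_congr rfl fun j _ => ?_
    rw [map_inv₀, Complex.inv_eq_conj]
    have : (φ (w i j)) ^ m = 1 := by rw [← map_pow, hw, map_one]
    exact Complex.norm_eq_one_of_pow_eq_one this hm.ne'
  have e1 : ∑ i, (G i).trace * (G' i).trace =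
      algebraMap (algebraicClosure ℚ K) K (∑ i, (∑ j, w i j) * (∑ j, (w i j)⁻¹)) := by
    rw [map_sum]
    refine Finset.sum_congr rfl fun i _ => ?_
    rw [hG, hG', map_mul, map_sum, map_sum]
    simp only [map_inv₀]
    have := hu i
    have e : ∀ x : algebraicClosure ℚ K, algebraMap _ K x = (x : K) := fun x => rfl
    simp only [e]
    field_simp
  rw [e1]
  intro hz
  have hz1 := (map_eq_zero_iff _ (FaithfulSMul.algebraMap_injective _ _)).mp hz
  have hz2 := congrArg φ hz1
  simp only [map_sum φ, map_mul, map_zero] at hz2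
  have hz3 : ∑ i, Complex.normSq (φ (∑ j, w i j)) = 0 := by
    have : ((∑ i, Complex.normSq (φ (∑ j, w i j)) : ℝ) : ℂ) = 0 := by
      rw [Complex.ofReal_sum, ← hz2]
      refine Finset.sum_congr rfl fun i _ => ?_
      rw [← map_sum, ← map_sum, key, Complex.mul_conj]
    exact_mod_cast this
  rw [Finset.sum_eq_zero_iff_of_nonneg (fun i _ => Complex.normSq_nonneg _)] at hz3
  have h5 := hz3 i₀ (Finset.mem_univ _)
  rw [Complex.normSq_eq_zero] at h5
  have h6 := key i₀
  rw [h5, map_zero] at h6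
  have h7 : (∑ j, (w i₀ j)⁻¹) = 0 := (map_eq_zero_iff φ φ.injective).mp h6
  apply h0
  rw [hG']
  have : ∑ j, ((w i₀ j)⁻¹ : K) = algebraMap (algebraicClosure ℚ K) K (∑ j, (w i₀ j)⁻¹) := by
    rw [map_sum]; rfl
  rw [this, h7, map_zero, mul_zero]
end A6

section lin
variable {K : Type*} [Field K] [CharZero K] {V : Type*} [AddCommGroup V] [Module K V] [FiniteDimensional K V]

theorem trace_idem_lin (f : Module.End K V) (h : f * f = f) :
    LinearMap.trace K V f = (Module.finrank K (LinearMap.range f) : K) := by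
  have hf : IsIdempotentElem f := h
  exact (LinearMap.IsIdempotentElem.isProj_range f hf).trace

theorem trace_cube (W : Module.End K V) (h : W * W * W = W) : ∃ k : ℤ, LinearMap.trace K V W = k := by
  have h2 : (2:K) ≠ 0 := two_ne_zero
  have hW4 : W * W * (W * W) = W * W := by rw [← mul_assoc, h]
  have hW3 : W * (W * W) = W := by rw [← mul_assoc, h]
  have e1 := trace_idem_lin ((2:K)⁻¹ • (W * W + W)) (by
    rw [smul_mul_smul_comm, add_mul, mul_add, mul_add, hW4, hW3, h, show W * W + W + (W + W * W) = (2:K) • (W*W+W) by rw [two_smul]; abel, smul_smul]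
    congr 1; field_simp)
  have e2 := trace_idem_lin ((2:K)⁻¹ • (W * W - W)) (by
    rw [smul_mul_smul_comm, sub_mul, mul_sub, mul_sub, hW4, hW3, h, show W * W - W - (W - W * W) = (2:K) • (W*W-W) by rw [two_smul]; abel, smul_smul]
    congr 1; field_simp)
  refine ⟨(Module.finrank K (LinearMap.range ((2:K)⁻¹ • (W * W + W))) : ℤ) - (Module.finrank K (LinearMap.range ((2:K)⁻¹ • (W * W - W))) : ℤ), ?_⟩
  push_cast
  rw [← e1, ← e2, ← map_sub, ← smul_sub, show W * W + W - (W * W - W) = (2:K) • W by rw [two_smul]; abel, smul_smul, inv_mul_cancel₀ h2, one_smul]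

theorem invol_eq (T W : Module.End K V) (hT : T * T = 1) (hW : W * W * W = W)
    (h : LinearMap.trace K V T = (Module.finrank K V : K) * LinearMap.trace K V W)
    (h0 : LinearMap.trace K V T ≠ 0) : T = 1 ∨ T = -1 := by
  have h2 : (2:K) ≠ 0 := two_ne_zero
  obtain ⟨k, hk⟩ := trace_cube W hW
  have hU : ((2:K)⁻¹ • (1 - T)) * ((2:K)⁻¹ • (1 - T)) = ((2:K)⁻¹ • (1 - T)) := by
    rw [smul_mul_smul_comm, sub_mul, mul_sub, mul_sub, hT, one_mul, one_mul, mul_one, show 1 - T - (T - 1) = (2:K) • (1 - T) by rw [two_smul]; abel, smul_smul]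
    congr 1; field_simp
  have e := trace_idem_lin _ hU
  set r := Module.finrank K (LinearMap.range ((2:K)⁻¹ • (1 - T))) with hr
  have hle : r ≤ Module.finrank K V := Submodule.finrank_le _
  rw [map_smul, map_sub, LinearMap.trace_one, smul_eq_mul, h, hk] at e
  rw [h, hk] at h0
  have hn0 : Module.finrank K V ≠ 0 := by rintro h; simp [h] at h0
  have hk0 : k ≠ 0 := by rintro h; simp [h] at h0
  have e' : (Module.finrank K V : ℤ) - Module.finrank K V * k = 2 * r := by
    have : ((Module.finrank K V : K) - Module.finrank K V * k) = 2 * r := by rw [← e]; field_simp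
    exact_mod_cast this
  set n := Module.finrank K V with hn
  rcases lt_or_gt_of_ne hk0 with hk1 | hk1
  · have hrn : r = n := by nlinarith
    right
    have hsurj : LinearMap.range ((2:K)⁻¹ • (1 - T)) = ⊤ := Submodule.eq_top_of_finrank_eq hrn
    have hid : ((2:K)⁻¹ • (1 - T)) = 1 := by
      ext v
      obtain ⟨u, rfl⟩ := LinearMap.range_eq_top.mp hsurj v
      exact LinearMap.congr_fun hU u
    have : (1 - T) = (2:K) • 1 := by
      have h3 := congrArg (fun z => (2:K) • z) hid
      simpa only [smul_smul, mul_inv_cancel₀ h2, one_smul] using h3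
    rw [two_smul] at this
    have : -T = 1 := by
      have := congrArg (fun z => z - 1) this; simpa [sub_sub_cancel_left] using this
    rw [← this, neg_neg]
  · have hr0 : r = 0 := by nlinarith
    left
    have : LinearMap.range ((2:K)⁻¹ • (1 - T)) = ⊥ := Submodule.finrank_eq_zero.mp hr0
    rw [LinearMap.range_eq_bot, smul_eq_zero] at this
    rcases this with h | h
    · simp at h
    · exact (sub_eq_zero.mp h).symm
end lin
end EvenHopf
end

section
open TensorProduct
set_option linter.unusedSectionVars false

namespace EvenHopf
section B1
variable {K H : Type*} [Field K] [Ring H] [HopfAlgebra K H] [FiniteDimensional K H]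

/-- index type -/
abbrev Ix (K H : Type*) [Field K] [Ring H] [HopfAlgebra K H] : Type := Fin (Module.finrank K H)

/-- a basis -/
noncomputable def ee (K H : Type*) [Field K] [Ring H] [HopfAlgebra K H] [FiniteDimensional K H] :
    Module.Basis (Ix K H) K H := Module.finBasis K H

/-- matrix coefficients of the regular comodule -/
noncomputable def dd (i j : Ix K H) : H :=
  TensorProduct.rid K H (LinearMap.lTensor H ((ee K H).coord j) (Coalgebra.comul (ee K H i)))

theorem tmul_basis_expand (x : H ⊗[K] H) :
    x = ∑ i, (TensorProduct.rid K H (LinearMap.lTensor H ((ee K H).coord i) x)) ⊗ₜ[K] (ee K H i) := by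
  induction x using TensorProduct.induction_on with
  | zero => simp
  | tmul a b =>
    simp only [LinearMap.lTensor_tmul, TensorProduct.rid_tmul, TensorProduct.smul_tmul]
    rw [← TensorProduct.tmul_sum]
    congr 1
    exact ((ee K H).sum_repr b).symm
  | add a b ha hb =>
    simp only [map_add, TensorProduct.add_tmul, Finset.sum_add_distrib]
    rw [← ha, ← hb]

theorem tmul_basis_inj {M : Type*} [AddCommGroup M] [Module K M] (u v : Ix K H → M)
    (h : ∑ i, u i ⊗ₜ[K] (ee K H i) = ∑ i, v i ⊗ₜ[K] (ee K H i)) : u = v := by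
  funext i
  have := congrArg (fun x => TensorProduct.rid K M (LinearMap.lTensor M ((ee K H).coord i) x)) h
  simpa [map_sum, Finsupp.single_apply] using this

theorem comul_ee (j : Ix K H) : Coalgebra.comul (R := K) (ee K H j) = ∑ i, dd j i ⊗ₜ[K] (ee K H i) :=
  tmul_basis_expand _

theorem counit_dd (i j : Ix K H) : Coalgebra.counit (R := K) (dd i j) = if i = j then 1 else 0 := by
  have h := Coalgebra.rTensor_counit_comul (R := K) (ee K H i)
  rw [comul_ee, map_sum] at h
  simp only [LinearMap.rTensor_tmul] at h
  have h2 := congrArg (TensorProduct.lid K H) h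
  simp only [map_sum, TensorProduct.lid_tmul, one_smul] at h2
  have h3 := congrArg (fun x => (ee K H).repr x j) h2
  simp only [map_sum, map_smul, Module.Basis.repr_self, Finsupp.coe_finsetSum, Finset.sum_apply, Finsupp.smul_apply, Finsupp.single_apply] at h3
  simpa using h3

theorem comul_dd (i j : Ix K H) : Coalgebra.comul (R := K) (dd i j) = ∑ k, dd i k ⊗ₜ[K] dd k j := by
  have h := Coalgebra.coassoc_apply (R := K) (ee K H i)
  rw [comul_ee, map_sum, map_sum, map_sum] at h
  simp only [LinearMap.rTensor_tmul, LinearMap.lTensor_tmul, comul_ee, TensorProduct.tmul_sum] at h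
  have h' : ∑ k, (Coalgebra.comul (R := K) (dd i k)) ⊗ₜ[K] ee K H k = ∑ k, (∑ x, dd i x ⊗ₜ[K] dd x k) ⊗ₜ[K] ee K H k := by
    apply (TensorProduct.assoc K H H H).injective
    rw [map_sum, h]
    simp only [map_sum, TensorProduct.sum_tmul, TensorProduct.assoc_tmul]
    rw [Finset.sum_comm]
  exact congrFun (tmul_basis_inj _ _ h') j

theorem ee_eq (j : Ix K H) : ee K H j = ∑ i, Coalgebra.counit (R := K) (ee K H i) • dd j i := by
  have h := Coalgebra.lTensor_counit_comul (R := K) (ee K H j)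
  rw [comul_ee, map_sum] at h
  have h2 := congrArg (TensorProduct.rid K H) h
  simpa [map_sum] using h2.symm

theorem ext_dd {M : Type*} [AddCommMonoid M] [Module K M] {f g : H →ₗ[K] M}
    (h : ∀ i j : Ix K H, f (dd i j) = g (dd i j)) : f = g := by
  apply (ee K H).ext
  intro j
  rw [ee_eq]
  simp [map_sum, h]

/-- antipode -/
abbrev SS : H →ₗ[K] H := HopfAlgebra.antipode K

theorem S_mul_dd (i j : Ix K H) : ∑ k, SS (K := K) (dd i k) * dd k j = if i = j then 1 else 0 := by
  have h := HopfAlgebra.mul_antipode_rTensor_comul_apply (R := K) (dd i j)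
  rw [comul_dd, counit_dd] at h
  simp only [map_sum, LinearMap.rTensor_tmul, LinearMap.mul'_apply] at h
  rw [h]; split_ifs <;> simp

theorem mul_S_dd (i j : Ix K H) : ∑ k, dd i k * SS (K := K) (dd k j) = if i = j then 1 else 0 := by
  have h := HopfAlgebra.mul_antipode_lTensor_comul_apply (R := K) (dd i j)
  rw [comul_dd, counit_dd] at h
  simp only [map_sum, LinearMap.lTensor_tmul, LinearMap.mul'_apply] at h
  rw [h]; split_ifs <;> simp

theorem S_mul (a b : H) : SS (K := K) (a * b) = SS (K := K) b * SS (K := K) a :=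
  HopfAlgebra.antipode_mul_antidistrib a b

theorem S_one : SS (K := K) (1 : H) = 1 := HopfAlgebra.antipode_one

theorem comul_S_dd (i j : Ix K H) : Coalgebra.comul (R := K) (SS (K := K) (dd i j)) =
    ∑ k, SS (K := K) (dd k j) ⊗ₜ[K] SS (K := K) (dd i k) := by
  let A : Matrix (Ix K H) (Ix K H) (H ⊗[K] H) := Matrix.of fun i j => Coalgebra.comul (R := K) (dd i j)
  let B : Matrix (Ix K H) (Ix K H) (H ⊗[K] H) := Matrix.of fun i j => Coalgebra.comul (R := K) (SS (K := K) (dd i j))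
  let C : Matrix (Ix K H) (Ix K H) (H ⊗[K] H) := Matrix.of fun i j => ∑ k, SS (K := K) (dd k j) ⊗ₜ[K] SS (K := K) (dd i k)
  have hBA : B * A = 1 := by
    ext i j
    simp only [Matrix.mul_apply, A, B, Matrix.of_apply, ← Bialgebra.comul_mul, ← map_sum, S_mul_dd, Matrix.one_apply]
    split_ifs <;> simp [Algebra.TensorProduct.one_def]
  have hAC : A * C = 1 := by
    ext i j
    simp only [Matrix.mul_apply, A, C, Matrix.of_apply, comul_dd, Finset.sum_mul_sum, Algebra.TensorProduct.tmul_mul_tmul]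
    rw [Finset.sum_comm]
    have : ∀ k : Ix K H, ∑ x, ∑ m, (dd i k * SS (K := K) (dd m j)) ⊗ₜ[K] (dd k x * SS (K := K) (dd x m)) =
        (dd i k * SS (K := K) (dd k j)) ⊗ₜ[K] (1 : H) := by
      intro k
      rw [Finset.sum_comm]
      simp only [← TensorProduct.tmul_sum, mul_S_dd]
      rw [Finset.sum_eq_single k]
      · simp
      · intro b _ hb; simp [hb.symm]
      · simp
    simp only [this, ← TensorProduct.sum_tmul, mul_S_dd, Matrix.one_apply]
    split_ifs <;> simp [Algebra.TensorProduct.one_def]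
  have : B = C := by
    calc B = B * (A * C) := by rw [hAC, mul_one]
      _ = C := by rw [← mul_assoc, hBA, one_mul]
  exact congrFun (congrFun this i) j

theorem comul_SS_ (x : H) : Coalgebra.comul (R := K) (SS (K := K) x) =
    TensorProduct.map (SS (K := K)) (SS (K := K)) (TensorProduct.comm K H H (Coalgebra.comul (R := K) x)) := by
  have : (Coalgebra.comul (R := K)) ∘ₗ (SS (K := K) : H →ₗ[K] H) =
    TensorProduct.map (SS (K := K)) (SS (K := K)) ∘ₗ (TensorProduct.comm K H H).toLinearMap ∘ₗ Coalgebra.comul (R := K) := by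
    apply ext_dd
    intro i j
    simp [comul_S_dd, comul_dd, map_sum]
  exact LinearMap.congr_fun this x
end B1
end EvenHopf
end

section
open TensorProduct
set_option linter.unusedSectionVars false

namespace EvenHopf
section B2
variable {K H : Type*} [Field K] [Ring H] [HopfAlgebra K H] [FiniteDimensional K H]

/-- normalized two sided integral -/
structure IsInt (K : Type*) {H : Type*} [Field K] [Ring H] [HopfAlgebra K H] (L : H) : Prop where
  left : ∀ h : H, h * L = Coalgebra.counit (R := K) h • L
  right : ∀ h : H, L * h = Coalgebra.counit (R := K) h • L
  one : Coalgebra.counit (R := K) L = 1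

theorem exists_left_int [IsSemisimpleRing H] : ∃ L : H, (∀ h : H, h * L = Coalgebra.counit (R := K) h • L) ∧
    Coalgebra.counit (R := K) L = 1 := by
  let I : Submodule H H := RingHom.ker (Bialgebra.counitAlgHom K H)
  obtain ⟨J, hJ⟩ := exists_isCompl I
  have h1 : (1 : H) ∈ I ⊔ J := by rw [hJ.sup_eq_top]; trivial
  obtain ⟨a, ha, L, hL, hsum⟩ := Submodule.mem_sup.mp h1
  have ha' : Coalgebra.counit (R := K) a = 0 := ha
  have hone : Coalgebra.counit (R := K) L = 1 := by
    have := congrArg (Coalgebra.counit (R := K)) hsum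
    simpa [map_add, ha'] using this
  refine ⟨L, ?_, hone⟩
  intro h
  have hm1 : h * L - Coalgebra.counit (R := K) h • L ∈ J := by
    refine J.sub_mem (J.smul_mem h hL) ?_
    rw [Algebra.smul_def]
    exact J.smul_mem _ hL
  have hm2 : h * L - Coalgebra.counit (R := K) h • L ∈ I := by
    change Bialgebra.counitAlgHom K H _ = 0
    simp [hone]
  have := Submodule.disjoint_def.mp hJ.disjoint _ hm2 hm1
  exact sub_eq_zero.mp this

theorem exists_right_int [IsSemisimpleRing H] : ∃ L : H, (∀ h : H, L * h = Coalgebra.counit (R := K) h • L) ∧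
    Coalgebra.counit (R := K) L = 1 := by
  let e : Hᵐᵒᵖ →+* K := ((Bialgebra.counitAlgHom K H : H →+* K).fromOpposite (fun _ _ => mul_comm _ _))
  have he : ∀ x : H, e (MulOpposite.op x) = Coalgebra.counit (R := K) x := fun x => rfl
  let I : Submodule Hᵐᵒᵖ Hᵐᵒᵖ := RingHom.ker e
  obtain ⟨J, hJ⟩ := exists_isCompl I
  have h1 : (1 : Hᵐᵒᵖ) ∈ I ⊔ J := by rw [hJ.sup_eq_top]; trivial
  obtain ⟨a, ha, L, hL, hsum⟩ := Submodule.mem_sup.mp h1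
  have ha' : e a = 0 := ha
  have hone : e L = 1 := by
    have := congrArg e hsum
    simpa [map_add, ha'] using this
  refine ⟨L.unop, ?_, hone⟩
  intro h
  have hm1 : MulOpposite.op h * L - MulOpposite.op (algebraMap K H (Coalgebra.counit (R := K) h)) * L ∈ J :=
    J.sub_mem (J.smul_mem _ hL) (J.smul_mem _ hL)
  have hm2 : MulOpposite.op h * L - MulOpposite.op (algebraMap K H (Coalgebra.counit (R := K) h)) * L ∈ I := by
    change e _ = 0
    rw [map_sub, map_mul, map_mul, hone, he, he]
    simp
  have := Submodule.disjoint_def.mp hJ.disjoint _ hm2 hm1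
  have h3 := congrArg MulOpposite.unop (sub_eq_zero.mp this)
  simp only [MulOpposite.unop_mul, MulOpposite.unop_op] at h3
  rw [h3, Algebra.smul_def, Algebra.commutes]

variable (K H) in
theorem exists_int [IsSemisimpleRing H] : ∃ L : H, IsInt K L := by
  obtain ⟨L, hL, h1⟩ := exists_left_int (K := K) (H := H)
  obtain ⟨R, hR, h2⟩ := exists_right_int (K := K) (H := H)
  have : L = R := by
    have e1 := hL R
    have e2 := hR L
    rw [h2, one_smul] at e1
    rw [h1, one_smul] at e2
    rw [← e1, e2]
  subst this
  exact ⟨L, hL, hR, h1⟩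

theorem IsInt.comul_left {L : H} (hL : IsInt K L) (h : H) :
    ((1 : H) ⊗ₜ[K] h) * Coalgebra.comul (R := K) L = (SS (K := K) h ⊗ₜ[K] (1 : H)) * Coalgebra.comul (R := K) L := by
  have : (LinearMap.mulRight K (Coalgebra.comul (R := K) L)) ∘ₗ (TensorProduct.mk K H H 1) =
      (LinearMap.mulRight K (Coalgebra.comul (R := K) L)) ∘ₗ ((TensorProduct.mk K H H).flip 1) ∘ₗ SS (K := K) := by
    apply ext_dd
    intro i j
    simp only [LinearMap.comp_apply, LinearMap.mulRight_apply, TensorProduct.mk_apply, LinearMap.flip_apply]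
    have e : ∀ k, (SS (K := K) (dd i k) ⊗ₜ[K] (1:H)) * Coalgebra.comul (R := K) (dd k j * L) =
       (if k = j then (1:K) else 0) • ((SS (K := K) (dd i k) ⊗ₜ[K] (1:H)) * Coalgebra.comul (R := K) L) := by
      intro k
      rw [hL.left, counit_dd, map_smul, mul_smul_comm]
    have e2 : ∑ k, (SS (K := K) (dd i k) ⊗ₜ[K] (1:H)) * Coalgebra.comul (R := K) (dd k j * L) =
        (SS (K := K) (dd i j) ⊗ₜ[K] (1:H)) * Coalgebra.comul (R := K) L := by
      simp only [e]; simp [-Bialgebra.comul_mul]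
    rw [← e2]
    simp only [Bialgebra.comul_mul, ← mul_assoc, ← Finset.sum_mul, comul_dd, Finset.mul_sum, Algebra.TensorProduct.tmul_mul_tmul, one_mul]
    congr 1
    rw [Finset.sum_comm]
    simp only [← TensorProduct.sum_tmul, S_mul_dd]
    simp [TensorProduct.ite_tmul]
  exact LinearMap.congr_fun this h

theorem IsInt.comul_right {L : H} (hL : IsInt K L) (h : H) :
    Coalgebra.comul (R := K) L * (h ⊗ₜ[K] (1 : H)) = Coalgebra.comul (R := K) L * ((1 : H) ⊗ₜ[K] SS (K := K) h) := by
  have : (LinearMap.mulLeft K (Coalgebra.comul (R := K) L)) ∘ₗ ((TensorProduct.mk K H H).flip 1) =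
      (LinearMap.mulLeft K (Coalgebra.comul (R := K) L)) ∘ₗ (TensorProduct.mk K H H 1) ∘ₗ SS (K := K) := by
    apply ext_dd
    intro i j
    simp only [LinearMap.comp_apply, LinearMap.mulLeft_apply, TensorProduct.mk_apply, LinearMap.flip_apply]
    have e : ∀ k, Coalgebra.comul (R := K) (L * dd i k) * ((1:H) ⊗ₜ[K] (SS (K := K) (dd k j))) =
       (if i = k then (1:K) else 0) • (Coalgebra.comul (R := K) L * ((1:H) ⊗ₜ[K] (SS (K := K) (dd k j)))) := by
      intro k
      rw [hL.right, counit_dd, map_smul, smul_mul_assoc]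
    have e2 : ∑ k, Coalgebra.comul (R := K) (L * dd i k) * ((1:H) ⊗ₜ[K] (SS (K := K) (dd k j))) =
        Coalgebra.comul (R := K) L * ((1:H) ⊗ₜ[K] (SS (K := K) (dd i j))) := by
      simp only [e]; simp [-Bialgebra.comul_mul]
    rw [← e2]
    simp only [Bialgebra.comul_mul, mul_assoc, ← Finset.mul_sum, comul_dd, Finset.sum_mul, Algebra.TensorProduct.tmul_mul_tmul, mul_one]
    congr 1
    rw [Finset.sum_comm]
    simp only [← TensorProduct.tmul_sum, mul_S_dd]
    simp [TensorProduct.tmul_ite]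
  exact LinearMap.congr_fun this h

/-- in a semisimple algebra, nonzero ideals contain nonzero central elements -/
theorem exists_central [IsAlgClosed K] [IsSemisimpleRing H] (h : H) (h0 : h ≠ 0) :
    ∃ (τ : Type) (_ : Fintype τ) (x y : τ → H), (∑ t, x t * h * y t) ≠ 0 ∧
      ∀ z, z * (∑ t, x t * h * y t) = (∑ t, x t * h * y t) * z := by
  obtain ⟨n, d, hd, ⟨φ⟩⟩ := IsSemisimpleRing.exists_algEquiv_pi_matrix_of_isAlgClosed K H
  have h1 : φ h ≠ 0 := by simpa using h0
  obtain ⟨i, hi⟩ := Function.ne_iff.mp h1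
  have hi' : ∃ p q, φ h i p q ≠ 0 := by
    by_contra hcon
    push Not at hcon
    exact hi (by ext p q; simpa using hcon p q)
  obtain ⟨p, q, hpq⟩ := hi'
  let X : Fin (d i) → H := fun r => φ.symm (Pi.single i (Matrix.single r p 1))
  let Y : Fin (d i) → H := fun r => φ.symm (Pi.single i (Matrix.single q r 1))
  have key : φ (∑ r, X r * h * Y r) = Pi.single i (algebraMap K _ (φ h i p q)) := by
    simp only [map_sum, map_mul, X, Y, AlgEquiv.apply_symm_apply]
    funext j
    by_cases hj : j = i
    · subst hj
      simp only [Finset.sum_apply, Pi.mul_apply, Pi.single_eq_same]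
      ext a b
      rw [Matrix.sum_apply]
      simp only [Matrix.single_mul_mul_single, one_mul, mul_one, Matrix.algebraMap_matrix_apply, Matrix.single_apply]
      by_cases hab : a = b
      · subst hab; simp
      · simp only [hab, if_false]
        refine Finset.sum_eq_zero fun c _ => ?_
        rw [if_neg]
        rintro ⟨rfl, rfl⟩
        exact hab rfl
    · simp [hj]
  refine ⟨Fin (d i), inferInstance, X, Y, ?_, ?_⟩
  · intro hz
    rw [hz, map_zero] at key
    have := congrFun key i
    rw [Pi.single_eq_same] at this
    have := congrFun (congrFun this p) p
    rw [Matrix.algebraMap_matrix_apply, if_pos rfl] at this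
    exact hpq this.symm
  · intro z
    apply φ.injective
    rw [map_mul, map_mul, key]
    funext j
    by_cases hj : j = i
    · subst hj; simp [(Algebra.commutes _ _).symm]
    · simp [hj]

theorem S_injective [IsAlgClosed K] [IsSemisimpleRing H] : Function.Injective (SS (K := K) : H →ₗ[K] H) := by
  rw [← LinearMap.ker_eq_bot, LinearMap.ker_eq_bot']
  intro h hS
  by_contra h0
  obtain ⟨L, hL⟩ := exists_int K H
  obtain ⟨τ, _, x, y, hne, hc⟩ := exists_central (K := K) h h0
  set c := ∑ t, x t * h * y t with hcdef
  have hSc : SS (K := K) c = 0 := by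
    rw [hcdef, map_sum]
    refine Finset.sum_eq_zero fun t _ => ?_
    rw [S_mul, S_mul, hS]; simp
  have h1 := hL.comul_right c
  rw [hSc, TensorProduct.tmul_zero, mul_zero] at h1
  have h2 : ∀ w : H ⊗[K] H, LinearMap.mul' K H (LinearMap.lTensor H (SS (K := K)) (w * (c ⊗ₜ[K] (1:H)))) =
      c * LinearMap.mul' K H (LinearMap.lTensor H (SS (K := K)) w) := by
    intro w
    induction w using TensorProduct.induction_on with
    | zero => simp
    | tmul a b =>
      simp only [Algebra.TensorProduct.tmul_mul_tmul, LinearMap.lTensor_tmul, LinearMap.mul'_apply, mul_one]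
      rw [hc, mul_assoc]
    | add a b ha hb => simp only [add_mul, map_add, ha, hb, mul_add]
  have h3 := h2 (Coalgebra.comul (R := K) L)
  rw [h1, HopfAlgebra.mul_antipode_lTensor_comul_apply, hL.one] at h3
  simp at h3
  exact hne h3.symm

theorem S_surjective [IsAlgClosed K] [IsSemisimpleRing H] : Function.Surjective (SS (K := K) : H →ₗ[K] H) :=
  LinearMap.injective_iff_surjective.mp S_injective

theorem counit_S (x : H) : Coalgebra.counit (R := K) (SS (K := K) x) = Coalgebra.counit (R := K) x :=
  HopfAlgebra.counit_antipode x

theorem IsInt.S_eq [IsAlgClosed K] [IsSemisimpleRing H] {L : H} (hL : IsInt K L) : SS (K := K) L = L := by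
  have h1 : ∀ h, SS (K := K) L * h = Coalgebra.counit (R := K) h • SS (K := K) L := by
    intro h
    obtain ⟨x, rfl⟩ := S_surjective (K := K) h
    rw [← S_mul, hL.left, counit_S, map_smul]
  have e1 := h1 L
  rw [hL.one, one_smul, hL.left, counit_S, hL.one, one_smul] at e1
  exact e1.symm
end B2
end EvenHopf
end

section
open TensorProduct
set_option linter.unusedSectionVars false

namespace EvenHopf
section B3
variable {K H : Type*} [Field K] [Ring H] [HopfAlgebra K H] [FiniteDimensional K H]

theorem tr_ee (f : H →ₗ[K] H) : LinearMap.trace K H f = ∑ i, (ee K H).repr (f (ee K H i)) i := by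
  rw [LinearMap.trace_eq_matrix_trace K (ee K H)]
  simp [Matrix.trace, LinearMap.toMatrix_apply]

theorem tr_rank_one (f : H →ₗ[K] K) (v : H) : LinearMap.trace K H (f.smulRight v) = f v := by
  rw [tr_ee]
  conv_rhs => rw [← (ee K H).sum_repr v]
  rw [map_sum]
  simp [mul_comm]

/-- `id ⊗ f` -/
noncomputable def E1 (f : H →ₗ[K] K) : H ⊗[K] H →ₗ[K] H :=
  (TensorProduct.rid K H).toLinearMap ∘ₗ LinearMap.lTensor H f

/-- `f ⊗ id` -/
noncomputable def E2 (f : H →ₗ[K] K) : H ⊗[K] H →ₗ[K] H :=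
  (TensorProduct.lid K H).toLinearMap ∘ₗ LinearMap.rTensor H f

@[simp] theorem E1_tmul (f : H →ₗ[K] K) (a b : H) : E1 f (a ⊗ₜ[K] b) = f b • a := by simp [E1]
@[simp] theorem E2_tmul (f : H →ₗ[K] K) (a b : H) : E2 f (a ⊗ₜ[K] b) = f a • b := by simp [E2]

/-- the square of the antipode -/
noncomputable def T2 (K H : Type*) [Field K] [Ring H] [HopfAlgebra K H] : Module.End K H :=
  (SS (K := K)) ∘ₗ (SS (K := K))

theorem T2_apply (x : H) : T2 K H x = SS (K := K) (SS (K := K) x) := rfl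

theorem T2_mul (x y : H) : T2 K H (x * y) = T2 K H x * T2 K H y := by
  simp [T2_apply, S_mul]

theorem T2_one : T2 K H 1 = 1 := by simp [T2_apply]

theorem comul_T2_dd (i j : Ix K H) : Coalgebra.comul (R := K) (T2 K H (dd i j)) = ∑ k, T2 K H (dd i k) ⊗ₜ[K] T2 K H (dd k j) := by
  rw [T2_apply, comul_SS_, comul_S_dd]
  simp [map_sum, T2_apply]

theorem comul_T2_ (x : H) : Coalgebra.comul (R := K) (T2 K H x) = TensorProduct.map (T2 K H) (T2 K H) (Coalgebra.comul (R := K) x) := by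
  have : Coalgebra.comul (R := K) ∘ₗ T2 K H = TensorProduct.map (T2 K H) (T2 K H) ∘ₗ Coalgebra.comul (R := K) := by
    apply ext_dd
    intro i j
    simp only [LinearMap.comp_apply]
    rw [comul_T2_dd, comul_dd]; simp [map_sum]
  exact LinearMap.congr_fun this x

/-- the integral on `H` -/
noncomputable def lam (K H : Type*) [Field K] [Ring H] [HopfAlgebra K H] [FiniteDimensional K H] : H →ₗ[K] K :=
  LinearMap.trace K H ∘ₗ LinearMap.mulRight K (T2 K H) ∘ₗ (Algebra.lmul K H).toLinearMap

theorem lam_apply (x : H) : lam K H x = LinearMap.trace K H (LinearMap.mulLeft K x * T2 K H) := rfl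

theorem lam_one : lam K H 1 = LinearMap.trace K H (T2 K H) := by
  rw [lam_apply]; simp; rfl

theorem lam_left (x : H) : E1 (lam K H) (Coalgebra.comul (R := K) x) = lam K H x • 1 := by
  let M : Ix K H → Ix K H → Ix K H → Ix K H → K := fun p q i j => (ee K H).repr (dd p q * T2 K H (ee K H j)) i
  have hM : ∀ p q j, dd p q * T2 K H (ee K H j) = ∑ i, M p q i j • ee K H i := fun p q j => ((ee K H).sum_repr _).symm
  have hlam : ∀ p q, lam K H (dd p q) = ∑ i, M p q i i := by
    intro p q
    rw [lam_apply, tr_ee]; rfl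
  have key : ∀ p q j k, ∑ i, M p q i j • dd i k = ∑ r, ∑ i, M r q k i • (dd p r * T2 K H (dd j i)) := by
    intro p q j
    have h1 := congrArg (Coalgebra.comul (R := K)) (hM p q j)
    rw [Bialgebra.comul_mul, comul_T2_, comul_ee, comul_dd, map_sum, map_sum] at h1
    simp only [TensorProduct.map_tmul, Finset.sum_mul_sum, Algebra.TensorProduct.tmul_mul_tmul, map_smul, comul_ee, hM, TensorProduct.tmul_sum, TensorProduct.tmul_smul, Finset.smul_sum, TensorProduct.smul_tmul'] at h1
    have h2 : ∑ k, (∑ i, M p q i j • dd i k) ⊗ₜ[K] ee K H k = ∑ k, (∑ r, ∑ i, M r q k i • (dd p r * T2 K H (dd j i))) ⊗ₜ[K] ee K H k := by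
      simp only [TensorProduct.sum_tmul]
      rw [Finset.sum_comm, ← h1]
      conv_rhs => rw [Finset.sum_comm]
      refine Finset.sum_congr rfl fun r _ => ?_
      rw [Finset.sum_comm]
    exact fun k => congrFun (tmul_basis_inj _ _ h2) k
  have hmain : ∀ p q : Ix K H, ∑ r, lam K H (dd r q) • dd p r = lam K H (dd p q) • (1:H) := by
    intro p q
    have h3 : ∑ j, ∑ k, (∑ i, M p q i j • dd i k) * SS (K := K) (dd k j) =
      ∑ j, ∑ k, (∑ r, ∑ i, M r q k i • (dd p r * T2 K H (dd j i))) * SS (K := K) (dd k j) := by simp only [key]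
    have hL : ∑ j, ∑ k, (∑ i, M p q i j • dd i k) * SS (K := K) (dd k j) = lam K H (dd p q) • (1:H) := by
      rw [hlam, Finset.sum_smul]
      refine Finset.sum_congr rfl fun j _ => ?_
      simp only [Finset.sum_mul]
      rw [Finset.sum_comm]
      simp only [smul_mul_assoc, ← Finset.smul_sum, mul_S_dd]
      simp
    have hR : ∑ j, ∑ k, (∑ r, ∑ i, M r q k i • (dd p r * T2 K H (dd j i))) * SS (K := K) (dd k j) =
        ∑ r, lam K H (dd r q) • dd p r := by
      have hS : ∀ i k : Ix K H, ∑ j, T2 K H (dd j i) * SS (K := K) (dd k j) = if k = i then (1:H) else 0 := by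
        intro i k
        simp only [T2_apply, ← S_mul, ← map_sum, mul_S_dd]
        split_ifs <;> simp
      simp only [Finset.sum_mul, smul_mul_assoc, mul_assoc]
      calc _ = ∑ k, ∑ r, ∑ i, M r q k i • (dd p r * ∑ j, T2 K H (dd j i) * SS (K := K) (dd k j)) := by
            rw [Finset.sum_comm]
            refine Finset.sum_congr rfl fun k _ => ?_
            rw [Finset.sum_comm]
            refine Finset.sum_congr rfl fun r _ => ?_
            rw [Finset.sum_comm]
            refine Finset.sum_congr rfl fun i _ => ?_
            rw [Finset.mul_sum, Finset.smul_sum]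
        _ = _ := by
            simp only [hS]
            rw [Finset.sum_comm]
            refine Finset.sum_congr rfl fun r _ => ?_
            rw [hlam, Finset.sum_smul]
            simp
    rw [← hL, h3, hR]
  have : E1 (lam K H) ∘ₗ Coalgebra.comul (R := K) = (lam K H).smulRight (1:H) := by
    apply ext_dd
    intro p q
    simp only [LinearMap.comp_apply, LinearMap.smulRight_apply]
    rw [comul_dd, map_sum, ← hmain]
    simp
  exact LinearMap.congr_fun this x

theorem lam_int {L : H} (hL : IsInt K L) : lam K H L = 1 := by
  have : LinearMap.mulLeft K L * T2 K H = (Coalgebra.counit (R := K)).smulRight L := by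
    ext y
    simp [hL.right, T2_apply]
  rw [lam_apply, this, tr_rank_one, hL.one]

theorem lam_comm (x y : H) : lam K H (x * y) = lam K H (y * T2 K H x) := by
  rw [lam_apply, lam_apply, LinearMap.mulLeft_mul]
  have e1 : (LinearMap.mulLeft K x ∘ₗ LinearMap.mulLeft K y) * T2 K H = LinearMap.mulLeft K x * (LinearMap.mulLeft K y * T2 K H) := rfl
  rw [e1, LinearMap.trace_mul_comm]
  congr 1
  ext z
  simp [T2_mul, mul_assoc]

theorem E1_left (f : H →ₗ[K] K) (a : H) (w : H ⊗[K] H) : E1 f ((a ⊗ₜ[K] (1:H)) * w) = a * E1 f w := by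
  induction w using TensorProduct.induction_on with
  | zero => simp
  | tmul x y => simp
  | add x y hx hy => simp only [mul_add, map_add, hx, hy]

theorem E1_right (f : H →ₗ[K] K) (a : H) (w : H ⊗[K] H) : E1 f (w * (a ⊗ₜ[K] (1:H))) = E1 f w * a := by
  induction w using TensorProduct.induction_on with
  | zero => simp
  | tmul x y => simp
  | add x y hx hy => simp only [add_mul, map_add, hx, hy]

theorem E2_right (f : H →ₗ[K] K) (a : H) (w : H ⊗[K] H) : E2 f (w * ((1:H) ⊗ₜ[K] a)) = E2 f w * a := by
  induction w using TensorProduct.induction_on with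
  | zero => simp
  | tmul x y => simp
  | add x y hx hy => simp only [add_mul, map_add, hx, hy]

theorem E1_mulLeft (f : H →ₗ[K] K) (a : H) (w : H ⊗[K] H) : E1 f (((1:H) ⊗ₜ[K] a) * w) = E1 (f ∘ₗ LinearMap.mulLeft K a) w := by
  induction w using TensorProduct.induction_on with
  | zero => simp
  | tmul x y => simp
  | add x y hx hy => simp only [mul_add, map_add, hx, hy]

theorem E1_mulRight (f : H →ₗ[K] K) (a : H) (w : H ⊗[K] H) : E1 f (w * ((1:H) ⊗ₜ[K] a)) = E1 (f ∘ₗ LinearMap.mulRight K a) w := by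
  induction w using TensorProduct.induction_on with
  | zero => simp
  | tmul x y => simp
  | add x y hx hy => simp only [add_mul, map_add, hx, hy]

/-- `S(x) = Λ₁ λ(x Λ₂)` -/
theorem S_formula {L : H} (hL : IsInt K L) (x : H) :
    E1 (lam K H ∘ₗ LinearMap.mulLeft K x) (Coalgebra.comul (R := K) L) = SS (K := K) x := by
  rw [← E1_mulLeft, hL.comul_left, E1_left, lam_left, lam_int hL]; simp

theorem id_formula {L : H} (hL : IsInt K L) (x : H) :
    E1 (lam K H ∘ₗ LinearMap.mulRight K (SS (K := K) x)) (Coalgebra.comul (R := K) L) = x := by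
  rw [← E1_mulRight, ← hL.comul_right, E1_right, lam_left, lam_int hL]; simp

variable [IsAlgClosed K] [IsSemisimpleRing H]

theorem nondeg_left (z : H) (h : ∀ y, lam K H (z * y) = 0) : z = 0 := by
  obtain ⟨L, hL⟩ := exists_int K H
  have h1 := S_formula hL z
  have : lam K H ∘ₗ LinearMap.mulLeft K z = 0 := by ext y; simp [h]
  rw [this] at h1
  apply S_injective (K := K)
  rw [← h1]
  simp [E1]

theorem nondeg_right (z : H) (h : ∀ y, lam K H (y * z) = 0) : z = 0 := by
  obtain ⟨L, hL⟩ := exists_int K H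
  obtain ⟨x, rfl⟩ := S_surjective (K := K) z
  have h1 := id_formula hL x
  have : lam K H ∘ₗ LinearMap.mulRight K (SS (K := K) x) = 0 := by ext y; simp [h]
  rw [this] at h1
  rw [← h1]
  simp [E1]
end B3
end EvenHopf
end

section
open TensorProduct
set_option linter.unusedSectionVars false

namespace EvenHopf
section B4
variable {K H : Type*} [Field K] [Ring H] [HopfAlgebra K H] [FiniteDimensional K H]

theorem apply_E1 (f g : H →ₗ[K] K) (w : H ⊗[K] H) : f (E1 g w) = g (E2 f w) := by
  induction w using TensorProduct.induction_on with
  | zero => simp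
  | tmul x y => simp [mul_comm]
  | add x y hx hy => simp only [map_add, hx, hy]

theorem E1_counit (x : H) : E1 (Coalgebra.counit (R := K)) (Coalgebra.comul (R := K) x) = x := by
  simp [E1]

theorem E2_counit (x : H) : E2 (Coalgebra.counit (R := K)) (Coalgebra.comul (R := K) x) = x := by
  simp [E2]

/-- the distinguished element -/
noncomputable def aa (K : Type*) {H : Type*} [Field K] [Ring H] [HopfAlgebra K H] [FiniteDimensional K H] (L : H) : H :=
  E2 (lam K H) (Coalgebra.comul (R := K) L)

theorem lam_S {L : H} (hL : IsInt K L) (x : H) : lam K H (SS (K := K) x) = lam K H (x * aa K L) := by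
  rw [← S_formula hL, apply_E1]; rfl

variable [IsAlgClosed K] [IsSemisimpleRing H]

theorem aa_comm {L : H} (hL : IsInt K L) (y : H) : y * aa K L = aa K L * T2 K H (T2 K H y) := by
  rw [← sub_eq_zero]
  apply nondeg_right (K := K)
  intro x
  rw [mul_sub, map_sub, sub_eq_zero, ← mul_assoc, ← lam_S hL, S_mul, lam_comm, ← mul_assoc, ← lam_comm (T2 K H y) (x * aa K L), ← mul_assoc, ← lam_S hL, S_mul]
  rfl

theorem aa_unit {L : H} (hL : IsInt K L) : ∃ b, b * aa K L = 1 := by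
  have hinj : Function.Injective (LinearMap.mulRight K (aa K L)) := by
    rw [← LinearMap.ker_eq_bot, LinearMap.ker_eq_bot']
    intro z hz
    have hz' : z * aa K L = 0 := hz
    apply S_injective (K := K)
    rw [map_zero]
    apply nondeg_left (K := K)
    intro y
    obtain ⟨x, rfl⟩ := S_surjective (K := K) y
    rw [← S_mul, lam_S hL, mul_assoc, hz', mul_zero, map_zero]
  exact LinearMap.injective_iff_surjective.mp hinj 1

theorem left_int_unique {L : H} (hL : IsInt K L) (μ : H →ₗ[K] K)
    (hμ : ∀ x, E1 μ (Coalgebra.comul (R := K) x) = μ x • 1) : μ = μ L • lam K H := by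
  obtain ⟨b, hb⟩ := aa_unit hL
  rw [← sub_eq_zero]
  set f := μ - μ L • lam K H with hf
  have h1 : ∀ w, E1 f w = E1 μ w - μ L • E1 (lam K H) w := by
    intro w
    induction w using TensorProduct.induction_on with
    | zero => simp
    | tmul x y => simp [hf, sub_smul, smul_smul]
    | add x y hx hy => simp only [map_add, hx, hy, smul_add]; abel
  have h2 : E1 f (Coalgebra.comul (R := K) L) = 0 := by
    rw [h1, hμ, lam_left, lam_int hL]; simp
  have h3 : ∀ x, f (x * aa K L) = 0 := by
    intro x
    have h4 : lam K H (E1 (f ∘ₗ LinearMap.mulLeft K x) (Coalgebra.comul (R := K) L)) = 0 := by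
      rw [← E1_mulLeft, hL.comul_left, E1_left, h2, mul_zero, map_zero]
    rw [apply_E1] at h4
    exact h4
  ext x
  have := h3 (x * b)
  rw [mul_assoc, hb, mul_one] at this
  exact this

theorem lam_right {L : H} (hL : IsInt K L) (x : H) :
    E2 (lam K H) (Coalgebra.comul (R := K) x) = lam K H x • aa K L := by
  have hd : ∀ i l : Ix K H, ∑ k, lam K H (dd k l) • dd i k = lam K H (dd i l) • (1:H) := by
    intro i l
    have := lam_left (K := K) (dd i l)
    rw [comul_dd, map_sum] at this
    simpa using this
  have key : ∀ f : H →ₗ[K] K, f (E2 (lam K H) (Coalgebra.comul (R := K) x)) = f (lam K H x • aa K L) := by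
    intro f
    let μ : H →ₗ[K] K := f ∘ₗ E2 (lam K H) ∘ₗ Coalgebra.comul (R := K)
    have hμd : ∀ i j : Ix K H, μ (dd i j) = ∑ l, lam K H (dd i l) * f (dd l j) := by
      intro i j
      simp only [μ, LinearMap.comp_apply]
      rw [comul_dd]; simp
    have hμ : ∀ x, E1 μ (Coalgebra.comul (R := K) x) = μ x • 1 := by
      have : E1 μ ∘ₗ Coalgebra.comul (R := K) = μ.smulRight (1:H) := by
        apply ext_dd
        intro i j
        simp only [LinearMap.comp_apply, LinearMap.smulRight_apply]
        rw [comul_dd, map_sum]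
        simp only [E1_tmul, hμd, Finset.sum_smul]
        rw [Finset.sum_comm]
        refine Finset.sum_congr rfl fun l _ => ?_
        have e := congrArg (fun z => f (dd l j) • z) (hd i l)
        simp only [Finset.smul_sum, smul_smul] at e
        simpa only [mul_comm] using e
      exact fun x => LinearMap.congr_fun this x
    have h := LinearMap.congr_fun (left_int_unique hL μ hμ) x
    have e : μ L = f (aa K L) := rfl
    rw [e] at h
    simp only [LinearMap.smul_apply, smul_eq_mul] at h
    rw [map_smul, smul_eq_mul, mul_comm, ← h]
    rfl
  apply (ee K H).repr.injective
  ext i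
  exact key ((ee K H).coord i)

theorem aa_grouplike {L : H} (hL : IsInt K L) : IsGroupLikeElem K (aa K L) := by
  constructor
  · have : Coalgebra.counit (R := K) (aa K L) = lam K H (E1 (Coalgebra.counit (R := K)) (Coalgebra.comul (R := K) L)) := by
      rw [apply_E1]; rfl
    rw [this, E1_counit, lam_int hL]
  · have hd : ∀ i j : Ix K H, ∑ k, lam K H (dd i k) • dd k j = lam K H (dd i j) • aa K L := by
      intro i j
      have := lam_right hL (dd i j)
      rw [comul_dd, map_sum] at this
      simpa using this
    have h : (lam K H).smulRight (Coalgebra.comul (R := K) (aa K L)) = (lam K H).smulRight (aa K L ⊗ₜ[K] aa K L) := by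
      apply ext_dd
      intro i j
      simp only [LinearMap.smulRight_apply]
      rw [← map_smul, ← hd, map_sum, ← TensorProduct.tmul_smul, ← hd, TensorProduct.tmul_sum]
      simp only [map_smul, comul_dd, Finset.smul_sum, TensorProduct.smul_tmul']
      rw [Finset.sum_comm]
      simp only [← TensorProduct.sum_tmul, hd]
      simp only [TensorProduct.tmul_smul, TensorProduct.smul_tmul']
    have := LinearMap.congr_fun h L
    simpa [lam_int hL] using this

theorem aa_pow {L : H} (hL : IsInt K L) : ∃ N : ℕ, 0 < N ∧ (aa K L) ^ N = 1 := by
  have : Finite (GroupLike K H) := (linearIndep_groupLikeVal (R := K) (A := H)).finite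
  let g : GroupLike K H := ⟨aa K L, aa_grouplike hL⟩
  refine ⟨orderOf g, orderOf_pos g, ?_⟩
  have := congrArg (GroupLike.val) (pow_orderOf_eq_one g)
  rw [GroupLike.val_pow, GroupLike.val_one] at this
  exact this

variable (K H) in
theorem T2_pow : ∃ m : ℕ, 0 < m ∧ (T2 K H) ^ m = 1 := by
  obtain ⟨L, hL⟩ := exists_int K H
  obtain ⟨N, hN, hN1⟩ := aa_pow hL
  have h : ∀ k (y : H), y * (aa K L) ^ k = (aa K L) ^ k * ((T2 K H) ^ (2 * k)) y := by
    intro k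
    induction k with
    | zero => simp
    | succ k ih =>
      intro y
      rw [pow_succ, ← mul_assoc, ih, mul_assoc, aa_comm hL, ← mul_assoc, show 2 * (k+1) = (1 + 1) + 2 * k by ring, pow_add (T2 K H), Module.End.mul_apply, pow_add, pow_one]
      rfl
  refine ⟨2 * N, by omega, ?_⟩
  ext y
  have := h N y
  rw [hN1] at this
  simpa using this.symm
end B4
end EvenHopf
end

section
open TensorProduct
set_option linter.unusedSectionVars false

namespace EvenHopf
section B5
variable {K H : Type*} [Field K] [Ring H] [HopfAlgebra K H] [FiniteDimensional K H]

theorem trace_pi_mul {n : ℕ} (d : Fin n → ℕ) (A B : ∀ i, Matrix (Fin (d i)) (Fin (d i)) K) :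
    LinearMap.trace K (∀ i, Matrix (Fin (d i)) (Fin (d i)) K) (LinearMap.mulLeft K A * LinearMap.mulRight K B) =
      ∑ i, (A i).trace * (B i).trace := by
  rw [LinearMap.trace_eq_matrix_trace K (Pi.basis fun i => Matrix.stdBasis K (Fin (d i)) (Fin (d i)))]
  simp only [Matrix.trace, Matrix.diag, LinearMap.toMatrix_apply, Fintype.sum_sigma, Fintype.sum_prod_type]
  refine Finset.sum_congr rfl fun i _ => ?_
  rw [Finset.sum_mul_sum]
  refine Finset.sum_congr rfl fun p _ => Finset.sum_congr rfl fun q _ => ?_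
  simp only [Pi.basis_apply, Pi.basis_repr, Module.End.mul_apply, LinearMap.mulLeft_apply, LinearMap.mulRight_apply, Pi.mul_apply, Pi.single_eq_same, Matrix.stdBasis_eq_single]
  have : ∀ X : Matrix (Fin (d i)) (Fin (d i)) K, (Matrix.stdBasis K (Fin (d i)) (Fin (d i))).repr X (p, q) = X p q := by
    intro X
    simp [Matrix.stdBasis]
  rw [this]
  simp [Matrix.mul_apply, Matrix.single_apply, Finset.sum_ite_eq, ite_and]

variable [IsAlgClosed K] [CharZero K] [IsSemisimpleRing H]

theorem trace_T2_ne : LinearMap.trace K H (T2 K H) ≠ 0 := by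
  obtain ⟨L, hL⟩ := exists_int K H
  obtain ⟨m, hm, hTm⟩ := T2_pow K H
  obtain ⟨n, d, hd, ⟨φ⟩⟩ := IsSemisimpleRing.exists_algEquiv_pi_matrix_of_isAlgClosed K H
  let G : ∀ i, Matrix (Fin (d i)) (Fin (d i)) K := fun i => Matrix.of fun p q =>
    lam K H (φ.symm (Pi.single i (Matrix.single q p 1)))
  let g : H := φ.symm G
  have hφg : φ g = G := by simp [g]
  let T : H → K := fun x => ∑ i, (φ x i).trace
  have hTc : ∀ x y, T (x * y) = T (y * x) := by
    intro x y
    simp only [T, map_mul, Pi.mul_apply]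
    exact Finset.sum_congr rfl fun i _ => Matrix.trace_mul_comm _ _
  have hTn : ∀ z, (∀ y, T (y * z) = 0) → z = 0 := by
    intro z hz
    apply φ.injective
    rw [map_zero]
    funext i
    ext p q
    have := hz (φ.symm (Pi.single i (Matrix.single q p 1)))
    simp only [T, map_mul, AlgEquiv.apply_symm_apply, Pi.mul_apply] at this
    rw [Finset.sum_eq_single i] at this
    · rw [Pi.single_eq_same, Matrix.trace_single_mul, one_smul] at this
      simpa using this
    · intro j _ hj; simp [hj]
    · simp
  have hlam : ∀ x, lam K H x = T (x * g) := by
    intro x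
    have hx : x = ∑ i, ∑ p, ∑ q, φ x i p q • φ.symm (Pi.single i (Matrix.single p q 1)) := by
      apply φ.injective
      simp only [map_sum, map_smul, AlgEquiv.apply_symm_apply]
      funext j
      ext a b
      simp only [Finset.sum_apply, Pi.smul_apply]
      rw [Finset.sum_eq_single j]
      · simp only [Pi.single_eq_same, Matrix.sum_apply, Matrix.smul_apply, Matrix.single_apply, ite_and]
        simp
      · intro i _ hi; simp [Ne.symm hi]
      · simp
    conv_lhs => rw [hx]
    simp only [map_sum, map_smul, T, map_mul, hφg, Pi.mul_apply, Matrix.trace, Matrix.diag, Matrix.mul_apply, smul_eq_mul, G, Matrix.of_apply]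
  have hgx : ∀ x, g * x = T2 K H x * g := by
    intro x
    rw [← sub_eq_zero]
    apply hTn
    intro y
    have h1 := lam_comm (K := K) x y
    rw [hlam, hlam] at h1
    have h2 : T (y * (g * x) - y * (T2 K H x * g)) = T (y * (g * x)) - T (y * (T2 K H x * g)) := by
      simp only [T, map_sub, Pi.sub_apply, Matrix.trace_sub, Finset.sum_sub_distrib]
    rw [mul_sub, h2, ← mul_assoc, ← mul_assoc, ← hTc x (y * g), ← mul_assoc, h1, sub_self]
  obtain ⟨g', hg'⟩ : ∃ g', g' * g = 1 := by
    have hinj : Function.Injective (LinearMap.mulRight K g) := by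
      rw [← LinearMap.ker_eq_bot, LinearMap.ker_eq_bot']
      intro z hz
      have hz' : z * g = 0 := hz
      apply nondeg_right (K := K)
      intro y
      rw [hlam, mul_assoc, hz', mul_zero]
      simp [T]
    exact LinearMap.injective_iff_surjective.mp hinj 1
  have hg'' : g * g' = 1 := mul_eq_one_symm hg'
  have hT2 : ∀ x, T2 K H x = g * x * g' := by
    intro x; rw [hgx, mul_assoc, hg'', mul_one]
  have hpow : ∀ k x, g ^ k * x = ((T2 K H) ^ k) x * g ^ k := by
    intro k
    induction k with
    | zero => simp
    | succ k ih =>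
      intro x
      rw [pow_succ, mul_assoc, hgx, ← mul_assoc, ih, mul_assoc, pow_succ (T2 K H), Module.End.mul_apply]
  have hcen : ∀ x, g ^ m * x = x * g ^ m := by
    intro x; rw [hpow, hTm]; rfl
  have htr : ∀ x, lam K H x = ∑ i, (φ (x * g) i).trace * (φ g' i).trace := by
    intro x
    rw [lam_apply, ← trace_pi_mul, ← LinearMap.trace_conj' _ φ.toLinearEquiv]
    congr 1
    refine LinearMap.ext fun y => ?_
    simp only [LinearEquiv.conj_apply, LinearMap.comp_apply, Module.End.mul_apply, LinearMap.mulLeft_apply, LinearMap.mulRight_apply, LinearEquiv.coe_coe]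
    have : φ.toLinearEquiv.symm y = φ.symm y := rfl
    rw [this, hT2]
    have : ∀ z, φ.toLinearEquiv z = φ z := fun z => rfl
    rw [this]
    simp only [map_mul, AlgEquiv.apply_symm_apply, mul_assoc]
  have hex : ∃ i, (φ g' i).trace ≠ 0 := by
    by_contra hcon
    push Not at hcon
    have := htr L
    rw [lam_int hL] at this
    simp [hcon] at this
  obtain ⟨i₀, hi₀⟩ := hex
  have hscal : ∀ i, ∃ c : K, (φ g i) ^ m = algebraMap K _ c := by
    intro i
    have hc : ∀ X : Matrix (Fin (d i)) (Fin (d i)) K, X * (φ g i) ^ m = (φ g i) ^ m * X := by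
      intro X
      have := congrArg φ (hcen (φ.symm (Pi.single i X)))
      simp only [map_mul, map_pow, AlgEquiv.apply_symm_apply] at this
      have := congrFun this i
      simp only [Pi.mul_apply, Pi.pow_apply, Pi.single_eq_same] at this
      exact this.symm
    have : (φ g i) ^ m ∈ Set.range (Matrix.scalar (Fin (d i))) := by
      apply Matrix.mem_range_scalar_of_commute_single
      intro a b _
      exact hc _
    obtain ⟨c, hc⟩ := this
    refine ⟨c, ?_⟩
    rw [← hc]; rfl
  choose c hc using hscal
  rw [← lam_one, htr, one_mul]
  refine sum_trace_ne_zero d hm (fun i => φ g i) (fun i => φ g' i) ?_ c hc i₀ hi₀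
  intro i
  have := congrFun (congrArg φ hg'') i
  simpa using this

theorem aa_eq_one {L : H} (hL : IsInt K L) : aa K L = 1 := by
  have h := lam_right hL 1
  simp only [Bialgebra.comul_one, Algebra.TensorProduct.one_def, E2_tmul] at h
  have h0 : lam K H 1 ≠ 0 := by rw [lam_one]; exact trace_T2_ne
  exact (smul_right_injective H h0 h).symm

theorem T2_sq : T2 K H * T2 K H = 1 := by
  obtain ⟨L, hL⟩ := exists_int K H
  ext y
  have := aa_comm hL y
  rw [aa_eq_one hL, mul_one, one_mul] at this
  exact this.symm
end B5
end EvenHopf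
end

section
open TensorProduct
set_option linter.unusedSectionVars false

namespace EvenHopf
section B6
variable {K H : Type*} [Field K] [Ring H] [HopfAlgebra K H] [FiniteDimensional K H]

/-- `x ↦ x₁ f(x₂)` -/
noncomputable def Ef (f : H →ₗ[K] K) : Module.End K H := E1 f ∘ₗ Coalgebra.comul (R := K)

theorem Ef_dd (f : H →ₗ[K] K) (i j : Ix K H) : Ef f (dd i j) = ∑ k, f (dd k j) • dd i k := by
  simp [Ef, comul_dd]

theorem Ef_mul (f g : H →ₗ[K] K) : Ef f * Ef g = Ef (f ∘ₗ Ef g) := by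
  apply ext_dd
  intro i j
  simp only [Module.End.mul_apply, Ef_dd, map_sum, map_smul, LinearMap.comp_apply, Finset.smul_sum, Finset.sum_smul, smul_smul, smul_eq_mul]
  rw [Finset.sum_comm]

theorem counit_Ef (f : H →ₗ[K] K) : Coalgebra.counit (R := K) ∘ₗ Ef f = f := by
  apply ext_dd
  intro i j
  simp [Ef_dd, counit_dd]

theorem tr_comp_S (F : Module.End K H) {L : H} (hL : IsInt K L) :
    LinearMap.trace K H (F * SS (K := K)) = lam K H (LinearMap.mul' K H (LinearMap.rTensor H F (Coalgebra.comul (R := K) L))) := by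
  have key : ∀ w : H ⊗[K] H, ∀ G : Module.End K H, (∀ x, G x = E1 (lam K H ∘ₗ LinearMap.mulLeft K x) w) →
      LinearMap.trace K H (F * G) = lam K H (LinearMap.mul' K H (LinearMap.rTensor H F w)) := by
    intro w
    induction w using TensorProduct.induction_on with
    | zero =>
      intro G hG
      have : G = 0 := by ext x; simp [hG]
      simp [this]
    | tmul a b =>
      intro G hG
      have : F * G = (lam K H ∘ₗ LinearMap.mulRight K b).smulRight (F a) := by
        ext x; simp [hG]
      rw [this, tr_rank_one]
      simp
    | add u v hu hv =>
      intro G hG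
      let U : Module.End K H :=
        { toFun := fun x => E1 (lam K H ∘ₗ LinearMap.mulLeft K x) u
          map_add' := fun x y => by
            have : lam K H ∘ₗ LinearMap.mulLeft K (x + y) = lam K H ∘ₗ LinearMap.mulLeft K x + lam K H ∘ₗ LinearMap.mulLeft K y := by
              ext z; simp [add_mul]
            simp [this, E1, LinearMap.lTensor_add]
          map_smul' := fun c x => by
            have : lam K H ∘ₗ LinearMap.mulLeft K (c • x) = c • (lam K H ∘ₗ LinearMap.mulLeft K x) := by
              ext z; simp
            simp [this, E1, LinearMap.lTensor_smul] }
      have h1 := hu U (fun x => rfl)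
      have h2 := hv (G - U) (fun x => by
        have : U x = E1 (lam K H ∘ₗ LinearMap.mulLeft K x) u := rfl
        rw [LinearMap.sub_apply, hG, this, map_add]; abel)
      have : F * G = F * U + F * (G - U) := by rw [← mul_add]; simp
      rw [this, map_add, h1, h2, map_add, map_add, map_add]
  exact key _ _ (fun x => (S_formula hL x).symm)

theorem mul_EfS (f : H →ₗ[K] K) (x : H) :
    LinearMap.mul' K H (LinearMap.rTensor H (Ef f * SS (K := K)) (Coalgebra.comul (R := K) x)) = f (SS (K := K) x) • 1 := by
  have : LinearMap.mul' K H ∘ₗ LinearMap.rTensor H (Ef f * SS (K := K)) ∘ₗ Coalgebra.comul (R := K) =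
    (f ∘ₗ SS (K := K)).smulRight (1:H) := by
    apply ext_dd
    intro i j
    simp only [LinearMap.comp_apply, comul_dd, map_sum, LinearMap.rTensor_tmul, LinearMap.mul'_apply, Module.End.mul_apply, LinearMap.smulRight_apply]
    have : ∀ k : Ix K H, Ef f (SS (K := K) (dd i k)) = ∑ l, f (SS (K := K) (dd i l)) • SS (K := K) (dd l k) := by
      intro k
      simp [Ef, comul_S_dd]
    simp only [this, Finset.sum_mul, smul_mul_assoc]
    rw [Finset.sum_comm]
    simp only [← Finset.smul_sum, S_mul_dd]
    simp
  exact LinearMap.congr_fun this x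

/-- character of the regular representation -/
noncomputable def rr (K H : Type*) [Field K] [Ring H] [HopfAlgebra K H] [FiniteDimensional K H] : H →ₗ[K] K :=
  LinearMap.trace K H ∘ₗ (Algebra.lmul K H).toLinearMap

theorem rr_apply (x : H) : rr K H x = LinearMap.trace K H (LinearMap.mulLeft K x) := rfl

theorem rr_conv (x : H) : (rr K H ∘ₗ Ef (rr K H)) x = (Module.finrank K H : K) * rr K H x := by
  let Phi : Module.End K (H ⊗[K] H) := TensorProduct.lift
    (LinearMap.mk₂ K (fun x y : H => Coalgebra.comul (R := K) x * ((1:H) ⊗ₜ[K] y))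
      (by intros; simp [add_mul]) (by intros; simp) (by intros; simp [TensorProduct.tmul_add, mul_add])
      (by intros; simp [TensorProduct.tmul_smul]))
  have hPhi : ∀ x y : H, Phi (x ⊗ₜ[K] y) = Coalgebra.comul (R := K) x * ((1:H) ⊗ₜ[K] y) := fun x y => by simp [Phi]
  have hsurj : Function.Surjective Phi := by
    rw [← LinearMap.range_eq_top, eq_top_iff, ← TensorProduct.span_tmul_eq_top, Submodule.span_le]
    rintro _ ⟨u, v, rfl⟩
    have : ∀ u : H, u ⊗ₜ[K] v = Phi (LinearMap.lTensor H (LinearMap.mulRight K v ∘ₗ SS (K := K)) (Coalgebra.comul (R := K) u)) := by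
      intro u
      have : (TensorProduct.mk K H H).flip v = Phi ∘ₗ (LinearMap.lTensor H (LinearMap.mulRight K v ∘ₗ SS (K := K))) ∘ₗ Coalgebra.comul (R := K) := by
        apply ext_dd
        intro i j
        simp only [LinearMap.comp_apply, comul_dd, map_sum, LinearMap.lTensor_tmul, LinearMap.mulRight_apply, hPhi, Finset.sum_mul, Algebra.TensorProduct.tmul_mul_tmul, mul_one, ← mul_assoc]
        rw [Finset.sum_comm]
        simp only [← TensorProduct.tmul_sum, ← Finset.sum_mul, mul_S_dd]
        rw [Finset.sum_eq_single j]
        · simp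
        · intro b _ hb; simp [hb]
        · simp
      exact LinearMap.congr_fun this u
    rw [this u]
    exact LinearMap.mem_range_self _ _
  have hbij : Function.Bijective Phi := ⟨LinearMap.injective_iff_surjective.mpr hsurj, hsurj⟩
  let P := LinearEquiv.ofBijective Phi hbij
  have h1 : LinearMap.mulLeft K (Coalgebra.comul (R := K) x) ∘ₗ Phi = Phi ∘ₗ TensorProduct.map (LinearMap.mulLeft K x) LinearMap.id := by
    apply TensorProduct.ext'
    intro a b
    simp [hPhi, mul_assoc]
  have h2 : LinearMap.trace K (H ⊗[K] H) (LinearMap.mulLeft K (Coalgebra.comul (R := K) x)) =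
      LinearMap.trace K (H ⊗[K] H) (TensorProduct.map (LinearMap.mulLeft K x) LinearMap.id) := by
    rw [← LinearMap.trace_conj' (TensorProduct.map (LinearMap.mulLeft K x) LinearMap.id) P]
    congr 1
    refine LinearMap.ext fun z => ?_
    obtain ⟨w, rfl⟩ := hsurj z
    have h3 : P.symm (Phi w) = w := P.symm_apply_apply w
    simp only [LinearEquiv.conj_apply, LinearMap.comp_apply, LinearEquiv.coe_coe, h3]
    exact LinearMap.congr_fun h1 w
  rw [LinearMap.trace_tensorProduct', LinearMap.trace_id] at h2
  rw [mul_comm, rr_apply, ← h2]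
  have : rr K H ∘ₗ Ef (rr K H) = LinearMap.trace K (H ⊗[K] H) ∘ₗ (Algebra.lmul K (H ⊗[K] H)).toLinearMap ∘ₗ Coalgebra.comul (R := K) := by
    apply ext_dd
    intro i j
    simp only [LinearMap.comp_apply, Ef_dd, comul_dd, map_sum, map_smul]
    refine Finset.sum_congr rfl fun k _ => ?_
    have : (Algebra.lmul K (H ⊗[K] H)).toLinearMap (dd i k ⊗ₜ[K] dd k j) = TensorProduct.map (LinearMap.mulLeft K (dd i k)) (LinearMap.mulLeft K (dd k j)) := by
      apply TensorProduct.ext'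
      intro a b
      simp
    rw [this, LinearMap.trace_tensorProduct', ← rr_apply, ← rr_apply, smul_eq_mul, mul_comm]
  exact LinearMap.congr_fun this x

variable [IsAlgClosed K] [IsSemisimpleRing H]

theorem tr_EfT2 (f : H →ₗ[K] K) {L : H} (hL : IsInt K L) :
    LinearMap.trace K H (Ef f * T2 K H) = LinearMap.trace K H (T2 K H) * f L := by
  have : Ef f * T2 K H = (Ef f * SS (K := K)) * SS (K := K) := rfl
  rw [this, tr_comp_S _ hL, mul_EfS, hL.S_eq, map_smul, lam_one, smul_eq_mul, mul_comm]

variable [CharZero K]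

variable (K H) in
theorem T2_eq_one : T2 K H = 1 := by
  obtain ⟨L, hL⟩ := exists_int K H
  have hsq := T2_sq (K := K) (H := H)
  have hsq' : ∀ y, T2 K H (T2 K H y) = y := fun y => LinearMap.congr_fun hsq y
  have hne := trace_T2_ne (K := K) (H := H)
  have h10 : (1 : H) ≠ 0 := by
    intro h
    have := congrArg (Coalgebra.counit (R := K)) h
    simp at this
  have : Nontrivial H := ⟨1, 0, h10⟩
  have hn : (Module.finrank K H : K) ≠ 0 := by
    exact_mod_cast (Module.finrank_pos (R := K) (M := H)).ne'
  have hrT : ∀ x, rr K H (T2 K H x) = rr K H x := by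
    intro x
    have : LinearMap.mulLeft K (T2 K H x) = T2 K H * (LinearMap.mulLeft K x * T2 K H) := by
      ext y
      simp [T2_mul, hsq']
    rw [rr_apply, this, LinearMap.trace_mul_comm, mul_assoc, hsq, mul_one, rr_apply]
  have hrL : rr K H L = 1 := by
    have : LinearMap.mulLeft K L = (Coalgebra.counit (R := K)).smulRight L := by
      ext y
      simp [hL.right]
    rw [rr_apply, this, tr_rank_one, hL.one]
  have hcomm : Ef (rr K H) * T2 K H = T2 K H * Ef (rr K H) := by
    apply ext_dd
    intro i j
    simp only [Module.End.mul_apply, Ef_dd, map_sum, map_smul]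
    simp only [Ef, LinearMap.comp_apply, comul_T2_dd, map_sum, E1_tmul, hrT]
  set R := Ef (rr K H) with hR
  have hRR : R * R = (Module.finrank K H : K) • R := by
    rw [hR, Ef_mul]
    have : rr K H ∘ₗ Ef (rr K H) = (Module.finrank K H : K) • rr K H := by
      ext x; exact rr_conv x
    rw [this]
    ext x
    simp [Ef, E1, LinearMap.lTensor_smul]
  set P := (Module.finrank K H : K)⁻¹ • R with hP
  have hPP : P * P = P := by
    rw [hP, smul_mul_smul_comm, hRR, smul_smul]
    congr 1
    field_simp
  have hPT : P * T2 K H = T2 K H * P := by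
    rw [hP, smul_mul_assoc, mul_smul_comm, hcomm]
  have hW2 : P * T2 K H * (P * T2 K H) = P := by
    calc _ = (P * P) * (T2 K H * T2 K H) := by
            rw [mul_assoc, ← mul_assoc (T2 K H) P, ← hPT]; simp only [mul_assoc]
      _ = P := by rw [hsq, hPP, mul_one]
  have hWt : LinearMap.trace K H (P * T2 K H) = (Module.finrank K H : K)⁻¹ * LinearMap.trace K H (T2 K H) := by
    rw [hP, smul_mul_assoc, map_smul, hR, tr_EfT2 _ hL, hrL, mul_one, smul_eq_mul]
  rcases invol_eq (T2 K H) (P * T2 K H) hsq (by rw [hW2, ← mul_assoc, hPP])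
    (by rw [hWt]; field_simp) hne with h | h
  · exact h
  · exfalso
    have h1 := T2_one (K := K) (H := H)
    rw [h] at h1
    have h2 : (-1 : H) = 1 := by simpa using h1
    have := congrArg (Coalgebra.counit (R := K)) h2
    simp at this
    norm_num [neg_eq_iff_add_eq_zero] at this

theorem SS_SS (x : H) : SS (K := K) (SS (K := K) x) = x := LinearMap.congr_fun (T2_eq_one K H) x

end B6
end EvenHopf
end

section
open TensorProduct
set_option linter.unusedSectionVars false

namespace EvenHopf
section C1
variable {K H : Type*} [Field K] [Ring H] [HopfAlgebra K H] [FiniteDimensional K H]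

/-- `f(w₁) g(w₂)` -/
noncomputable def bl (f g : H →ₗ[K] K) : H ⊗[K] H →ₗ[K] K := LinearMap.mul' K K ∘ₗ TensorProduct.map f g

@[simp] theorem bl_tmul (f g : H →ₗ[K] K) (a b : H) : bl f g (a ⊗ₜ[K] b) = f a * g b := by simp [bl]

theorem bl_comul (f g : H →ₗ[K] K) (x : H) : bl f g (Coalgebra.comul (R := K) x) = f (Ef g x) := by
  have : bl f g ∘ₗ Coalgebra.comul (R := K) = f ∘ₗ Ef g := by
    apply ext_dd
    intro i j
    simp only [LinearMap.comp_apply, comul_dd, map_sum, bl_tmul, Ef_dd, map_smul, smul_eq_mul]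
    exact Finset.sum_congr rfl fun k _ => mul_comm _ _
  exact LinearMap.congr_fun this x

theorem bl_mul {ι κ : Type*} [Fintype ι] [Fintype κ] (f : ι → ι → H →ₗ[K] K) (g : κ → κ → H →ₗ[K] K)
    (hf : ∀ a b x y, f a b (x * y) = ∑ c, f a c x * f c b y) (hg : ∀ a b x y, g a b (x * y) = ∑ c, g a c x * g c b y)
    (a b : ι) (a' b' : κ) (w w' : H ⊗[K] H) :
    bl (f a b) (g a' b') (w * w') = ∑ c, ∑ c', bl (f a c) (g a' c') w * bl (f c b) (g c' b') w' := by
  induction w using TensorProduct.induction_on with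
  | zero => simp
  | tmul x y =>
    induction w' using TensorProduct.induction_on with
    | zero => simp
    | tmul x' y' =>
      simp only [Algebra.TensorProduct.tmul_mul_tmul, bl_tmul, hf, hg, Finset.sum_mul_sum]
      exact Finset.sum_congr rfl fun c _ => Finset.sum_congr rfl fun c' _ => by ring
    | add u v hu hv => simp only [mul_add, map_add, hu, hv, Finset.sum_add_distrib]
  | add u v hu hv => simp only [add_mul, map_add, hu, hv, Finset.sum_add_distrib]

theorem cv_mul {ι κ : Type*} [Fintype ι] [Fintype κ] (f : ι → ι → H →ₗ[K] K) (g : κ → κ → H →ₗ[K] K)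
    (hf : ∀ a b x y, f a b (x * y) = ∑ c, f a c x * f c b y) (hg : ∀ a b x y, g a b (x * y) = ∑ c, g a c x * g c b y)
    (a b : ι) (a' b' : κ) (x y : H) :
    f a b (Ef (g a' b') (x * y)) = ∑ c, ∑ c', f a c (Ef (g a' c') x) * f c b (Ef (g c' b') y) := by
  simp only [← bl_comul, Bialgebra.comul_mul, bl_mul f g hf hg]

theorem Ef_add (f g : H →ₗ[K] K) : Ef (f + g) = Ef f + Ef g := by
  ext x; simp [Ef, E1, LinearMap.lTensor_add]

theorem Ef_zero : Ef (0 : H →ₗ[K] K) = 0 := by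
  ext x; simp [Ef, E1]

theorem Ef_sum {ι : Type*} (s : Finset ι) (f : ι → H →ₗ[K] K) : Ef (∑ i ∈ s, f i) = ∑ i ∈ s, Ef (f i) := by
  classical
  induction s using Finset.induction_on with
  | empty => simp [Ef_zero]
  | insert a s ha ih => rw [Finset.sum_insert ha, Finset.sum_insert ha, Ef_add, ih]

theorem Ef_counit : Ef (Coalgebra.counit (R := K) (A := H)) = 1 := by
  ext x; exact E1_counit x

/-- colinear endomorphisms -/
def Col (F : Module.End K H) : Prop := Ef (Coalgebra.counit (R := K) ∘ₗ F) = F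

theorem col_Ef (f : H →ₗ[K] K) : Col (Ef f) := by rw [Col, counit_Ef]

theorem col_one : Col (1 : Module.End K H) := by
  rw [← Ef_counit]; exact col_Ef _

theorem Col.mul {F G : Module.End K H} (hF : Col F) (hG : Col G) : Col (F * G) := by
  rw [← hF, ← hG, Ef_mul]; exact col_Ef _

theorem col_sum {ι : Type*} (s : Finset ι) (F : ι → Module.End K H) (h : ∀ i ∈ s, Col (F i)) : Col (∑ i ∈ s, F i) := by
  rw [← Finset.sum_congr rfl h, ← Ef_sum]; exact col_Ef _

theorem col_list (l : List (Module.End K H)) (h : ∀ F ∈ l, Col F) : Col l.prod := by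
  induction l with
  | nil => simpa using col_one
  | cons a l ih =>
    rw [List.prod_cons]
    exact Col.mul (h _ (by simp)) (ih fun F hF => h F (by simp [hF]))

variable [IsAlgClosed K] [IsSemisimpleRing H] [CharZero K]

theorem Col.trace {L : H} (hL : IsInt K L) {F : Module.End K H} (hF : Col F) :
    LinearMap.trace K H F = (Module.finrank K H : K) * Coalgebra.counit (R := K) (F L) := by
  have := tr_EfT2 (Coalgebra.counit (R := K) ∘ₗ F) hL
  rw [T2_eq_one, mul_one, LinearMap.trace_one, hF] at this
  exact this

theorem finrank_ne : (Module.finrank K H : K) ≠ 0 := by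
  have h10 : (1 : H) ≠ 0 := by
    intro h
    have := congrArg (Coalgebra.counit (R := K)) h
    simp at this
  have : Nontrivial H := ⟨1, 0, h10⟩
  exact_mod_cast (Module.finrank_pos (R := K) (M := H)).ne'

theorem tau_comm {L : H} (hL : IsInt K L) {F G : Module.End K H} (hF : Col F) (hG : Col G) :
    Coalgebra.counit (R := K) ((F * G) L) = Coalgebra.counit (R := K) ((G * F) L) := by
  have h := LinearMap.trace_mul_comm K F G
  rw [(hF.mul hG).trace hL, (hG.mul hF).trace hL] at h
  exact mul_left_cancel₀ finrank_ne h

theorem rr_eq_lam : rr K H = lam K H := by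
  ext x
  rw [lam_apply, T2_eq_one, mul_one, rr_apply]

theorem rr_S (x : H) : rr K H (SS (K := K) x) = rr K H x := by
  obtain ⟨L, hL⟩ := exists_int K H
  rw [rr_eq_lam, lam_S hL, aa_eq_one hL, mul_one]

theorem rr_comm (x y : H) : rr K H (x * y) = rr K H (y * x) := by
  rw [rr_eq_lam, lam_comm, T2_eq_one]; rfl

end C1

section paths
variable {R : Type*} [Ring R] {ι : Type*} [Fintype ι] [DecidableEq ι]

/-- ordered product of entries -/
def FF (X : Matrix ι ι R) {N : ℕ} (x z : Fin N → ι) : R := (List.ofFn fun j => X (x j) (z j)).prod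

theorem FF_cons (X : Matrix ι ι R) {N : ℕ} (a b : ι) (x z : Fin N → ι) :
    FF X (Fin.cons a x : Fin (N+1) → ι) (Fin.cons b z : Fin (N+1) → ι) = X a b * FF X x z := by
  simp [FF, List.ofFn_succ]

theorem FF_snoc (X : Matrix ι ι R) {N : ℕ} (a b : ι) (x z : Fin N → ι) :
    FF X (Fin.snoc x a : Fin (N+1) → ι) (Fin.snoc z b : Fin (N+1) → ι) = FF X x z * X a b := by
  rw [FF, List.ofFn_succ', List.concat_eq_append, List.prod_append]
  simp [FF]

theorem sum_cons {M : Type*} [AddCommMonoid M] {N : ℕ} (g : (Fin (N+1) → ι) → M) :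
    ∑ y, g y = ∑ a, ∑ x : Fin N → ι, g (Fin.cons a x) := by
  rw [← (Fin.consEquiv fun _ => ι).sum_comp, Fintype.sum_prod_type]
  rfl

theorem pow_path (X : Matrix ι ι R) (k : ℕ) (a b : ι) :
    (X ^ (k+1)) a b = ∑ x : Fin k → ι, FF X (Fin.cons a x : Fin (k+1) → ι) (Fin.snoc x b : Fin (k+1) → ι) := by
  induction k generalizing a b with
  | zero => simp [FF, Fin.snoc]
  | succ k ih =>
    rw [pow_succ', Matrix.mul_apply, sum_cons]
    refine Finset.sum_congr rfl fun c _ => ?_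
    rw [ih, Finset.mul_sum]
    refine Finset.sum_congr rfl fun x _ => ?_
    rw [← Fin.cons_snoc_eq_snoc_cons, FF_cons]

theorem trace_path (X : Matrix ι ι R) (k : ℕ) :
    (X ^ (k+1)).trace = ∑ y : Fin (k+1) → ι, FF X y (y ∘ finRotate (k+1)) := by
  rw [sum_cons]
  refine Finset.sum_congr rfl fun a _ => ?_
  rw [Matrix.diag_apply, pow_path]
  refine Finset.sum_congr rfl fun x _ => ?_
  rw [Fin.snoc_eq_cons_rotate]
  rfl
end paths
end EvenHopf
end

section
open TensorProduct
set_option linter.unusedSectionVars false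

namespace EvenHopf
section C2
variable {K H : Type*} [Field K] [Ring H] [HopfAlgebra K H] [FiniteDimensional K H]
variable {ι : Type*} [Fintype ι] [DecidableEq ι] (ρ : H →ₐ[K] Matrix ι ι K)

/-- matrix coefficients -/
noncomputable def mc (i j : ι) : H →ₗ[K] K :=
  { toFun := fun h => ρ h i j
    map_add' := fun x y => by simp
    map_smul' := fun c x => by simp }

@[simp] theorem mc_apply (i j : ι) (h : H) : mc ρ i j h = ρ h i j := rfl

theorem mc_mul (a b : ι) (x y : H) : mc ρ a b (x * y) = ∑ c, mc ρ a c x * mc ρ c b y := by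
  simp [Matrix.mul_apply]

/-- matrix of operators -/
noncomputable def XX : Matrix ι ι (Module.End K H) := Matrix.of fun i j => Ef (mc ρ i j)

theorem col_FF {N : ℕ} (x z : Fin N → ι) : Col (FF (XX ρ) x z) := by
  apply col_list
  intro F hF
  rw [List.mem_ofFn] at hF
  obtain ⟨j, rfl⟩ := hF
  exact col_Ef _

/-- coefficients of the tensor power -/
noncomputable def ff {N : ℕ} (x z : Fin N → ι) : H →ₗ[K] K := Coalgebra.counit (R := K) ∘ₗ FF (XX ρ) x z

theorem Ef_ff {N : ℕ} (x z : Fin N → ι) : Ef (ff ρ x z) = FF (XX ρ) x z := col_FF ρ x z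

theorem ff_cons {N : ℕ} (a b : ι) (x z : Fin N → ι) (h : H) :
    ff ρ (Fin.cons a x : Fin (N+1) → ι) (Fin.cons b z : Fin (N+1) → ι) h = mc ρ a b (Ef (ff ρ x z) h) := by
  rw [ff, FF_cons, LinearMap.comp_apply, Module.End.mul_apply, Ef_ff]
  exact LinearMap.congr_fun (counit_Ef (mc ρ a b)) _

theorem ff_mul {N : ℕ} (x z : Fin N → ι) (h h' : H) : ff ρ x z (h * h') = ∑ y, ff ρ x y h * ff ρ y z h' := by
  induction N generalizing h h' with
  | zero => simp [ff, FF]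
  | succ N ih =>
    rw [← Fin.cons_self_tail x, ← Fin.cons_self_tail z, ff_cons, sum_cons]
    simp only [ff_cons]
    rw [cv_mul (mc ρ) (fun x z => ff ρ x z) (mc_mul ρ) (fun a b x y => ih a b x y)]

/-- the projection -/
noncomputable def PP (L : H) (N : ℕ) : Matrix (Fin N → ι) (Fin N → ι) K := Matrix.of fun x z => ff ρ x z L

theorem PP_idem {L : H} (hL : IsInt K L) (N : ℕ) : PP ρ L N * PP ρ L N = PP ρ L N := by
  ext x z
  simp only [Matrix.mul_apply, PP, Matrix.of_apply]
  rw [← ff_mul, hL.left, hL.one, one_smul]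

variable [IsAlgClosed K] [IsSemisimpleRing H] [CharZero K]

theorem PP_rot {L : H} (hL : IsInt K L) (k : ℕ) (x z : Fin (k+1) → ι) :
    PP ρ L (k+1) (x ∘ finRotate (k+1)) (z ∘ finRotate (k+1)) = PP ρ L (k+1) x z := by
  have h : ∀ x : Fin (k+1) → ι, x ∘ finRotate (k+1) = (Fin.snoc (Fin.tail x) (x 0) : Fin (k+1) → ι) := by
    intro x
    rw [Fin.snoc_eq_cons_rotate]
    funext j
    simp only [Fin.cons_self_tail, Function.comp]
  rw [h x, h z]
  conv_rhs => rw [← Fin.cons_self_tail x, ← Fin.cons_self_tail z]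
  simp only [PP, Matrix.of_apply, ff, LinearMap.comp_apply]
  rw [FF_cons, FF_snoc]
  exact tau_comm hL (col_FF ρ _ _) (col_Ef _)

theorem PP_rot_pow {L : H} (hL : IsInt K L) (k m : ℕ) (x z : Fin (k+1) → ι) :
    PP ρ L (k+1) (x ∘ ((finRotate (k+1))^m : Equiv.Perm _)) (z ∘ ((finRotate (k+1))^m : Equiv.Perm _)) = PP ρ L (k+1) x z := by
  induction m generalizing x z with
  | zero => rfl
  | succ m ih =>
    rw [pow_succ, Equiv.Perm.coe_mul, ← Function.comp_assoc, ← Function.comp_assoc, PP_rot ρ hL, ih]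

/-- the twisted projection -/
noncomputable def QQ (L : H) (k : ℕ) : Matrix (Fin (k+1) → ι) (Fin (k+1) → ι) K :=
  Matrix.of fun x z => PP ρ L (k+1) x (z ∘ finRotate (k+1))

theorem QQ_pow {L : H} (hL : IsInt K L) (k m : ℕ) (x z : Fin (k+1) → ι) :
    (QQ ρ L k ^ (m+1)) x z = PP ρ L (k+1) x (z ∘ ((finRotate (k+1))^(m+1) : Equiv.Perm _)) := by
  induction m generalizing x z with
  | zero => simp [QQ]
  | succ m ih =>
    rw [pow_succ, Matrix.mul_apply]
    simp only [ih]
    conv_rhs => rw [← PP_idem ρ hL, Matrix.mul_apply,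
      ← (Equiv.arrowCongr ((finRotate (k+1))^(m+1) : Equiv.Perm _).symm (Equiv.refl ι)).sum_comp]
    refine Finset.sum_congr rfl fun y _ => ?_
    have e : (Equiv.arrowCongr ((finRotate (k+1))^(m+1) : Equiv.Perm _).symm (Equiv.refl ι)) y = y ∘ ((finRotate (k+1))^(m+1) : Equiv.Perm _) := by
      funext j; rfl
    rw [e]
    congr 1
    have e' : QQ ρ L k y z = PP ρ L (k+1) y (z ∘ finRotate (k+1)) := rfl
    rw [e', ← PP_rot_pow ρ hL k (m+1) y, Function.comp_assoc, ← Equiv.Perm.coe_mul, ← pow_succ']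

theorem QQ_pow_succ {L : H} (hL : IsInt K L) (k : ℕ) : ∃ m, 1 ≤ m ∧ QQ ρ L k ^ (m+1) = QQ ρ L k := by
  refine ⟨orderOf (finRotate (k+1)), orderOf_pos _, ?_⟩
  ext x z
  rw [QQ_pow ρ hL, pow_succ', pow_orderOf_eq_one, mul_one]
  rfl

theorem QQ_integral {L : H} (hL : IsInt K L) (k : ℕ) : IsIntegral ℤ (QQ ρ L k).trace := by
  obtain ⟨m, hm, h⟩ := QQ_pow_succ ρ hL k
  exact trace_integral_of_pow hm _ h

/-- big block matrix -/
noncomputable def TT : Matrix (ι × Ix K H) (ι × Ix K H) K :=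
  Matrix.compRingEquiv ι (Ix K H) K ((LinearMap.toMatrixAlgEquiv (ee K H)).toRingEquiv.mapMatrix (XX ρ))

theorem TT_trace_pow {L : H} (hL : IsInt K L) (k : ℕ) :
    (TT ρ ^ (k+1)).trace = (Module.finrank K H : K) * (QQ ρ L k).trace := by
  have h1 : (TT ρ ^ (k+1)).trace = ∑ i, LinearMap.trace K H ((XX ρ ^ (k+1)) i i) := by
    rw [TT, ← map_pow, ← map_pow]
    simp only [Matrix.trace, Matrix.diag, Fintype.sum_prod_type]
    refine Finset.sum_congr rfl fun i _ => ?_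
    rw [LinearMap.trace_eq_matrix_trace K (ee K H)]
    rfl
  rw [h1, ← map_sum]
  have h2 : ∑ i, (XX ρ ^ (k+1)) i i = (XX ρ ^ (k+1)).trace := rfl
  rw [h2, trace_path, Col.trace hL (col_sum _ _ fun y _ => col_FF ρ _ _)]
  congr 1
  rw [LinearMap.sum_apply, map_sum]
  rfl

theorem nat_even_of_integral {N : ℕ} {z : K} (hz : IsIntegral ℤ z) (h : (N : K) = 2 * z) : Even N := by
  have hz' : z = algebraMap ℚ K ((N : ℚ) / 2) := by
    rw [map_div₀]
    simp [h]
  rw [hz', isIntegral_algebraMap_iff (algebraMap ℚ K).injective, IsIntegrallyClosed.isIntegral_iff] at hz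
  obtain ⟨y, hy⟩ := hz
  have : (N : ℚ) = 2 * y := by
    have : (y : ℚ) = N / 2 := hy
    rw [this]; ring
  have : (N : ℤ) = 2 * y := by exact_mod_cast this
  rw [← Int.even_coe_nat, this]
  exact even_two_mul y

theorem selfdual {L : H} (hL : IsInt K L) (h0 : (ρ L).trace = 0)
    (h1 : (∑ i, mc ρ i i) (Ef (∑ i, mc ρ i i) L) = 1) : Even (Module.finrank K H) := by
  have hn : IsIntegral ℤ (Module.finrank K H : K) := by
    have := isIntegral_algebraMap (R := ℤ) (A := K) (x := (Module.finrank K H : ℤ))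
    simpa using this
  obtain ⟨z, hz, e1⟩ := trace_sq_of_integral (TT ρ) (fun k hk => by
    obtain ⟨k, rfl⟩ : ∃ k', k = k' + 1 := ⟨k - 1, by omega⟩
    rw [TT_trace_pow ρ hL]
    exact hn.mul (QQ_integral ρ hL k))
  have e2 : (TT ρ).trace = 0 := by
    have h3 : (TT ρ ^ 1).trace = _ := TT_trace_pow ρ hL 0
    rw [pow_one] at h3
    rw [h3]
    have : (QQ ρ L 0).trace = (ρ L).trace := by
      rw [Matrix.trace, Matrix.trace, ← (Equiv.funUnique (Fin 1) ι).symm.sum_comp]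
      refine Finset.sum_congr rfl fun i _ => ?_
      simp [QQ, PP, ff, FF, XX]
      exact LinearMap.congr_fun (counit_Ef (mc ρ i i)) _
    rw [this, h0, mul_zero]
  have e3 := TT_trace_pow ρ hL 1
  norm_num at e3
  have hrot : (finRotate 2)^2 = 1 := by decide
  have hQ2 : QQ ρ L 1 ^ 2 = PP ρ L 2 := by
    ext x z
    have := QQ_pow ρ hL 1 1 x z
    norm_num at this
    rw [this, hrot]; rfl
  have hQ3 : QQ ρ L 1 ^ 3 = QQ ρ L 1 := by
    ext x z
    have := QQ_pow ρ hL 1 2 x z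
    norm_num at this
    rw [this, pow_succ, hrot, one_mul]; rfl
  obtain ⟨z', hz', e4⟩ := trace_sq_of_integral (QQ ρ L 1) (fun k hk => by
    refine trace_integral_of_pow (k := 2) (by norm_num) _ ?_
    rw [← pow_mul, mul_comm, pow_mul, hQ3])
  have e5 : (QQ ρ L 1 ^ 2).trace = 1 := by
    rw [hQ2, ← h1, Matrix.trace, sum_cons, Ef_sum, LinearMap.sum_apply, LinearMap.sum_apply]
    refine Finset.sum_congr rfl fun a _ => ?_
    rw [map_sum, ← (Equiv.funUnique (Fin 1) ι).symm.sum_comp]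
    refine Finset.sum_congr rfl fun b _ => ?_
    rw [Matrix.diag_apply, PP, Matrix.of_apply, ff_cons, Ef_ff]
    simp [FF, XX]
  rw [e5] at e4
  rw [e2, e3] at e1
  set n : K := (Module.finrank K H : K) with hnn
  set ν := (QQ ρ L 1).trace
  have hfin : ((Module.finrank K H ^ 2 : ℕ) : K) = 2 * (2 * (z * z) - n * n * z') := by
    push_cast
    rw [← hnn]
    have a1 : ν ^ 2 = 1 + 2 * z' := by linear_combination e4
    have a2 : n * ν = - (2 * z) := by linear_combination -e1
    linear_combination (n * ν - 2 * z) * a2 - n ^ 2 * a1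
  have h2i : IsIntegral ℤ (2 : K) := by
    have := isIntegral_algebraMap (R := ℤ) (A := K) (x := 2)
    simpa using this
  have := nat_even_of_integral (((h2i.mul (hz.mul hz))).sub ((hn.mul hn).mul hz')) hfin
  rw [Nat.even_pow] at this
  exact this.1

end C2
end EvenHopf
end

section
open TensorProduct
set_option linter.unusedSectionVars false

namespace EvenHopf
section C3
variable {K H : Type*} [Field K] [Ring H] [HopfAlgebra K H] [FiniteDimensional K H]
variable {ι : Type*} [Fintype ι] [DecidableEq ι] (ρ : H →ₐ[K] Matrix ι ι K)

/-- character -/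
noncomputable def chi : H →ₗ[K] K := ∑ i, mc ρ i i

theorem chi_apply (h : H) : chi ρ h = (ρ h).trace := by
  simp [chi, Matrix.trace]

/-- averaging -/
noncomputable def Th (B : Matrix ι ι K) : H ⊗[K] H →ₗ[K] Matrix ι ι K :=
  LinearMap.mul' K (Matrix ι ι K) ∘ₗ TensorProduct.map (LinearMap.mulRight K B ∘ₗ ρ.toLinearMap) (ρ.toLinearMap ∘ₗ SS (K := K))

@[simp] theorem Th_tmul (B : Matrix ι ι K) (a b : H) : Th ρ B (a ⊗ₜ[K] b) = ρ a * B * ρ (SS (K := K) b) := by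
  simp [Th]

theorem Th_left (B : Matrix ι ι K) (h : H) (w : H ⊗[K] H) : Th ρ B ((h ⊗ₜ[K] (1:H)) * w) = ρ h * Th ρ B w := by
  induction w using TensorProduct.induction_on with
  | zero => simp
  | tmul x y => simp [mul_assoc]
  | add x y hx hy => simp only [mul_add, map_add, hx, hy]

theorem Th_right (B : Matrix ι ι K) (h : H) (w : H ⊗[K] H) : Th ρ B (((1:H) ⊗ₜ[K] h) * w) = Th ρ B w * ρ (SS (K := K) h) := by
  induction w using TensorProduct.induction_on with
  | zero => simp
  | tmul x y => simp [mul_assoc, S_mul]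
  | add x y hx hy => simp only [mul_add, add_mul, map_add, hx, hy]

variable [IsAlgClosed K] [IsSemisimpleRing H] [CharZero K]

theorem Th_comm {L : H} (hL : IsInt K L) (B : Matrix ι ι K) (h : H) :
    ρ h * Th ρ B (Coalgebra.comul (R := K) L) = Th ρ B (Coalgebra.comul (R := K) L) * ρ h := by
  have := hL.comul_left (SS (K := K) h)
  rw [SS_SS] at this
  rw [← Th_left, ← this, Th_right, SS_SS]

theorem Th_trace {L : H} (hL : IsInt K L) (B : Matrix ι ι K) :
    (Th ρ B (Coalgebra.comul (R := K) L)).trace = B.trace := by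
  have key : ∀ x : H, (Th ρ B (Coalgebra.comul (R := K) x)).trace = Coalgebra.counit (R := K) x * B.trace := by
    have : Matrix.traceLinearMap ι K K ∘ₗ Th ρ B ∘ₗ Coalgebra.comul (R := K) = (Coalgebra.counit (R := K) (A := H)).smulRight B.trace := by
      apply ext_dd
      intro i j
      simp only [LinearMap.comp_apply, comul_dd, map_sum, Th_tmul, Matrix.traceLinearMap_apply, LinearMap.smulRight_apply, counit_dd]
      have e : ∀ k : Ix K H, (ρ (dd i k) * B * ρ (SS (K := K) (dd k j))).trace = (B * ρ (SS (K := K) (dd k j) * dd i k)).trace := by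
        intro k
        rw [mul_assoc, Matrix.trace_mul_comm, map_mul, mul_assoc]
      simp only [e]
      rw [← Matrix.trace_sum, ← Finset.mul_sum, ← map_sum]
      have e2 : ∑ k, SS (K := K) (dd k j) * dd i k = if i = j then (1:H) else 0 := by
        have := congrArg (SS (K := K)) (S_mul_dd (K := K) (H := H) i j)
        rw [map_sum] at this
        simp only [S_mul, SS_SS] at this
        rw [this]
        split_ifs <;> simp
      rw [e2]
      split_ifs <;> simp
    intro x
    exact LinearMap.congr_fun this x
  rw [key, hL.one, one_mul]

theorem schur {L : H} (hL : IsInt K L) [Nonempty ι]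
    (hρ : ∀ B : Matrix ι ι K, (∀ h, ρ h * B = B * ρ h) → ∃ c : K, B = c • 1) :
    chi ρ (Ef (chi ρ ∘ₗ SS (K := K)) L) = 1 := by
  choose c hc using fun B => hρ (Th ρ B (Coalgebra.comul (R := K) L)) (Th_comm ρ hL B)
  have hcard : (Fintype.card ι : K) ≠ 0 := by exact_mod_cast Fintype.card_ne_zero
  have hcB : ∀ B, c B * (Fintype.card ι : K) = B.trace := by
    intro B
    rw [← Th_trace ρ hL B, hc B, Matrix.trace_smul, Matrix.trace_one, smul_eq_mul]
  have key : ∀ w, bl (chi ρ) (chi ρ ∘ₗ SS (K := K)) w = ∑ i, ∑ j, (Th ρ (Matrix.single i j 1) w) i j := by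
    intro w
    induction w using TensorProduct.induction_on with
    | zero => simp
    | tmul x y =>
      simp only [bl_tmul, LinearMap.comp_apply, chi_apply, Th_tmul, Matrix.trace, Matrix.diag, Finset.sum_mul_sum]
      refine Finset.sum_congr rfl fun i _ => Finset.sum_congr rfl fun j _ => ?_
      simp [Matrix.mul_apply, Matrix.single_apply, ite_and]
    | add x y hx hy => simp only [map_add, hx, hy, Matrix.add_apply, Finset.sum_add_distrib]
  rw [← bl_comul, key]
  simp only [hc, Matrix.smul_apply, Matrix.one_apply, smul_eq_mul, mul_ite, mul_one, mul_zero, Finset.sum_ite_eq, Finset.mem_univ, if_true]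
  have : ∀ i : ι, c (Matrix.single i i 1) = (Fintype.card ι : K)⁻¹ := by
    intro i
    have := hcB (Matrix.single i i 1)
    rw [Matrix.trace_single_eq_same] at this
    exact eq_inv_of_mul_eq_one_left this
  simp [this, hcard]

theorem chiM_S (x : H) : chi ρ (Ef (chi ρ ∘ₗ SS (K := K)) (SS (K := K) x)) = chi ρ (Ef (chi ρ ∘ₗ SS (K := K)) x) := by
  have : (chi ρ ∘ₗ Ef (chi ρ ∘ₗ SS (K := K))) ∘ₗ SS (K := K) = chi ρ ∘ₗ Ef (chi ρ ∘ₗ SS (K := K)) := by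
    apply ext_dd
    intro i j
    simp only [LinearMap.comp_apply]
    rw [← bl_comul, ← bl_comul, comul_S_dd, comul_dd]
    simp only [map_sum, bl_tmul, LinearMap.comp_apply, SS_SS]
    exact Finset.sum_congr rfl fun k _ => mul_comm _ _
  exact LinearMap.congr_fun this x

theorem chiM_idem (e : H) (he : e * e = e) : ∃ m : ℕ, chi ρ (Ef (chi ρ ∘ₗ SS (K := K)) e) = m := by
  let g : ι → ι → H →ₗ[K] K := fun a b => mc ρ b a ∘ₗ SS (K := K)
  have hg : ∀ a b x y, g a b (x * y) = ∑ c, g a c x * g c b y := by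
    intro a b x y
    simp only [g, LinearMap.comp_apply, S_mul, mc_mul]
    exact Finset.sum_congr rfl fun k _ => mul_comm _ _
  let M : Matrix (ι × ι) (ι × ι) K := Matrix.of fun p q => mc ρ p.1 q.1 (Ef (g p.2 q.2) e)
  have hM : M * M = M := by
    ext p q
    rw [Matrix.mul_apply, Fintype.sum_prod_type]
    simp only [M, Matrix.of_apply]
    rw [← cv_mul (mc ρ) g (mc_mul ρ) hg, he]
  obtain ⟨m, hm⟩ := trace_idem M hM
  refine ⟨m, ?_⟩
  rw [← hm, Matrix.trace, Fintype.sum_prod_type]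
  have : chi ρ ∘ₗ SS (K := K) = ∑ i, g i i := by
    ext x
    simp [chi, g]
  rw [this, Ef_sum, LinearMap.sum_apply, map_sum, Finset.sum_comm]
  refine Finset.sum_congr rfl fun i _ => ?_
  simp [chi, M]

theorem chiM_one : chi ρ (Ef (chi ρ ∘ₗ SS (K := K)) 1) = (Fintype.card ι : K) ^ 2 := by
  rw [← bl_comul, Bialgebra.comul_one, Algebra.TensorProduct.one_def, bl_tmul, LinearMap.comp_apply, S_one, chi_apply, map_one, Matrix.trace_one, sq]

end C3

section C4
variable {K H : Type*} [Field K] [Ring H] [HopfAlgebra K H] [FiniteDimensional K H]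
variable [IsAlgClosed K] [IsSemisimpleRing H] [CharZero K]

theorem rr_pi {n : ℕ} (d : Fin n → ℕ) (φ : H ≃ₐ[K] (∀ i, Matrix (Fin (d i)) (Fin (d i)) K)) (x : H) :
    rr K H x = ∑ i, (φ x i).trace * (d i : K) := by
  have h := trace_pi_mul d (φ x) 1
  simp only [Pi.one_apply, Matrix.trace_one, Fintype.card_fin] at h
  rw [← h, rr_apply, ← LinearMap.trace_conj' _ φ.toLinearEquiv]
  congr 1
  refine LinearMap.ext fun y => ?_
  simp only [LinearEquiv.conj_apply, LinearMap.comp_apply, Module.End.mul_apply, LinearMap.mulLeft_apply, LinearMap.mulRight_apply, LinearEquiv.coe_coe]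
  have e1 : φ.toLinearEquiv.symm y = φ.symm y := rfl
  have e2 : ∀ z, φ.toLinearEquiv z = φ z := fun z => rfl
  rw [e1, e2]
  simp

theorem scalar_of_comm {N : ℕ} (M : Matrix (Fin N) (Fin N) K) (h : ∀ X : Matrix (Fin N) (Fin N) K, X * M = M * X) :
    ∃ c : K, M = c • 1 := by
  have : M ∈ Set.range (Matrix.scalar (Fin N)) := by
    apply Matrix.mem_range_scalar_of_commute_single
    intro a b _
    exact h _
  obtain ⟨c, hc⟩ := this
  exact ⟨c, by rw [← hc, Matrix.smul_one_eq_diagonal]; rfl⟩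

theorem central_idem {N : ℕ} (M : Matrix (Fin N) (Fin N) K) (h : ∀ X : Matrix (Fin N) (Fin N) K, X * M = M * X)
    (hM : M * M = M) (h0 : M ≠ 0) : M = 1 := by
  obtain ⟨c, rfl⟩ := scalar_of_comm M h
  have hc : c ≠ 0 := by rintro rfl; simp at h0
  have h1 : (1 : Matrix (Fin N) (Fin N) K) ≠ 0 := by intro h1; simp [h1] at h0
  rw [smul_mul_smul_comm, one_mul] at hM
  have := smul_left_injective K h1 hM
  have : c = 1 := mul_left_cancel₀ hc (by simpa using this)
  rw [this, one_smul]

theorem main_matrix {ι : Type*} [Fintype ι] [DecidableEq ι] [Nonempty ι] (ρ : H →ₐ[K] Matrix ι ι K)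
    (hρ : ∀ B : Matrix ι ι K, (∀ h, ρ h * B = B * ρ h) → ∃ c : K, B = c • 1)
    (hι : Even (Fintype.card ι)) : Even (Module.finrank K H) := by
  by_contra hodd
  obtain ⟨L, hL⟩ := exists_int K H
  obtain ⟨n, d, hd, ⟨φ⟩⟩ := IsSemisimpleRing.exists_algEquiv_pi_matrix_of_isAlgClosed K H
  let e : Fin n → H := fun i => φ.symm (Pi.single i 1)
  have hφe : ∀ i, φ (e i) = Pi.single i 1 := fun i => by simp [e]
  have hone : ∀ i, (1 : Matrix (Fin (d i)) (Fin (d i)) K) ≠ 0 := by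
    intro i
    have := hd i
    exact one_ne_zero
  have hee : ∀ i, e i * e i = e i := by
    intro i
    apply φ.injective
    rw [map_mul, hφe, ← Pi.single_mul, one_mul]
  have hec : ∀ i x, e i * x = x * e i := by
    intro i x
    apply φ.injective
    rw [map_mul, map_mul, hφe]
    funext j
    by_cases hj : j = i
    · subst hj; simp
    · simp [hj]
  have hcmp : ∀ i x, φ (x * e i) = Pi.single i (φ x i) := by
    intro i x
    rw [map_mul, hφe]
    funext j
    by_cases hj : j = i
    · subst hj; simp
    · simp [hj]
  have hsum : ∑ i, e i = 1 := by
    apply φ.injective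
    rw [map_sum, map_one]
    simp only [hφe]
    exact Finset.univ_sum_single (1 : ∀ i, Matrix (Fin (d i)) (Fin (d i)) K)
  -- a central idempotent supported on one block
  have hblock : ∀ i x, (∀ y, y * x = x * y) → x * x = x → x ≠ 0 → x * e i = x → x = e i := by
    intro i x hxc hxx hx0 hxe
    have h1 := hcmp i x
    rw [hxe] at h1
    have h2 : φ x i = 1 := by
      apply central_idem
      · intro X
        have := congrFun (congrArg φ (hxc (φ.symm (Pi.single i X)))) i
        simpa using this
      · have := congrFun (congrArg φ hxx) i
        simpa using this
      · intro h0
        apply hx0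
        apply φ.injective
        rw [h1, h0]; simp
    apply φ.injective
    rw [h1, h2, hφe]
  have hcomp1 : ∀ x, (∀ y, y * x = x * y) → x * x = x → x ≠ 0 → ∃ i, x * e i = e i := by
    intro x hxc hxx hx0
    have : ∃ i, φ x i ≠ 0 := by
      by_contra hcon
      push Not at hcon
      apply hx0
      apply φ.injective
      rw [map_zero]
      funext i
      exact hcon i
    obtain ⟨i, hi⟩ := this
    refine ⟨i, ?_⟩
    apply φ.injective
    rw [hcmp, hφe]
    congr 1
    apply central_idem _ _ _ hi
    · intro X
      have := congrFun (congrArg φ (hxc (φ.symm (Pi.single i X)))) i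
      simpa using this
    · have := congrFun (congrArg φ hxx) i
      simpa using this
  have hLc : ∀ y, y * L = L * y := fun y => by rw [hL.left, hL.right]
  have hLL : L * L = L := by rw [hL.left, hL.one, one_smul]
  have hL0 : L ≠ 0 := by
    intro h
    have := hL.one
    rw [h, map_zero] at this
    exact zero_ne_one this
  have he0 : ∀ i, e i ≠ 0 := by
    intro i h
    have := hφe i
    rw [h, map_zero] at this
    have := congrFun this i
    simp only [Pi.zero_apply, Pi.single_eq_same] at this
    exact hone i this.symm
  obtain ⟨i₀, hi₀⟩ : ∃ i₀, e i₀ = L := by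
    obtain ⟨i, hi⟩ := hcomp1 L hLc hLL hL0
    refine ⟨i, ?_⟩
    have h1 : e i = Coalgebra.counit (R := K) (e i) • L := by rw [← hL.right, hi]
    have h2 : Coalgebra.counit (R := K) (e i) ≠ 0 := by
      intro h; rw [h, zero_smul] at h1; exact he0 i h1
    have h3 : Coalgebra.counit (R := K) (e i) = 1 := by
      have := congrArg (Coalgebra.counit (R := K)) (hee i)
      rw [Bialgebra.counit_mul] at this
      exact mul_left_cancel₀ h2 (by rw [this, mul_one])
    rw [h1, h3, one_smul]
  have hstar : ∀ i, ∃ j, SS (K := K) (e i) = e j := by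
    intro i
    have hSc : ∀ x : H, (∀ y, y * x = x * y) → ∀ y, y * SS (K := K) x = SS (K := K) x * y := by
      intro x hx y
      have := congrArg (SS (K := K)) (hx (SS (K := K) y))
      rw [S_mul, S_mul, SS_SS] at this
      exact this.symm
    have hSi : ∀ x : H, x * x = x → SS (K := K) x * SS (K := K) x = SS (K := K) x := by
      intro x hx; rw [← S_mul, hx]
    have hS0 : ∀ x : H, x ≠ 0 → SS (K := K) x ≠ 0 := by
      intro x hx h
      apply hx
      rw [← SS_SS (K := K) x, h, map_zero]
    obtain ⟨j, hj⟩ := hcomp1 (SS (K := K) (e i)) (hSc _ fun y => (hec i y).symm) (hSi _ (hee i)) (hS0 _ (he0 i))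
    refine ⟨j, ?_⟩
    have h1 := congrArg (SS (K := K)) hj
    rw [S_mul, SS_SS] at h1
    have h2 := hblock i (SS (K := K) (e j)) (hSc _ fun y => (hec j y).symm) (hSi _ (hee j)) (hS0 _ (he0 j)) h1
    rw [← h2, SS_SS]
  choose st hst using hstar
  have hinj : Function.Injective e := by
    intro i j hij
    by_contra hne
    have h := congrFun (congrArg φ hij) i
    rw [hφe, hφe, Pi.single_eq_same, Pi.single_eq_of_ne hne] at h
    exact hone i h
  have hstst : ∀ i, st (st i) = i := by
    intro i
    apply hinj
    rw [← hst, ← hst, SS_SS]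
  -- no nontrivial self dual block
  have hns : ∀ i, i ≠ i₀ → st i ≠ i := by
    intro i hi hsi
    apply hodd
    have := hd i
    let π : H →ₐ[K] Matrix (Fin (d i)) (Fin (d i)) K := (Pi.evalAlgHom K _ i).comp φ.toAlgHom
    have hπ : ∀ x, π x = φ x i := fun x => rfl
    have hdi : (d i : K) ≠ 0 := by exact_mod_cast NeZero.ne (d i)
    have hchi : ∀ x, rr K H (x * e i) = chi π x * d i := by
      intro x
      rw [rr_pi d φ, hcmp, Finset.sum_eq_single i, Pi.single_eq_same, chi_apply, hπ]
      · intro j _ hj; simp [hj]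
      · simp
    have hS : chi π ∘ₗ SS (K := K) = chi π := by
      ext x
      rw [LinearMap.comp_apply]
      apply mul_right_cancel₀ hdi
      rw [← hchi, ← hchi]
      have : e i = SS (K := K) (e i) := by rw [hst, hsi]
      conv_lhs => rw [this]
      rw [← S_mul, rr_S, rr_comm]
    refine selfdual π hL ?_ ?_
    · rw [hπ, ← hi₀, hφe, Pi.single_eq_of_ne hi, Matrix.trace_zero]
    · have h := schur π hL (by
        intro B hB
        apply scalar_of_comm
        intro X
        have := hB (φ.symm (Pi.single i X))
        rw [hπ] at this
        simpa using this)
      rw [hS] at h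
      exact h
  choose m hm using fun i => chiM_idem ρ (e i) (hee i)
  have hm0 : m i₀ = 1 := by
    have := hm i₀
    rw [hi₀, schur ρ hL hρ] at this
    exact_mod_cast this.symm
  have hmst : ∀ i, m (st i) = m i := by
    intro i
    have := hm (st i)
    rw [← hst, chiM_S, hm] at this
    exact_mod_cast this.symm
  have htot : ∑ i, m i = Fintype.card ι ^ 2 := by
    have := chiM_one (K := K) (H := H) ρ
    rw [← hsum, map_sum, map_sum] at this
    simp only [hm] at this
    exact_mod_cast this
  have hz : ∑ i ∈ Finset.univ.erase i₀, (m i : ZMod 2) = 0 := by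
    have hst0 : st i₀ = i₀ := by
      apply hinj
      rw [← hst, hi₀, hL.S_eq]
    refine Finset.sum_involution (fun i _ => st i) ?_ ?_ ?_ ?_
    · intro i _
      rw [hmst]
      exact CharTwo.add_self_eq_zero _
    · intro i hi _
      exact hns i (Finset.ne_of_mem_erase hi)
    · intro i hi
      refine Finset.mem_erase.mpr ⟨?_, Finset.mem_univ _⟩
      intro h
      apply Finset.ne_of_mem_erase hi
      rw [← hstst i, h, hst0]
    · intro i _
      exact hstst i
  have h1 : ((∑ i, m i : ℕ) : ZMod 2) = 1 := by
    rw [Nat.cast_sum, ← Finset.add_sum_erase _ _ (Finset.mem_univ i₀), hz, hm0]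
    simp
  rw [htot] at h1
  have h2 : Even (Fintype.card ι ^ 2) := hι.pow_of_ne_zero two_ne_zero
  rw [(ZMod.natCast_eq_zero_iff_even).mpr h2] at h1
  exact zero_ne_one h1

end C4
end EvenHopf
end

/-- Let `H` be a semisimple Hopf algebra over an algebraically closed
field of characteristic zero.  If `H` has a simple module of even dimension, then the
dimension of `H` is even. -/
theorem even_dim_simple_module_even_dim_hopf
    {K H : Type*} [Field K] [IsAlgClosed K] [CharZero K]
    [Ring H] [HopfAlgebra K H] [FiniteDimensional K H]
    [IsSemisimpleRing H]
    (V : Type*) [AddCommGroup V] [Module K V] [Module H V]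
    [IsScalarTower K H V] [FiniteDimensional K V]
    [IsSimpleModule H V]
    (hV : Even (Module.finrank K V)) :
    Even (Module.finrank K H) := by
  have : Nontrivial V := IsSimpleModule.nontrivial H V
  have : NeZero (Module.finrank K V) := ⟨(Module.finrank_pos (R := K) (M := V)).ne'⟩
  let b := Module.finBasis K V
  let ρ : H →ₐ[K] Matrix (Fin (Module.finrank K V)) (Fin (Module.finrank K V)) K :=
    (LinearMap.toMatrixAlgEquiv b).toAlgHom.comp (Algebra.lsmul K K V)
  refine EvenHopf.main_matrix ρ ?_ (by simpa using hV)
  intro B hB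
  let F : Module.End K V := (LinearMap.toMatrixAlgEquiv b).symm B
  have hF : LinearMap.toMatrixAlgEquiv b F = B := by simp [F]
  have hc : ∀ (h : H) (v : V), h • F v = F (h • v) := by
    intro h v
    have h1 := hB h
    have h2 : ρ h = LinearMap.toMatrixAlgEquiv b (Algebra.lsmul K K V h) := rfl
    rw [h2, ← hF, ← map_mul, ← map_mul] at h1
    exact LinearMap.congr_fun ((LinearMap.toMatrixAlgEquiv b).injective h1) v
  let G : Module.End H V := { toFun := F, map_add' := F.map_add, map_smul' := fun h v => (hc h v).symm }
  obtain ⟨c, hcG⟩ := (IsSimpleModule.algebraMap_end_bijective_of_isAlgClosed (A := H) (V := V) K).2 G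
  refine ⟨c, ?_⟩
  rw [← hF]
  have : F = c • 1 := by
    ext v
    have := LinearMap.congr_fun hcG v
    exact this.symm
  rw [this, map_smul, map_one]
end
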